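/- arXiv:0906.2364 — 2 statements merged into one kernel-verified Lean document; each statement's English description precedes it below -/
import Mathlib

section
/- Fix an integer d > 0. Then there exists a finite set of primes e(d) such that for every prime p not in e(d) and every homogeneous polynomial f of degree d over the field ℚ_p of p-adic numbers in n variables with n > d², f has a nontrivial zero over ℚ_p (i.e., there exists a nonzero vector x ∈ ℚ_p^n with f(x) = 0). -/
namespace AK
open Polynomial

/-- A valued field with coefficient field, cross section, a Newton-Hensel property and
countable spherical completeness. -/
structure CF (k Γ K : Type*) [Field k] [LinearOrderedCommGroupWithZero Γ] [Field K] where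
  v : Valuation K Γ
  ι : k →+* K
  s : Γ →*₀ K
  v_ι : ∀ α, α ≠ 0 → v (ι α) = 1
  v_s : ∀ γ, v (s γ) = γ
  lead : ∀ a, a ≠ 0 → ∃ α, α ≠ 0 ∧ v (a - ι α * s (v a)) < v a
  newton : ∀ (Q : K[X]) (w : K), (taylor w Q).coeff 1 ≠ 0 →
    (∀ i, 2 ≤ i → v ((taylor w Q).coeff i) * v (Q.eval w) ^ (i - 1) <
      v ((taylor w Q).coeff 1) ^ i) →
    ∃ z, Q.eval z = 0 ∧ v (z - w) * v ((taylor w Q).coeff 1) ≤ v (Q.eval w)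
  sph : ∀ (c : ℕ → K) (δ : ℕ → Γ), (∀ n, ∃ y, ∀ i ≤ n, v (y - c i) ≤ δ i) →
    ∃ y, ∀ i, v (y - c i) ≤ δ i

section val
variable {Γ F : Type*} [LinearOrderedCommGroupWithZero Γ] [Field F] (v : Valuation F Γ)

lemma v_nat_le (n : ℕ) : v (n : F) ≤ 1 := by
  induction n with
  | zero => simp
  | succ n ih =>
    push_cast
    exact (v.map_add _ _).trans (max_le ih (by simp))

lemma taylor_lt (R : F[X]) (h : F) (δ t : Γ) (hδ : δ ≠ 0) (ht : t ≠ 0) (hh : v h ≤ δ)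
    (H : ∀ j, 1 ≤ j → v (R.coeff j) * δ ^ j < t) (i : ℕ) (hi : 1 ≤ i) :
    v ((taylor h R).coeff i) * δ ^ i < t := by
  have hδi : 0 < δ ^ i := pow_pos (zero_lt_iff.2 hδ) _
  rw [← lt_div_iff₀ hδi]
  rw [taylor_coeff, hasseDeriv_apply, sum_def, eval_finsetSum]
  refine v.map_sum_lt (by simp [ht, hδ]) ?_
  intro j _
  rw [eval_monomial, lt_div_iff₀ hδi]
  by_cases hji : j < i
  · simp [Nat.choose_eq_zero_of_lt hji, zero_lt_iff.2 ht]
  push Not at hji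
  have := H j (hi.trans hji)
  refine lt_of_le_of_lt ?_ this
  rw [map_mul, map_mul, map_pow]
  calc v ((j.choose i : ℕ) : F) * v (R.coeff j) * v h ^ (j - i) * δ ^ i
      ≤ 1 * v (R.coeff j) * δ ^ (j - i) * δ ^ i := by
        gcongr
        exact v_nat_le v _
    _ = v (R.coeff j) * δ ^ j := by
        rw [one_mul, mul_assoc, ← pow_add, Nat.sub_add_cancel hji]

lemma eval_sub_eq (Q : F[X]) (a w : F) :
    Q.eval w = Q.eval a + ∑ j ∈ Finset.range (Q.natDegree),
      (taylor a Q).coeff (j + 1) * (w - a) ^ (j + 1) := by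
  have h1 : Q.eval w = (taylor a Q).eval (w - a) := by
    rw [taylor_eval]; simp
  rw [h1, eval_eq_sum_range, natDegree_taylor, Finset.sum_range_succ', add_comm]
  simp [taylor_coeff_zero]

lemma eval_sub_lt (Q : F[X]) (a w : F) (δ t : Γ) (ht : t ≠ 0) (hh : v (w - a) ≤ δ)
    (H : ∀ j, 1 ≤ j → v ((taylor a Q).coeff j) * δ ^ j < t) :
    v (Q.eval w - Q.eval a) < t := by
  rw [eval_sub_eq Q a w, add_sub_cancel_left]
  refine v.map_sum_lt ht ?_
  intro j _
  refine lt_of_le_of_lt ?_ (H (j+1) (by omega))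
  rw [map_mul, map_pow]
  gcongr

lemma eval_le (Q : F[X]) (a w : F) (δ t : Γ) (hh : v (w - a) ≤ δ)
    (h0 : v (Q.eval a) ≤ t)
    (H : ∀ j, 1 ≤ j → v ((taylor a Q).coeff j) * δ ^ j ≤ t) :
    v (Q.eval w) ≤ t := by
  rw [eval_sub_eq Q a w]
  refine (v.map_add _ _).trans (max_le h0 (v.map_sum_le ?_))
  intro j _
  refine le_trans ?_ (H (j+1) (by omega))
  rw [map_mul, map_pow]
  gcongr

lemma taylor_lt' (Q : F[X]) (a w : F) (δ t : Γ) (hδ : δ ≠ 0) (ht : t ≠ 0) (hh : v (w - a) ≤ δ)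
    (H : ∀ j, 1 ≤ j → v ((taylor a Q).coeff j) * δ ^ j < t) (i : ℕ) (hi : 1 ≤ i) :
    v ((taylor w Q).coeff i) * δ ^ i < t := by
  have := taylor_lt v (taylor a Q) (w - a) δ t hδ ht hh H i hi
  rwa [taylor_taylor, sub_add_cancel] at this

end val

section lt
variable {k Γ K : Type*} [Field k] [LinearOrderedCommGroupWithZero Γ] [Field K] (A : CF k Γ K)

/-- `a` has leading term `α t^γ`. -/
def CF.lt (a : K) (α : k) (γ : Γ) : Prop := A.v (a - A.ι α * A.s γ) < γ

variable {A}
lemma CF.v_d {α : k} (hα : α ≠ 0) (γ : Γ) : A.v (A.ι α * A.s γ) = γ := by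
  rw [map_mul, A.v_ι _ hα, A.v_s, one_mul]

lemma CF.lt.v_eq {a : K} {α : k} {γ : Γ} (h : A.lt a α γ) (hα : α ≠ 0) : A.v a = γ := by
  have h2 := A.v.map_add_eq_of_lt_right (x := a - A.ι α * A.s γ) (y := A.ι α * A.s γ)
    (by rw [CF.v_d hα]; exact h)
  rwa [sub_add_cancel, CF.v_d hα] at h2

lemma CF.lt.ne {a : K} {α : k} {γ : Γ} (h : A.lt a α γ) (hα : α ≠ 0) (hγ : γ ≠ 0) : a ≠ 0 := by
  rintro rfl
  exact hγ (by rw [← h.v_eq hα, map_zero])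

lemma CF.lt.mul {a b : K} {α β : k} {γ η : Γ} (h : A.lt a α γ) (h' : A.lt b β η)
    (hα : α ≠ 0) (hβ : β ≠ 0) (hγ : γ ≠ 0) (hη : η ≠ 0) : A.lt (a * b) (α * β) (γ * η) := by
  unfold CF.lt
  have : a * b - A.ι (α * β) * A.s (γ * η) =
    a * (b - A.ι β * A.s η) + (a - A.ι α * A.s γ) * (A.ι β * A.s η) := by
    simp only [map_mul]; ring
  rw [this]
  refine A.v.map_add_lt ?_ ?_
  · rw [map_mul, h.v_eq hα]
    exact mul_lt_mul_of_pos_left h' (zero_lt_iff.2 hγ)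
  · rw [map_mul, CF.v_d hβ]
    exact mul_lt_mul_of_pos_right h (zero_lt_iff.2 hη)

lemma CF.lt.inv {a : K} {α : k} {γ : Γ} (h : A.lt a α γ)
    (hα : α ≠ 0) (hγ : γ ≠ 0) : A.lt a⁻¹ α⁻¹ γ⁻¹ := by
  have ha := h.ne hα hγ
  have hd : A.ι α * A.s γ ≠ 0 := by
    rw [← A.v.ne_zero_iff, CF.v_d hα]; exact hγ
  unfold CF.lt
  have : a⁻¹ - A.ι α⁻¹ * A.s γ⁻¹ = - (a - A.ι α * A.s γ) * (a⁻¹ * (A.ι α * A.s γ)⁻¹) := by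
    rw [map_inv₀, map_inv₀, ← mul_inv]
    generalize A.ι α * A.s γ = d at hd
    field_simp
    ring
  rw [this, map_mul, Valuation.map_neg, map_mul, map_inv₀, map_inv₀, h.v_eq hα, CF.v_d hα]
  calc _ < γ * (γ⁻¹ * γ⁻¹) := mul_lt_mul_of_pos_right h (zero_lt_iff.2 (by simp [hγ]))
    _ = γ⁻¹ := by field_simp

lemma CF.lt.perturb {a b : K} {α : k} {γ : Γ} (h : A.lt a α γ) (hb : A.v (b - a) < γ) :
    A.lt b α γ := by
  unfold CF.lt
  rw [← sub_add_sub_cancel b a]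
  exact A.v.map_add_lt hb h

lemma CF.lt.unique {a : K} {α β : k} {γ : Γ} (hγ : γ ≠ 0) (h : A.lt a α γ) (h' : A.lt a β γ) :
    α = β := by
  by_contra hne
  have h3 : A.v (A.ι (α - β) * A.s γ) < γ := by
    have : A.ι (α - β) * A.s γ = (a - A.ι β * A.s γ) - (a - A.ι α * A.s γ) := by
      rw [map_sub]; ring
    rw [this]
    exact (A.v.map_sub _ _).trans_lt (max_lt h' h)
  rw [CF.v_d (sub_ne_zero.2 hne)] at h3
  exact lt_irrefl _ h3

lemma CF.exists_lt {a : K} (ha : a ≠ 0) : ∃ α γ, α ≠ 0 ∧ γ ≠ 0 ∧ A.lt a α γ := by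
  obtain ⟨α, h0, h⟩ := A.lead a ha
  exact ⟨α, A.v a, h0, by simpa using ha, h⟩

lemma CF.v_nat [CharZero k] {n : ℕ} (hn : n ≠ 0) : A.v (n : K) = 1 := by
  have := A.v_ι (n : k) (by exact_mod_cast hn)
  simpa using this
end lt

section closure
variable {k Γ K : Type*} [Field k] [LinearOrderedCommGroupWithZero Γ] [Field K] (A : CF k Γ K)

/-- one closure step -/
def clo (f g : K → K) (S : Set K) : Set K :=
  {z | ∃ Q : (Subfield.closure (S ∪ Set.image f S ∪ Set.image g S))[X], Q ≠ 0 ∧ aeval z Q = 0}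

lemma clo_countable (f g : K → K) {S : Set K} (hS : S.Countable) : (clo f g S).Countable := by
  have h1 : (S ∪ Set.image f S ∪ Set.image g S).Countable := (hS.union (hS.image f)).union (hS.image g)
  have : Countable (Subfield.closure (S ∪ Set.image f S ∪ Set.image g S)) := by
    have := h1.to_subtype
    have h := Subfield.cardinalMk_closure_le_max (S ∪ Set.image f S ∪ Set.image g S)
    rw [← Cardinal.mk_le_aleph0_iff]
    exact h.trans (max_le (Cardinal.mk_le_aleph0_iff.2 this) le_rfl)
  have h2 : Countable ((Subfield.closure (S ∪ Set.image f S ∪ Set.image g S))[X]) := by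
    rw [← Cardinal.mk_le_aleph0_iff]
    exact Polynomial.cardinalMk_le_max.trans (max_le (Cardinal.mk_le_aleph0_iff.2 this) le_rfl)
  have h3 : clo f g S ⊆ ⋃ Q : (Subfield.closure (S ∪ Set.image f S ∪ Set.image g S))[X], (Q.rootSet K) := by
    rintro z ⟨Q, h0, hz⟩
    simp only [Set.mem_iUnion]
    exact ⟨Q, (mem_rootSet.2 ⟨h0, hz⟩)⟩
  exact (Set.countable_iUnion fun Q => (Polynomial.rootSet_finite Q K).countable).mono h3

lemma sub_clo (f g : K → K) (S : Set K) :
    (Subfield.closure (S ∪ Set.image f S ∪ Set.image g S) : Set K) ⊆ clo f g S := by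
  intro z hz
  exact ⟨X - C ⟨z, hz⟩, X_sub_C_ne_zero _, by simp [Algebra.algebraMap_eq_smul_one, Subfield.smul_def]⟩

theorem exists_closed (S : Set K) (hS : S.Countable) : ∃ B : Subfield K, (B : Set K).Countable ∧
    S ⊆ B ∧ (∀ b ∈ B, ∀ α γ, α ≠ 0 → γ ≠ 0 → A.lt b α γ → A.ι α ∈ B ∧ A.s γ ∈ B) ∧
    (∀ (Q : K[X]) (z : K), Q ≠ 0 → (∀ i, Q.coeff i ∈ B) → Q.eval z = 0 → z ∈ B) := by
  classical
  let ac : K → k := fun a => if h : a ≠ 0 then (A.lead a h).choose else 0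
  let f : K → K := fun a => A.ι (ac a)
  let g : K → K := fun a => A.s (A.v a)
  let T : ℕ → Set K := fun n => (clo f g)^[n] S
  have hT : ∀ n, T (n+1) = clo f g (T n) := fun n => Function.iterate_succ_apply' _ _ _
  have hsub : ∀ n, (Subfield.closure (T n ∪ f '' T n ∪ g '' T n) : Set K) ⊆ T (n+1) := by
    intro n; rw [hT]; exact sub_clo _ _ _
  have hmono : Monotone T := by
    refine monotone_nat_of_le_succ fun n => ?_
    refine Set.Subset.trans (fun x hx => ?_) (hsub n)
    exact Subfield.subset_closure (Or.inl (Or.inl hx))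
  have hcl : ∀ n x, x ∈ T n → x ∈ Subfield.closure (T n ∪ f '' T n ∪ g '' T n) :=
    fun n x hx => Subfield.subset_closure (Or.inl (Or.inl hx))
  have hcount : ∀ n, (T n).Countable := by
    intro n
    induction n with
    | zero => exact hS
    | succ n ih => rw [hT]; exact clo_countable _ _ ih
  have hpoly : ∀ (Q : K[X]) (z : K), Q ≠ 0 → (∀ i, ∃ n, Q.coeff i ∈ T n) → Q.eval z = 0 →
      ∃ n, z ∈ T n := by
    intro Q z h0 hQ hz
    choose N hN using hQ
    let m := (Finset.range (Q.natDegree + 1)).sup N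
    have hm : ∀ i, Q.coeff i ∈ Subfield.closure (T m ∪ f '' T m ∪ g '' T m) := by
      intro i
      by_cases hi : i ≤ Q.natDegree
      · apply hcl
        exact hmono (Finset.le_sup (f := N) (Finset.mem_range.2 (by omega))) (hN i)
      · rw [coeff_eq_zero_of_natDegree_lt (by omega)]; exact zero_mem _
    refine ⟨m+1, ?_⟩
    rw [hT]
    have hl : Q ∈ lifts (Subfield.closure (T m ∪ f '' T m ∪ g '' T m)).subtype := by
      rw [lifts_iff_coeff_lifts]
      intro i
      exact ⟨⟨_, hm i⟩, rfl⟩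
    obtain ⟨R, hR⟩ := (mem_lifts _).1 hl
    refine ⟨R, ?_, ?_⟩
    · rintro rfl; simp at hR; exact h0 hR.symm
    · rw [← hz, ← hR, eval_map, aeval_def]; rfl
  have h2 : ∀ {a b : K}, a ∈ ⋃ n, T n → b ∈ ⋃ n, T n → ∃ n, a ∈ T n ∧ b ∈ T n := by
    intro a b ha hb
    obtain ⟨n, hn⟩ := Set.mem_iUnion.1 ha
    obtain ⟨m, hm⟩ := Set.mem_iUnion.1 hb
    exact ⟨max n m, hmono (le_max_left _ _) hn, hmono (le_max_right _ _) hm⟩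
  let B : Subfield K :=
    { carrier := ⋃ n, T n
      mul_mem' := by
        intro a b ha hb
        obtain ⟨n, ha, hb⟩ := h2 ha hb
        exact Set.mem_iUnion.2 ⟨n+1, hsub n (mul_mem (hcl n _ ha) (hcl n _ hb))⟩
      add_mem' := by
        intro a b ha hb
        obtain ⟨n, ha, hb⟩ := h2 ha hb
        exact Set.mem_iUnion.2 ⟨n+1, hsub n (add_mem (hcl n _ ha) (hcl n _ hb))⟩
      neg_mem' := by
        intro a ha
        obtain ⟨n, ha⟩ := Set.mem_iUnion.1 ha
        exact Set.mem_iUnion.2 ⟨n+1, hsub n (neg_mem (hcl n _ ha))⟩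
      one_mem' := Set.mem_iUnion.2 ⟨1, hsub 0 (one_mem _)⟩
      zero_mem' := Set.mem_iUnion.2 ⟨1, hsub 0 (zero_mem _)⟩
      inv_mem' := by
        intro a ha
        obtain ⟨n, ha⟩ := Set.mem_iUnion.1 ha
        exact Set.mem_iUnion.2 ⟨n+1, hsub n (inv_mem (hcl n _ ha))⟩ }
  refine ⟨B, Set.countable_iUnion hcount, ?_, ?_, ?_⟩
  · intro x hx; exact Set.mem_iUnion.2 ⟨0, hx⟩
  · intro b hb α γ hα hγ h
    obtain ⟨n, hb⟩ := Set.mem_iUnion.1 hb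
    have hb0 := h.ne hα hγ
    have hv := h.v_eq hα
    have hac : ac b = α := by
      have : A.lt b (ac b) γ := by
        simp only [ac, dif_pos hb0]
        have := (A.lead b hb0).choose_spec.2
        unfold CF.lt
        subst hv
        exact this
      exact this.unique hγ h
    constructor
    · refine Set.mem_iUnion.2 ⟨n+1, hsub n (Subfield.subset_closure (Or.inl (Or.inr ⟨b, hb, ?_⟩)))⟩
      simp only [f, hac]
    · refine Set.mem_iUnion.2 ⟨n+1, hsub n (Subfield.subset_closure (Or.inr ⟨b, hb, ?_⟩))⟩
      simp only [g, hv]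
  · intro Q z h0 hQ hz
    exact Set.mem_iUnion.2 (hpoly Q z h0 (fun i => Set.mem_iUnion.1 (hQ i)) hz)
end closure
end AK
namespace AK
open Polynomial
section pairs
variable {k Γ K M : Type*} [Field k] [LinearOrderedCommGroupWithZero Γ] [Field K] [Field M]
  (A : CF k Γ K) (C : CF k Γ M)

/-- the two components have the same leading term -/
def E (e : K × M) : Prop :=
  e = 0 ∨ ∃ α γ, α ≠ 0 ∧ γ ≠ 0 ∧ A.lt e.1 α γ ∧ C.lt e.2 α γ

/-- diagonal copy of the coefficient field -/
def dι : k →+* K × M := A.ι.prod C.ι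
/-- diagonal copy of the cross section -/
def ds : Γ →*₀ K × M where
  toFun γ := (A.s γ, C.s γ)
  map_zero' := by simp
  map_one' := by simp
  map_mul' := by simp

variable {A C}

lemma E.v_eq {e : K × M} (h : E A C e) : A.v e.1 = C.v e.2 := by
  rcases h with rfl | ⟨α, γ, hα, hγ, h1, h2⟩
  · simp
  · rw [h1.v_eq hα, h2.v_eq hα]

lemma E.ne1 {e : K × M} (h : E A C e) (he : e ≠ 0) : e.1 ≠ 0 := by
  rcases h with rfl | ⟨α, γ, hα, hγ, h1, h2⟩
  · exact absurd rfl he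
  · exact h1.ne hα hγ

lemma E.ne2 {e : K × M} (h : E A C e) (he : e ≠ 0) : e.2 ≠ 0 := by
  rcases h with rfl | ⟨α, γ, hα, hγ, h1, h2⟩
  · exact absurd rfl he
  · exact h2.ne hα hγ

lemma E.perturb {e f : K × M} (h : E A C e) (he : e ≠ 0) (h1 : A.v (f.1 - e.1) < A.v e.1)
    (h2 : C.v (f.2 - e.2) < A.v e.1) : E A C f := by
  rcases h with rfl | ⟨α, γ, hα, hγ, h3, h4⟩
  · exact absurd rfl he
  · rw [h3.v_eq hα] at h1 h2
    exact Or.inr ⟨α, γ, hα, hγ, h3.perturb h1, h4.perturb h2⟩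

lemma E.mul {e f : K × M} (h : E A C e) (h' : E A C f) : E A C (e * f) := by
  rcases h with rfl | ⟨α, γ, hα, hγ, h3, h4⟩
  · left; simp
  rcases h' with rfl | ⟨β, η, hβ, hη, h5, h6⟩
  · left; simp
  exact Or.inr ⟨α * β, γ * η, mul_ne_zero hα hβ, mul_ne_zero hγ hη,
    h3.mul h5 hα hβ hγ hη, h4.mul h6 hα hβ hγ hη⟩

lemma E.inv {e : K × M} (h : E A C e) : E A C e⁻¹ := by
  rcases h with rfl | ⟨α, γ, hα, hγ, h3, h4⟩
  · left; ext <;> simp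
  exact Or.inr ⟨α⁻¹, γ⁻¹, inv_ne_zero hα, inv_ne_zero hγ, h3.inv hα hγ, h4.inv hα hγ⟩

lemma E.pow {e : K × M} (h : E A C e) (n : ℕ) : E A C (e ^ n) := by
  induction n with
  | zero =>
    right
    refine ⟨1, 1, one_ne_zero, one_ne_zero, ?_, ?_⟩ <;> simp [CF.lt]
  | succ n ih => rw [pow_succ]; exact ih.mul h

variable (A C)
/-- Good partial isomorphisms -/
def Good (G : Subring (K × M)) : Prop :=
  (∀ e ∈ G, e⁻¹ ∈ G) ∧ ∀ e ∈ G, e = 0 ∨ ∃ α γ, α ≠ 0 ∧ γ ≠ 0 ∧ A.lt e.1 α γ ∧ C.lt e.2 α γ ∧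
    dι A C α ∈ G ∧ ds A C γ ∈ G

variable {A C}
lemma lt_sum {J : Type*} (I : Finset J) (t : J → K) (a : J → k) (η : J → Γ) (γ : Γ)
    (hγ : γ ≠ 0) (ha : ∀ i ∈ I, a i ≠ 0) (h : ∀ i ∈ I, A.lt (t i) (a i) (η i))
    (hle : ∀ i ∈ I, η i ≤ γ) : 
    open Classical in A.lt (∑ i ∈ I, t i) (∑ i ∈ I, if η i = γ then a i else 0) γ := by
  classical
  unfold CF.lt
  rw [map_sum, Finset.sum_mul, ← Finset.sum_sub_distrib]
  refine A.v.map_sum_lt hγ ?_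
  intro i hi
  split_ifs with hh
  · have := h i hi
    unfold CF.lt at this
    rwa [hh] at this
  · rw [map_zero, zero_mul, sub_zero, (h i hi).v_eq (ha i hi)]
    exact lt_of_le_of_ne (hle i hi) hh

lemma stepA {G : Subring (K × M)} (hG : Good A C G) {J : Type*} (n : ℕ) : ∀ (I : Finset J),
    I.card = n → ∀ (g : J → K × M) (α : J → k) (γ : J → Γ), (∀ i ∈ I, g i ∈ G) →
    (∀ i ∈ I, α i ≠ 0) → (∀ i ∈ I, γ i ≠ 0) →
    E A C (∑ i ∈ I, g i * (dι A C (α i) * ds A C (γ i))) := by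
  classical
  induction n with
  | zero =>
    intro I hI
    rw [Finset.card_eq_zero] at hI
    subst hI
    intros
    left; simp
  | succ n ih =>
    intro I hI g α γ hg hα hγ
    by_cases h0 : ∃ i ∈ I, g i = 0
    · obtain ⟨i, hi, h0⟩ := h0
      rw [← Finset.add_sum_erase I _ hi, h0, zero_mul, zero_add]
      refine ih _ (by rw [Finset.card_erase_of_mem hi, hI]; rfl) _ _ _ ?_ ?_ ?_
      · exact fun i hi => hg i (Finset.mem_of_mem_erase hi)
      · exact fun i hi => hα i (Finset.mem_of_mem_erase hi)
      · exact fun i hi => hγ i (Finset.mem_of_mem_erase hi)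
    push Not at h0
    have hl : ∀ i : J, ∃ β η, i ∈ I → β ≠ 0 ∧ η ≠ 0 ∧ A.lt (g i).1 β η ∧ C.lt (g i).2 β η ∧
        dι A C β ∈ G ∧ ds A C η ∈ G := by
      intro i
      by_cases hi : i ∈ I
      · obtain ⟨β, η, h⟩ := (hG.2 _ (hg i hi)).resolve_left (h0 i hi)
        exact ⟨β, η, fun _ => h⟩
      · exact ⟨0, 0, fun h => absurd h hi⟩
    choose β η h using hl
    have hne : I.Nonempty := by rw [← Finset.card_pos]; omega
    obtain ⟨j, hj, hmax⟩ := Finset.exists_max_image I (fun i => η i * γ i) hne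
    have hβ : ∀ i ∈ I, β i ≠ 0 := fun i hi => (h i hi).1
    have hη : ∀ i ∈ I, η i ≠ 0 := fun i hi => (h i hi).2.1
    by_cases hσ : (∑ i ∈ I, if η i * γ i = η j * γ j then β i * α i else 0) = 0
    · have hre : ∑ i ∈ I, g i * (dι A C (α i) * ds A C (γ i)) =
        ∑ i ∈ I.erase j, (g i + if η i * γ i = η j * γ j then
          - (g j * (dι A C (β i * (β j)⁻¹) * ds A C (η i * (η j)⁻¹))) else 0) *
          (dι A C (α i) * ds A C (γ i)) := by
        rw [← Finset.add_sum_erase I _ hj]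
        simp only [add_mul]
        rw [Finset.sum_add_distrib, add_comm]
        congr 1
        rw [← Finset.add_sum_erase I _ hj, if_pos rfl] at hσ
        have hαj : α j = - ∑ i ∈ I.erase j, (if η i * γ i = η j * γ j then
            β i * (β j)⁻¹ * α i else 0) := by
          have h2 : ∑ i ∈ I.erase j, (if η i * γ i = η j * γ j then
            β i * (β j)⁻¹ * α i else 0) = (β j)⁻¹ * ∑ i ∈ I.erase j,
              (if η i * γ i = η j * γ j then β i * α i else 0) := by
            rw [Finset.mul_sum]
            refine Finset.sum_congr rfl fun i _ => ?_
            split_ifs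
            · ring
            · simp
          rw [h2]
          have h3 := eq_neg_of_add_eq_zero_right hσ
          rw [h3]
          have := hβ j hj
          field_simp
        conv_lhs => rw [hαj]
        rw [map_neg, map_sum, neg_mul, Finset.sum_mul, mul_neg, Finset.mul_sum,
          ← Finset.sum_neg_distrib]
        refine Finset.sum_congr rfl fun i hi => ?_
        split_ifs with hh
        · have : γ j = (η i * (η j)⁻¹) * γ i := by
            have := hη j hj
            rw [mul_right_comm, hh]; field_simp
          rw [this]
          simp only [map_mul]
          ring
        · simp
      rw [hre]
      refine ih _ (by rw [Finset.card_erase_of_mem hj, hI]; rfl) _ _ _ ?_ ?_ ?_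
      · intro i hi
        have hi' := Finset.mem_of_mem_erase hi
        refine add_mem (hg i hi') ?_
        split_ifs
        · refine neg_mem (mul_mem (hg j hj) (mul_mem ?_ ?_))
          · rw [map_mul]
            refine mul_mem (h i hi').2.2.2.2.1 ?_
            convert! hG.1 _ (h j hj).2.2.2.2.1 using 1
            ext <;> simp [dι]
          · rw [map_mul]
            refine mul_mem (h i hi').2.2.2.2.2 ?_
            convert! hG.1 _ (h j hj).2.2.2.2.2 using 1
            ext <;> simp [ds]
        · exact zero_mem _
      · exact fun i hi => hα i (Finset.mem_of_mem_erase hi)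
      · exact fun i hi => hγ i (Finset.mem_of_mem_erase hi)
    · refine Or.inr ⟨_, η j * γ j, hσ, mul_ne_zero (hη j hj) (hγ j hj), ?_, ?_⟩
      · rw [Prod.fst_sum]
        have := lt_sum (A := A) I (fun i => (g i * (dι A C (α i) * ds A C (γ i))).1)
          (fun i => β i * α i) (fun i => η i * γ i) (η j * γ j) 
          (mul_ne_zero (hη j hj) (hγ j hj)) (fun i hi => mul_ne_zero (hβ i hi) (hα i hi)) ?_ hmax
        · convert! this
        · intro i hi
          refine (h i hi).2.2.1.mul ?_ (hβ i hi) (hα i hi) (hη i hi) (hγ i hi)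
          simpa [CF.lt, dι, ds] using zero_lt_iff.2 (hγ i hi)
      · rw [Prod.snd_sum]
        have := lt_sum (A := C) I (fun i => (g i * (dι A C (α i) * ds A C (γ i))).2)
          (fun i => β i * α i) (fun i => η i * γ i) (η j * γ j) 
          (mul_ne_zero (hη j hj) (hγ j hj)) (fun i hi => mul_ne_zero (hβ i hi) (hα i hi)) ?_ hmax
        · convert! this
        · intro i hi
          refine (h i hi).2.2.2.1.mul ?_ (hβ i hi) (hα i hi) (hη i hi) (hγ i hi)
          simpa [CF.lt, dι, ds] using zero_lt_iff.2 (hγ i hi)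

variable (A C) in
/-- products of an element of `G` with a monomial -/
def monN (G : Subring (K × M)) : Submonoid (K × M) where
  carrier := {x | ∃ g ∈ G, ∃ α γ, α ≠ 0 ∧ γ ≠ 0 ∧ x = g * (dι A C α * ds A C γ)}
  one_mem' := ⟨1, one_mem _, 1, 1, one_ne_zero, one_ne_zero, by simp⟩
  mul_mem' := by
    rintro _ _ ⟨g, hg, α, γ, hα, hγ, rfl⟩ ⟨g', hg', α', γ', hα', hγ', rfl⟩
    exact ⟨g * g', mul_mem hg hg', α * α', γ * γ', mul_ne_zero hα hα', mul_ne_zero hγ hγ',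
      by simp only [map_mul]; ring⟩

lemma monN_le (G : Subring (K × M)) (S : Set k) (S' : Set Γ) :
    Submonoid.closure ((G : Set (K × M)) ∪ dι A C '' S ∪ ds A C '' S') ≤ monN A C G := by
  rw [Submonoid.closure_le]
  rintro x ((hx | ⟨α, -, rfl⟩) | ⟨γ, -, rfl⟩)
  · exact ⟨x, hx, 1, 1, one_ne_zero, one_ne_zero, by simp⟩
  · by_cases h0 : α = 0
    · exact ⟨0, zero_mem _, 1, 1, one_ne_zero, one_ne_zero, by simp [h0]⟩
    · exact ⟨1, one_mem _, α, 1, h0, one_ne_zero, by simp⟩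
  · by_cases h0 : γ = 0
    · exact ⟨0, zero_mem _, 1, 1, one_ne_zero, one_ne_zero, by simp [h0]⟩
    · exact ⟨1, one_mem _, 1, γ, one_ne_zero, h0, by simp⟩

variable (A C) in
/-- sums of monomials with coefficients in `G` -/
def Rep (G : Subring (K × M)) (e : K × M) : Prop :=
  ∃ (n : ℕ) (g : Fin n → K × M) (α : Fin n → k) (γ : Fin n → Γ),
      (∀ i, g i ∈ G) ∧ (∀ i, α i ≠ 0) ∧ (∀ i, γ i ≠ 0) ∧
      e = ∑ i, g i * (dι A C (α i) * ds A C (γ i))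

lemma Rep.add {G : Subring (K × M)} {x y : K × M} (hx : Rep A C G x) (hy : Rep A C G y) :
    Rep A C G (x + y) := by
  obtain ⟨n, g, α, γ, h1, h2, h3, rfl⟩ := hx
  obtain ⟨n', g', α', γ', h1', h2', h3', rfl⟩ := hy
  refine ⟨n + n', Fin.append g g', Fin.append α α', Fin.append γ γ', ?_, ?_, ?_, ?_⟩
  · intro i; refine Fin.addCases ?_ ?_ i <;> intro i <;> simp only [Fin.append_left, Fin.append_right, h1, h1']
  · intro i; refine Fin.addCases ?_ ?_ i <;> intro i <;> simp only [Fin.append_left, Fin.append_right] <;> first | exact h2 _ | exact h2' _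
  · intro i; refine Fin.addCases ?_ ?_ i <;> intro i <;> simp only [Fin.append_left, Fin.append_right] <;> first | exact h3 _ | exact h3' _
  · rw [Fin.sum_univ_add]; simp only [Fin.append_left, Fin.append_right]

lemma rep_of_mem {G : Subring (K × M)} (S : Set k) (S' : Set Γ) (e : K × M)
    (he : e ∈ Subring.closure ((G : Set (K × M)) ∪ dι A C '' S ∪ ds A C '' S')) :
    Rep A C G e := by
  rw [Subring.mem_closure_iff] at he
  induction he using AddSubgroup.closure_induction with
  | mem x hx =>
    obtain ⟨g, hg, α, γ, hα, hγ, rfl⟩ := monN_le G S S' hx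
    exact ⟨1, fun _ => g, fun _ => α, fun _ => γ, fun _ => hg, fun _ => hα, fun _ => hγ, by simp⟩
  | zero => exact ⟨0, Fin.elim0, Fin.elim0, Fin.elim0, fun i => i.elim0, fun i => i.elim0,
        fun i => i.elim0, by simp⟩
  | add x y _ _ hx hy => exact hx.add hy
  | neg x _ hx =>
    obtain ⟨n, g, α, γ, h1, h2, h3, rfl⟩ := hx
    refine ⟨n, fun i => - g i, α, γ, fun i => neg_mem (h1 i), h2, h3, ?_⟩
    simp only [neg_mul, Finset.sum_neg_distrib]

lemma stepA' {G : Subring (K × M)} (hG : Good A C G) (S : Set k) (S' : Set Γ) (e : K × M)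
    (he : e ∈ Subring.closure ((G : Set (K × M)) ∪ dι A C '' S ∪ ds A C '' S')) : E A C e := by
  obtain ⟨n, g, α, γ, h1, h2, h3, rfl⟩ := rep_of_mem S S' e he
  exact stepA hG n Finset.univ (by simp) g α γ (fun i _ => h1 i) (fun i _ => h2 i) (fun i _ => h3 i)
end pairs
end AK
namespace AK
open Polynomial
section imm
variable {k Γ K M : Type*} [Field k] [LinearOrderedCommGroupWithZero Γ] [Field K] [Field M]
  {A : CF k Γ K} {C : CF k Γ M}

/-- first projection on a subring -/
def f1 (G : Subring (K × M)) : G →+* K := (RingHom.fst K M).comp G.subtype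
/-- second projection on a subring -/
def f2 (G : Subring (K × M)) : G →+* M := (RingHom.snd K M).comp G.subtype

lemma f1_apply (G : Subring (K × M)) (a : G) : f1 G a = (a : K × M).1 := rfl
lemma f2_apply (G : Subring (K × M)) (a : G) : f2 G a = (a : K × M).2 := rfl

variable {G : Subring (K × M)}

lemma aeval_fst (Q : G[X]) (w : K × M) : (aeval w Q).1 = (Q.map (f1 G)).eval w.1 := by
  rw [aeval_def, eval_map]
  exact hom_eval₂ Q (algebraMap G (K × M)) (RingHom.fst K M) w

lemma aeval_snd (Q : G[X]) (w : K × M) : (aeval w Q).2 = (Q.map (f2 G)).eval w.2 := by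
  rw [aeval_def, eval_map]
  exact hom_eval₂ Q (algebraMap G (K × M)) (RingHom.snd K M) w

lemma tc1 (Q : G[X]) (a : G) (i : ℕ) :
    (taylor (f1 G a) (Q.map (f1 G))).coeff i = f1 G ((taylor a Q).coeff i) := by
  rw [← map_taylor, coeff_map]

lemma tc2 (Q : G[X]) (a : G) (i : ℕ) :
    (taylor (f2 G a) (Q.map (f2 G))).coeff i = f2 G ((taylor a Q).coeff i) := by
  rw [← map_taylor, coeff_map]

lemma ev1 (Q : G[X]) (a : G) : (Q.map (f1 G)).eval (f1 G a) = f1 G (Q.eval a) := by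
  rw [eval_map, eval₂_at_apply]

lemma ev2 (Q : G[X]) (a : G) : (Q.map (f2 G)).eval (f2 G a) = f2 G (Q.eval a) := by
  rw [eval_map, eval₂_at_apply]

variable (A) in
/-- the value of `Q` near the pseudo limit is determined by the approximation `a` -/
def Settled (δ : G → Γ) (Q : G[X]) (a : G) : Prop :=
  ∀ i, 1 ≤ i → A.v (f1 G ((taylor a Q).coeff i)) * δ a ^ i < A.v (f1 G (Q.eval a))

lemma v21 (hE : ∀ e ∈ G, E A C e) (g : G) : C.v (f2 G g) = A.v (f1 G g) :=
  ((hE g g.2).v_eq).symm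

lemma Settled.ne {δ : G → Γ} {Q : G[X]} {a : G} (h : Settled A δ Q a) :
    A.v (f1 G (Q.eval a)) ≠ 0 := (lt_of_le_of_lt zero_le (h 1 le_rfl)).ne'

lemma Settled.E (hE : ∀ e ∈ G, E A C e) {δ : G → Γ} {Q : G[X]} {a : G} (h : Settled A δ Q a)
    {w : K × M} (h1 : A.v (w.1 - f1 G a) ≤ δ a) (h2 : C.v (w.2 - f2 G a) ≤ δ a) :
    E A C (aeval w Q) := by
  refine (hE _ (Q.eval a).2).perturb ?_ ?_ ?_
  · intro h0
    apply h.ne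
    rw [f1_apply, h0]; simp
  · have := eval_sub_lt A.v (Q.map (f1 G)) (f1 G a) w.1 (δ a) _ h.ne h1
      (fun j hj => by rw [tc1]; exact h j hj)
    rw [aeval_fst]
    rwa [ev1] at this
  · have := eval_sub_lt C.v (Q.map (f2 G)) (f2 G a) w.2 (δ a) _ h.ne h2
      (fun j hj => by rw [tc2, v21 hE]; exact h j hj)
    rw [aeval_snd]
    rwa [ev2] at this

lemma Settled.persist {δ : G → Γ} {Q : G[X]} {a a' : G} (h : Settled A δ Q a)
    (h1 : A.v (f1 G a' - f1 G a) ≤ δ a) (h2 : δ a' ≤ δ a) (h0 : δ a ≠ 0) :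
    Settled A δ Q a' := by
  have h3 := eval_sub_lt A.v (Q.map (f1 G)) (f1 G a) (f1 G a') (δ a) _ h.ne h1
      (fun j hj => by rw [tc1]; exact h j hj)
  rw [ev1, ev1] at h3
  have h4 := A.v.map_eq_of_sub_lt h3
  intro i hi
  rw [h4]
  have := taylor_lt' A.v (Q.map (f1 G)) (f1 G a) (f1 G a') (δ a) _ h0 h.ne h1
      (fun j hj => by rw [tc1]; exact h j hj) i hi
  rw [tc1] at this
  refine lt_of_le_of_lt ?_ this
  gcongr

/-- Newton step in one field. -/
lemma newton_step {F : Type*} [Field F] (D : CF k Γ F) [CharZero k] (Q : F[X]) (a w : F) (δ : Γ)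
    (hδ : δ ≠ 0) (hw : D.v (w - a) ≤ δ)
    (h1 : D.v ((taylor a Q).coeff 1) ≠ 0)
    (h2 : ∀ i, 2 ≤ i → D.v ((taylor a Q).coeff i) * δ ^ (i - 1) < D.v ((taylor a Q).coeff 1))
    (h0 : D.v (Q.eval a) ≤ D.v ((taylor a Q).coeff 1) * δ) :
    D.v ((taylor w Q).coeff 1) = D.v ((taylor a Q).coeff 1) ∧
    (∀ i, 2 ≤ i → D.v ((taylor w Q).coeff i) * δ ^ (i - 1) < D.v ((taylor w Q).coeff 1)) ∧
    D.v (Q.eval w) ≤ D.v ((taylor w Q).coeff 1) * δ := by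
  have hder : ∀ (b : F) (i : ℕ), D.v ((taylor b (derivative Q)).coeff i) =
      D.v ((taylor b Q).coeff (i + 1)) := by
    intro b i
    have : taylor b (derivative Q) = derivative (taylor b Q) := by
      simp [taylor_apply, derivative_comp]
    rw [this, coeff_derivative, map_mul]
    have h3 := D.v_nat (n := i + 1) (by omega)
    push_cast at h3
    rw [h3, mul_one]
  have hH : ∀ j, 1 ≤ j → D.v ((taylor a (derivative Q)).coeff j) * δ ^ j <
      D.v ((taylor a Q).coeff 1) := by
    intro j hj
    rw [hder]
    exact h2 (j+1) (by omega)
  have e1 : D.v ((taylor w Q).coeff 1) = D.v ((taylor a Q).coeff 1) := by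
    have := eval_sub_lt D.v (derivative Q) a w δ _ h1 hw hH
    rw [taylor_coeff_one] at this
    have := D.v.map_eq_of_sub_lt this
    rwa [taylor_coeff_one, taylor_coeff_one]
  refine ⟨e1, ?_, ?_⟩
  · intro i hi
    rw [e1]
    have := taylor_lt' D.v (derivative Q) a w δ _ hδ h1 hw hH (i-1) (by omega)
    rw [hder, Nat.sub_add_cancel (by omega)] at this
    exact this
  · rw [e1]
    refine eval_le D.v Q a w δ _ hw h0 ?_
    intro j hj
    rcases Nat.eq_or_lt_of_le hj with rfl | hj
    · rw [pow_one]
    · have h3 := h2 j hj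
      have : δ ^ j = δ ^ (j - 1) * δ := by rw [← pow_succ, Nat.sub_add_cancel (by omega)]
      rw [this, ← mul_assoc]
      gcongr

/-- Root close to `w`, at a distance at most `δ` for all admissible `δ`. -/
lemma newton_root {F : Type*} [Field F] (D : CF k Γ F) (Q : F[X]) (w : F)
    (h1 : D.v ((taylor w Q).coeff 1) ≠ 0) (δ : Γ)
    (h2 : ∀ i, 2 ≤ i → D.v ((taylor w Q).coeff i) * δ ^ (i - 1) < D.v ((taylor w Q).coeff 1))
    (h0 : D.v (Q.eval w) ≤ D.v ((taylor w Q).coeff 1) * δ) :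
    ∃ z, Q.eval z = 0 ∧ ∀ δ', D.v (Q.eval w) ≤ D.v ((taylor w Q).coeff 1) * δ' →
      D.v (z - w) ≤ δ' := by
  obtain ⟨z, hz, hzw⟩ := D.newton Q w (by rwa [← D.v.ne_zero_iff]) (by
    intro i hi
    calc _ ≤ D.v ((taylor w Q).coeff i) * (D.v ((taylor w Q).coeff 1) * δ) ^ (i - 1) := by gcongr
      _ = (D.v ((taylor w Q).coeff i) * δ ^ (i - 1)) * D.v ((taylor w Q).coeff 1) ^ (i - 1) := by
        rw [mul_pow]; ac_rfl
      _ < D.v ((taylor w Q).coeff 1) * D.v ((taylor w Q).coeff 1) ^ (i - 1) :=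
        mul_lt_mul_of_pos_right (h2 i hi) (pow_pos (zero_lt_iff.2 h1) _)
      _ = _ := by rw [← pow_succ', Nat.sub_add_cancel (by omega)])
  refine ⟨z, hz, fun δ' h' => ?_⟩
  have := hzw.trans h'
  rw [mul_comm] at this
  exact le_of_mul_le_mul_left this (zero_lt_iff.2 h1)

theorem imm [CharZero k] (B : Subfield K) (hBc : (B : Set K).Countable)
    (hB1 : ∀ b ∈ B, ∀ α γ, α ≠ 0 → γ ≠ 0 → A.lt b α γ → A.ι α ∈ B ∧ A.s γ ∈ B)
    (hB2 : ∀ (Q : K[X]) (z : K), Q ≠ 0 → (∀ i, Q.coeff i ∈ B) → Q.eval z = 0 → z ∈ B)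
    (hE : ∀ e ∈ G, E A C e) (hGB : ∀ e ∈ G, e.1 ∈ B)
    (hι : ∀ α, A.ι α ∈ B → dι A C α ∈ G) (hs : ∀ γ, A.s γ ∈ B → ds A C γ ∈ G)
    (hmax : ∀ G', G ≤ G' → (∀ e ∈ G', E A C e) → (∀ e ∈ G', e.1 ∈ B) → G' ≤ G) :
    (∀ e ∈ G, e⁻¹ ∈ G) ∧ ∀ x ∈ B, ∃ e ∈ G, e.1 = x := by
  have adj : ∀ w : K × M, w.1 ∈ B → (∀ Q : G[X], E A C (aeval w Q)) → w ∈ G := by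
    intro w hw hQ
    have hmem : ∀ e, e ∈ (Algebra.adjoin G {w}).toSubring ↔ ∃ Q : G[X], aeval w Q = e := by
      intro e
      rw [Subalgebra.mem_toSubring, Algebra.adjoin_singleton_eq_range_aeval]
      rfl
    refine hmax (Algebra.adjoin G {w}).toSubring ?_ ?_ ?_ ((hmem w).2 ⟨X, by simp⟩)
    · intro g hg
      refine (hmem g).2 ⟨Polynomial.C ⟨g, hg⟩, ?_⟩
      rw [aeval_C]; rfl
    · intro e he
      obtain ⟨Q, rfl⟩ := (hmem e).1 he
      exact hQ Q
    · intro e he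
      obtain ⟨Q, rfl⟩ := (hmem e).1 he
      rw [aeval_fst, eval_eq_sum_range]
      refine sum_mem fun i _ => mul_mem ?_ (pow_mem hw _)
      rw [coeff_map]
      exact hGB _ (Q.coeff i).2
  have hinv : ∀ e ∈ G, e⁻¹ ∈ G := by
    intro e he
    by_cases h0 : e = 0
    · have : (0 : K × M)⁻¹ = 0 := by ext <;> simp
      rw [h0, this]; exact zero_mem _
    have hee : e * e⁻¹ = 1 := by
      ext
      · simp [(hE e he).ne1 h0]
      · simp [(hE e he).ne2 h0]
    refine adj _ (by simpa using inv_mem (hGB e he)) fun Q => ?_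
    have h2 : aeval e⁻¹ Q * e ^ Q.natDegree ∈ G := by
      rw [aeval_eq_sum_range, Finset.sum_mul]
      refine sum_mem fun i hi => ?_
      have hi' : i ≤ Q.natDegree := by simpa [Nat.lt_succ_iff] using hi
      have : (Q.coeff i • e⁻¹ ^ i) * e ^ Q.natDegree =
          (Q.coeff i : K × M) * e ^ (Q.natDegree - i) := by
        rw [Subring.smul_def, smul_eq_mul]
        conv_lhs => rw [← Nat.add_sub_cancel' hi', pow_add]
        calc _ = (Q.coeff i : K × M) * ((e * e⁻¹) ^ i * e ^ (Q.natDegree - i)) := by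
              rw [mul_pow]; ring
          _ = _ := by rw [hee]; simp
      rw [this]
      exact mul_mem (Q.coeff i).2 (pow_mem he _)
    have h3 : aeval e⁻¹ Q = (aeval e⁻¹ Q * e ^ Q.natDegree) * (e⁻¹) ^ Q.natDegree := by
      rw [mul_assoc, ← mul_pow, hee, one_pow, mul_one]
    rw [h3]
    exact (hE _ h2).mul ((hE e he).inv.pow _)
  refine ⟨hinv, ?_⟩
  intro x hxB
  by_contra hx
  push Not at hx
  let δ : G → Γ := fun a => A.v (x - f1 G a)
  have hδ0 : ∀ a, δ a ≠ 0 := by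
    intro a h
    rw [A.v.zero_iff, sub_eq_zero] at h
    exact hx a a.2 h.symm
  have hcl : ∀ a b : G, A.v (f1 G a - f1 G b) ≤ max (δ a) (δ b) := by
    intro a b
    rw [← sub_sub_sub_cancel_left _ _ x, max_comm]
    exact A.v.map_sub _ _
  have hGc : Countable G := by
    have hinj : Set.InjOn (Prod.fst : K × M → K) (G : Set (K × M)) := by
      intro e he e' he' h
      by_contra hne
      refine (hE _ (sub_mem he he')).ne1 (sub_ne_zero.2 hne) ?_
      simp [h]
    exact (Set.MapsTo.countable_of_injOn (t := (B : Set K)) (fun e he => hGB e he) hinj hBc).to_subtype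
  obtain ⟨en, hen⟩ := exists_surjective_nat G
  obtain ⟨y, hy⟩ := C.sph (fun n => f2 G (en n)) (fun n => δ (en n)) (by
    intro n
    obtain ⟨j, hj, hmin⟩ := Finset.exists_min_image (Finset.range (n+1)) (fun i => δ (en i)) (by simp)
    refine ⟨f2 G (en j), fun i hi => ?_⟩
    rw [← map_sub, v21 hE, map_sub]
    refine (hcl _ _).trans (max_le (hmin i (Finset.mem_range.2 (by omega))) le_rfl))
  have hy' : ∀ a : G, C.v (y - f2 G a) ≤ δ a := by
    intro a
    obtain ⟨n, rfl⟩ := hen a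
    exact hy n
  have hnomin : ∀ a : G, ∃ a' : G, δ a' < δ a := by
    intro a
    have hne : x - f1 G a ≠ 0 := by rw [← A.v.ne_zero_iff]; exact hδ0 a
    obtain ⟨α, γ, hα, hγ, h⟩ := A.exists_lt hne
    have hb : x - f1 G a ∈ B := sub_mem hxB (hGB _ a.2)
    obtain ⟨h1, h2⟩ := hB1 _ hb α γ hα hγ h
    refine ⟨a + ⟨dι A C α, hι _ h1⟩ * ⟨ds A C γ, hs _ h2⟩, ?_⟩
    have h3 : δ a = γ := h.v_eq hα
    rw [h3]
    have h4 : x - f1 G (a + ⟨dι A C α, hι _ h1⟩ * ⟨ds A C γ, hs _ h2⟩) =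
      x - f1 G a - A.ι α * A.s γ := by
      rw [map_add, map_mul, sub_add_eq_sub_sub]; rfl
    change A.v _ < γ
    rw [h4]
    exact h
  by_cases hall : ∀ Q : G[X], Q ≠ 0 → ∃ a, Settled A δ Q a
  · have hw : (x, y) ∈ G := by
      refine adj (x, y) hxB fun Q => ?_
      by_cases hQ : Q = 0
      · left; rw [hQ, map_zero]
      obtain ⟨a, ha⟩ := hall Q hQ
      exact ha.E hE le_rfl (hy' a)
    exact hx _ hw rfl
  · -- minimal unsettled polynomial
    push Not at hall
    let P : ℕ → Prop := fun n => ∃ Q : G[X], Q ≠ 0 ∧ (∀ a, ¬ Settled A δ Q a) ∧ Q.natDegree = n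
    have hP : ∃ n, P n := by
      obtain ⟨Q, h1, h2⟩ := hall
      exact ⟨_, Q, h1, h2, rfl⟩
    classical
    obtain ⟨Q0, hQ0, hQ0u, hQ0d⟩ := Nat.find_spec hP
    have hmin : ∀ W : G[X], W ≠ 0 → W.natDegree < Nat.find hP → ∃ a, Settled A δ W a := by
      intro W hW hd
      by_contra h
      push Not at h
      exact Nat.find_min hP hd ⟨W, hW, h, rfl⟩
    -- make it monic
    obtain ⟨Q, hQm, hQu, hQd⟩ : ∃ Q : G[X], Q.Monic ∧ (∀ a, ¬ Settled A δ Q a) ∧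
        Q.natDegree = Nat.find hP := by
      have hl0 : Q0.leadingCoeff ≠ 0 := leadingCoeff_ne_zero.2 hQ0
      have hl0' : (Q0.leadingCoeff : K × M) ≠ 0 := fun h => hl0 (Subtype.ext h)
      let c : G := ⟨_, hinv _ Q0.leadingCoeff.2⟩
      have hcl : c * Q0.leadingCoeff = 1 := by
        apply Subtype.ext
        have h1 := (hE _ Q0.leadingCoeff.2).ne1 hl0'
        have h2 := (hE _ Q0.leadingCoeff.2).ne2 hl0'
        ext
        · simp [c, h1]
        · simp [c, h2]
      have hv : A.v (f1 G c) ≠ 0 := by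
        intro h
        have := congrArg (fun t => A.v (f1 G t)) hcl
        simp [h] at this
      have hc0 : IsUnit c := IsUnit.of_mul_eq_one _ hcl
      refine ⟨Polynomial.C c * Q0, monic_C_mul_of_mul_leadingCoeff_eq_one hcl, ?_, ?_⟩
      · intro a h
        apply hQ0u a
        intro i hi
        have := h i hi
        simp only [taylor_mul, taylor_C, coeff_C_mul, map_mul, eval_mul, eval_C] at this
        rw [mul_assoc] at this
        exact lt_of_mul_lt_mul_left' this
      · rw [natDegree_C_mul_of_isUnit hc0, hQ0d]
    have hmapne : Q.map (f1 G) ≠ 0 := (hQm.map (f1 G)).ne_zero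
    have hdpos : 0 < Q.natDegree := by
      by_contra h
      have h1 : Q = 1 := hQm.natDegree_eq_zero.1 (by omega)
      refine hQu 0 fun i hi => ?_
      rw [h1]
      simp [coeff_one, show i ≠ 0 by omega]
    have hvn : A.v (Q.natDegree : K) = 1 := A.v_nat (by omega)
    have hdne : derivative Q ≠ 0 := by
      intro h
      have h1 := coeff_derivative Q (Q.natDegree - 1)
      rw [h, Nat.sub_add_cancel hdpos, coeff_zero, hQm.coeff_natDegree, one_mul] at h1
      have h2 : ((Q.natDegree : ℕ) : G) = 0 := by
        rw [h1]
        conv_lhs => rw [← Nat.sub_add_cancel hdpos]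
        push_cast
        rfl
      have h3 := congrArg (f1 G) h2
      rw [map_natCast, map_zero] at h3
      rw [h3] at hvn
      simp at hvn
    obtain ⟨a0, ha0⟩ := hmin (derivative Q) hdne (by
      rw [← hQd]; exact natDegree_derivative_lt (by omega))
    have hdert : ∀ (a : G) (i : ℕ), A.v (f1 G ((taylor a (derivative Q)).coeff i)) =
      A.v (f1 G ((taylor a Q).coeff (i + 1))) := by
      intro a i
      have : taylor a (derivative Q) = derivative (taylor a Q) := by
        simp [taylor_apply, derivative_comp]
      rw [this, coeff_derivative, map_mul, map_mul]
      have h3 := A.v_nat (n := i + 1) (by omega)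
      push_cast at h3
      rw [map_add, map_natCast, map_one, h3, mul_one]
    have hnear : ∀ a : G, δ a ≤ δ a0 → A.v (f1 G ((taylor a Q).coeff 1)) ≠ 0 ∧
        (∀ i, 2 ≤ i → A.v (f1 G ((taylor a Q).coeff i)) * δ a ^ (i - 1) <
          A.v (f1 G ((taylor a Q).coeff 1))) ∧
        A.v (f1 G (Q.eval a)) ≤ A.v (f1 G ((taylor a Q).coeff 1)) * δ a := by
      intro a ha
      have hsa : Settled A δ (derivative Q) a :=
        ha0.persist ((hcl _ _).trans (max_le ha le_rfl)) ha (hδ0 _)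
      have h1 := hsa.ne
      have h2 : ∀ i, 2 ≤ i → A.v (f1 G ((taylor a Q).coeff i)) * δ a ^ (i - 1) <
          A.v (f1 G ((taylor a Q).coeff 1)) := by
        intro i hi
        have := hsa (i - 1) (by omega)
        rw [hdert, Nat.sub_add_cancel (by omega), ← taylor_coeff_one] at this
        exact this
      rw [← taylor_coeff_one] at h1
      refine ⟨h1, h2, ?_⟩
      by_contra hcon
      push Not at hcon
      refine hQu a fun i hi => ?_
      refine lt_of_le_of_lt ?_ hcon
      rcases Nat.eq_or_lt_of_le hi with rfl | hi
      · rw [pow_one]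
      · have : δ a ^ i = δ a ^ (i - 1) * δ a := by rw [← pow_succ, Nat.sub_add_cancel (by omega)]
        rw [this, ← mul_assoc]
        gcongr
        exact (h2 i hi).le
    -- apply Newton in both fields
    have hK : ∃ z, (Q.map (f1 G)).eval z = 0 ∧ ∀ a : G, δ a ≤ δ a0 → A.v (z - f1 G a) ≤ δ a := by
      have key : ∀ a : G, δ a ≤ δ a0 → _ := fun a ha => newton_step A (Q.map (f1 G)) (f1 G a) x (δ a)
        (hδ0 a) le_rfl (by rw [tc1]; exact (hnear a ha).1)
        (by intro i hi; rw [tc1, tc1]; exact (hnear a ha).2.1 i hi)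
        (by rw [tc1, ev1]; exact (hnear a ha).2.2)
      obtain ⟨h1, h2, h3⟩ := key a0 le_rfl
      obtain ⟨z, hz, hzz⟩ := newton_root A (Q.map (f1 G)) x
        (by rw [h1, tc1]; exact (hnear a0 le_rfl).1) (δ a0) h2 h3
      refine ⟨z, hz, fun a ha => ?_⟩
      have := hzz (δ a) (key a ha).2.2
      rw [← sub_add_sub_cancel z x]
      exact (A.v.map_add _ _).trans (max_le this le_rfl)
    have hM : ∃ z, (Q.map (f2 G)).eval z = 0 ∧ ∀ a : G, δ a ≤ δ a0 → C.v (z - f2 G a) ≤ δ a := by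
      have key : ∀ a : G, δ a ≤ δ a0 → _ := fun a ha => newton_step C (Q.map (f2 G)) (f2 G a) y (δ a)
        (hδ0 a) (hy' a) (by rw [tc2, v21 hE]; exact (hnear a ha).1)
        (by intro i hi; rw [tc2, tc2, v21 hE, v21 hE]; exact (hnear a ha).2.1 i hi)
        (by rw [tc2, ev2, v21 hE, v21 hE]; exact (hnear a ha).2.2)
      obtain ⟨h1, h2, h3⟩ := key a0 le_rfl
      obtain ⟨z, hz, hzz⟩ := newton_root C (Q.map (f2 G)) y
        (by rw [h1, tc2, v21 hE]; exact (hnear a0 le_rfl).1) (δ a0) h2 h3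
      refine ⟨z, hz, fun a ha => ?_⟩
      have := hzz (δ a) (key a ha).2.2
      rw [← sub_add_sub_cancel z y]
      exact (C.v.map_add _ _).trans (max_le this (hy' a))
    obtain ⟨z1, hz1, hz1'⟩ := hK
    obtain ⟨z2, hz2, hz2'⟩ := hM
    have hzG : (z1, z2) ∈ G := by
      refine adj _ ?_ fun P => ?_
      · refine hB2 (Q.map (f1 G)) z1 hmapne ?_ hz1
        intro i
        rw [coeff_map]
        exact hGB _ (Q.coeff i).2
      · have hQz : aeval (z1, z2) Q = 0 := by
          ext
          · rw [aeval_fst]; exact hz1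
          · rw [aeval_snd]; exact hz2
        have h1 : aeval (z1, z2) P = aeval (z1, z2) (P %ₘ Q) := by
          conv_lhs => rw [← modByMonic_add_div P Q]
          rw [map_add, map_mul, hQz, zero_mul, add_zero]
        rw [h1]
        by_cases hW : P %ₘ Q = 0
        · left; rw [hW, map_zero]
        have hne1 : Q ≠ 1 := by rintro rfl; simp at hdpos
        obtain ⟨a, ha⟩ := hmin (P %ₘ Q) hW (by rw [← hQd]; exact natDegree_modByMonic_lt P hQm hne1)
        rcases le_total (δ a) (δ a0) with hle | hle
        · exact ha.E hE (hz1' a hle) (hz2' a hle)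
        · have := ha.persist (a' := a0) ((hcl _ _).trans (max_le hle le_rfl)) hle (hδ0 _)
          exact this.E hE (hz1' a0 le_rfl) (hz2' a0 le_rfl)
    obtain ⟨a', ha'⟩ := hnomin ⟨_, hzG⟩
    have h5 : ∃ a'' : G, δ a'' < δ ⟨_, hzG⟩ ∧ δ a'' ≤ δ a0 := by
      rcases le_total (δ a') (δ a0) with hle | hle
      · exact ⟨a', ha', hle⟩
      · exact ⟨a0, lt_of_le_of_lt hle ha', le_rfl⟩
    obtain ⟨a'', h6, h7⟩ := h5
    have h8 : δ ⟨_, hzG⟩ ≤ δ a'' := by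
      change A.v (x - z1) ≤ _
      rw [← sub_sub_sub_cancel_right x z1 (f1 G a'')]
      exact (A.v.map_sub _ _).trans (max_le le_rfl (hz1' a'' h7))
    exact absurd h6 (not_lt.2 h8)
end imm
end AK
namespace AK
open Polynomial
section transfer
variable {k Γ K M : Type*} [Field k] [LinearOrderedCommGroupWithZero Γ] [Field K] [Field M]
  {A : CF k Γ K} {C : CF k Γ M}

lemma Good.E {G : Subring (K × M)} (hG : Good A C G) : ∀ e ∈ G, E A C e := by
  intro e he
  rcases hG.2 e he with h | ⟨α, γ, h1, h2, h3, h4, -⟩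
  · exact Or.inl h
  · exact Or.inr ⟨α, γ, h1, h2, h3, h4⟩

lemma Good.inj1 {G : Subring (K × M)} (hG : ∀ e ∈ G, AK.E A C e) {e : K × M} (he : e ∈ G)
    (h : e.1 = 0) : e = 0 := by
  by_contra h0
  exact (hG e he).ne1 h0 h

lemma Good.inj2 {G : Subring (K × M)} (hG : ∀ e ∈ G, AK.E A C e) {e : K × M} (he : e ∈ G)
    (h : e.2 = 0) : e = 0 := by
  by_contra h0
  exact (hG e he).ne2 h0 h

theorem ext_good [CharZero k] {G : Subring (K × M)} (hG : Good A C G)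
    (hGc : (G : Set (K × M)).Countable) (S : Set K) (hS : S.Countable) :
    ∃ G' : Subring (K × M), Good A C G' ∧ G ≤ G' ∧ (G' : Set (K × M)).Countable ∧
      ∀ x ∈ S, ∃ e ∈ G', e.1 = x := by
  obtain ⟨B, hBc, hSB, hB1, hB2⟩ := exists_closed A (S ∪ Prod.fst '' (G : Set (K × M)))
    (hS.union (hGc.image _))
  set G1 := Subring.closure ((G : Set (K × M)) ∪ dι A C '' {α | A.ι α ∈ B} ∪
    ds A C '' {γ | A.s γ ∈ B}) with hG1
  have hG1E : ∀ e ∈ G1, AK.E A C e := fun e he => stepA' hG _ _ e he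
  have hG1B : ∀ e ∈ G1, e.1 ∈ B := by
    have : G1 ≤ B.toSubring.comap (RingHom.fst K M) := by
      rw [hG1, Subring.closure_le]
      rintro x ((hx | ⟨α, hα, rfl⟩) | ⟨γ, hγ, rfl⟩)
      · exact hSB (Or.inr ⟨x, hx, rfl⟩)
      · exact hα
      · exact hγ
    exact this
  obtain ⟨G', hle, hmax⟩ := zorn_le_nonempty₀
    {H : Subring (K × M) | (∀ e ∈ H, AK.E A C e) ∧ ∀ e ∈ H, e.1 ∈ B} (by
      intro c hc hch y hy
      have hd : DirectedOn (· ≤ ·) c := hch.directedOn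
      have hm : ∀ e, e ∈ sSup c ↔ ∃ s ∈ c, e ∈ s := fun e =>
        Subring.mem_sSup_of_directedOn ⟨y, hy⟩ hd
      refine ⟨sSup c, ⟨?_, ?_⟩, fun z hz => le_sSup hz⟩
      · intro e he
        obtain ⟨s, hs, hes⟩ := (hm e).1 he
        exact (hc hs).1 e hes
      · intro e he
        obtain ⟨s, hs, hes⟩ := (hm e).1 he
        exact (hc hs).2 e hes) G1 ⟨hG1E, hG1B⟩
  have hι : ∀ α, A.ι α ∈ B → dι A C α ∈ G' := fun α hα =>
    hle (Subring.subset_closure (Or.inl (Or.inr ⟨α, hα, rfl⟩)))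
  have hs : ∀ γ, A.s γ ∈ B → ds A C γ ∈ G' := fun γ hγ =>
    hle (Subring.subset_closure (Or.inr ⟨γ, hγ, rfl⟩))
  obtain ⟨hE, hGB⟩ := hmax.prop
  obtain ⟨h1, h2⟩ := imm B hBc hB1 hB2 hE hGB hι hs (fun G'' h3 h4 h5 => hmax.2 ⟨h4, h5⟩ h3)
  refine ⟨G', ⟨h1, ?_⟩, ?_, ?_, ?_⟩
  · intro e he
    rcases hE e he with h | ⟨α, γ, hα, hγ, h3, h4⟩
    · exact Or.inl h
    · obtain ⟨h5, h6⟩ := hB1 e.1 (hGB e he) α γ hα hγ h3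
      exact Or.inr ⟨α, γ, hα, hγ, h3, h4, hι _ h5, hs _ h6⟩
  · intro e he
    exact hle (Subring.subset_closure (Or.inl (Or.inl he)))
  · have hinj : Set.InjOn Prod.fst (G' : Set (K × M)) := by
      intro x hx y hy hxy
      have := Good.inj1 hE (sub_mem hx hy) (by simp [hxy])
      exact sub_eq_zero.1 this
    refine Set.MapsTo.countable_of_injOn (t := (B : Set K)) ?_ hinj hBc
    intro e he
    exact hGB e he
  · intro x hx
    exact h2 x (hSB (Or.inl hx))

lemma Good.swap {G : Subring (K × M)} (hG : Good A C G) :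
    Good C A (G.comap (RingEquiv.prodComm : M × K ≃+* K × M).toRingHom) := by
  constructor
  · intro e he
    exact hG.1 _ he
  · intro e he
    rcases hG.2 _ he with h | ⟨α, γ, h1, h2, h3, h4, h5, h6⟩
    · left
      have h7 := congrArg Prod.fst h
      have h8 := congrArg Prod.snd h
      exact Prod.ext h8 h7
    · exact Or.inr ⟨α, γ, h1, h2, h4, h3, h5, h6⟩

lemma swap_countable {G : Subring (K × M)} (hG : (G : Set (K × M)).Countable) :
    ((G.comap (RingEquiv.prodComm : M × K ≃+* K × M).toRingHom : Subring _) :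
      Set (M × K)).Countable := by
  refine (hG.image Prod.swap).mono ?_
  intro e he
  exact ⟨e.swap, he, by simp⟩

variable (A C) in
lemma exists_good [CharZero k] : ∃ G : Subring (K × M), Good A C G ∧ (G : Set (K × M)).Countable := by
  refine ⟨((dι A C).comp (algebraMap ℚ k)).range, ⟨?_, ?_⟩, ?_⟩
  · rintro _ ⟨q, rfl⟩
    refine ⟨q⁻¹, ?_⟩
    ext <;> simp [dι]
  · rintro _ ⟨q, rfl⟩
    by_cases h : q = 0
    · left; simp [h]
    · right
      refine ⟨algebraMap ℚ k q, 1, by simpa using h, one_ne_zero, ?_, ?_, ⟨q, rfl⟩, ?_⟩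
      · simp [CF.lt, dι]
      · simp [CF.lt, dι]
      · rw [map_one]; exact one_mem _
  · rw [RingHom.coe_range]
    exact Set.countable_range _

/-- value of the polynomial with coefficients `c` and exponents in `I` -/
def form {F : Type*} [CommRing F] {n : ℕ} (I : Finset (Fin n → ℕ)) (c : (Fin n → ℕ) → F)
    (x : Fin n → F) : F := ∑ m ∈ I, c m * ∏ i, x i ^ m i

lemma map_form {F F' : Type*} [CommRing F] [CommRing F'] (φ : F →+* F') {n : ℕ}
    (I : Finset (Fin n → ℕ)) (c : (Fin n → ℕ) → F) (x : Fin n → F) :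
    φ (form I c x) = form I (fun m => φ (c m)) (fun i => φ (x i)) := by
  simp [form]

theorem transfer (A : CF k Γ K) (C : CF k Γ M) [CharZero k] {n : ℕ} (I : Finset (Fin n → ℕ))
    (h : ∀ c : (Fin n → ℕ) → M, ∃ y : Fin n → M, y ≠ 0 ∧ form I c y = 0)
    (c : (Fin n → ℕ) → K) : ∃ x : Fin n → K, x ≠ 0 ∧ form I c x = 0 := by
  obtain ⟨G0, hG0, hc0⟩ := exists_good A C
  obtain ⟨G1, hG1, -, hc1, hS⟩ := ext_good hG0 hc0 (Set.range c) (Set.countable_range c)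
  choose b hb hb1 using fun m => hS (c m) ⟨m, rfl⟩
  obtain ⟨y, hy, hy0⟩ := h (fun m => (b m).2)
  obtain ⟨G2, hG2, hle, -, hS2⟩ := ext_good hG1.swap (swap_countable hc1) (Set.range y)
    (Set.countable_range y)
  choose z hz hz1 using fun i => hS2 (y i) ⟨i, rfl⟩
  have hform : form I (fun m => (b m).swap) z ∈ G2 := by
    refine sum_mem fun m _ => mul_mem (hle (show (b m).swap.swap ∈ G1 from ?_)) ?_
    · simpa using hb m
    · exact prod_mem fun i _ => pow_mem (hz i) _
  have hzero : form I (fun m => (b m).swap) z = 0 := by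
    refine Good.inj1 hG2.E hform ?_
    have := map_form (RingHom.fst M K) I (fun m => (b m).swap) z
    simp only [RingHom.coe_fst, Prod.fst_swap, hz1] at this
    rw [this, hy0]
  refine ⟨fun i => (z i).2, ?_, ?_⟩
  · obtain ⟨i, hi⟩ := Function.ne_iff.1 hy
    refine Function.ne_iff.2 ⟨i, ?_⟩
    have : z i ≠ 0 := by
      intro h
      apply hi
      rw [← hz1, h]
      rfl
    exact (hG2.E _ (hz i)).ne2 this
  · have := map_form (RingHom.snd M K) I (fun m => (b m).swap) z
    simp only [RingHom.coe_snd, Prod.snd_swap, hb1] at this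
    rw [← this, hzero]
    rfl
end transfer
end AK
namespace AK
open Polynomial WithZero Filter
section ult
variable (U : Ultrafilter ℕ)

/-- the value group -/
abbrev VG : Type := Filter.Germ (U : Filter ℕ) ℤᵐ⁰

noncomputable instance VG.inst : LinearOrderedCommGroupWithZero (VG U) where
  __ := (Germ.instGroupWithZero : GroupWithZero (VG U))
  __ := (Germ.instCommMonoid : CommMonoid (VG U))
  __ := (Germ.instLinearOrder : LinearOrder (VG U))
  __ := (Germ.instOrderBot : OrderBot (VG U))
  isBot_zero := by
    intro x
    induction x using Germ.inductionOn with
    | _ f => exact Germ.coe_le.2 (Eventually.of_forall fun i => zero_le)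
  mul_lt_mul_of_pos_left := by
    intro a ha b c hbc
    induction a using Germ.inductionOn with
    | _ f => 
      revert hbc
      refine Germ.inductionOn₂ b c fun g h hgh => ?_
      refine Germ.coe_lt.2 <| (Germ.coe_lt.1 ha).mp <| (Germ.coe_lt.1 hgh).mono fun _ h1 h2 => ?_
      exact mul_lt_mul_of_pos_left h1 h2

variable (K : ℕ → Type) [∀ i, Field (K i)]

/-- sequences that vanish almost everywhere -/
def nullI : Ideal (∀ i, K i) where
  carrier := {x | ∀ᶠ i in U, x i = 0}
  add_mem' := by
    intro a b ha hb
    filter_upwards [ha, hb] with i h1 h2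
    simp [h1, h2]
  zero_mem' := by simp
  smul_mem' := by
    intro c x hx
    filter_upwards [hx] with i h1
    simp [h1]

instance : (nullI U K).IsMaximal := by
  rw [Ideal.isMaximal_iff]
  constructor
  · intro h
    obtain ⟨i, hi⟩ := (show ∀ᶠ i in U, (1 : ∀ i, K i) i = 0 from h).exists
    simp at hi
  · intro J x hJ hx hxJ
    have hx' : ∀ᶠ i in U, x i ≠ 0 := Ultrafilter.eventually_not.2 hx
    have h1 : 1 - x⁻¹ * x ∈ nullI U K := by
      filter_upwards [hx'] with i hi
      simp [hi]
    have := J.add_mem (hJ h1) (J.mul_mem_left x⁻¹ hxJ)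
    simpa using this

/-- the ultraproduct -/
def Ult : Type := (∀ i, K i) ⧸ nullI U K

noncomputable instance : Field (Ult U K) := Ideal.Quotient.field (nullI U K)

/-- quotient map -/
noncomputable def um : (∀ i, K i) →+* Ult U K := Ideal.Quotient.mk (nullI U K)

lemma um_surj : Function.Surjective (um U K) := Ideal.Quotient.mk_surjective

variable {U K}
lemma um_eq {x y : ∀ i, K i} : um U K x = um U K y ↔ ∀ᶠ i in U, x i = y i := by
  unfold um
  erw [Ideal.Quotient.eq]
  show (∀ᶠ i in U, (x - y) i = 0) ↔ _
  simp [sub_eq_zero]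

lemma um_eq_zero {x : ∀ i, K i} : um U K x = 0 ↔ ∀ᶠ i in U, x i = 0 := by
  rw [← map_zero (um U K), um_eq]; rfl

/-- representative -/
noncomputable def ur (x : Ult U K) : ∀ i, K i := Function.surjInv (um_surj U K) x
@[simp] lemma um_ur (x : Ult U K) : um U K (ur x) = x := Function.surjInv_eq _ x
lemma ur_um (x : ∀ i, K i) : ∀ᶠ i in U, ur (um U K x) i = x i := um_eq.1 (um_ur _)

variable (U) in
/-- the ultraproduct valuation as a function -/
noncomputable def uvf (w : ∀ i, Valuation (K i) ℤᵐ⁰) (x : Ult U K) : VG U :=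
  ((fun i => w i (ur x i) : ℕ → ℤᵐ⁰) : Germ (U : Filter ℕ) ℤᵐ⁰)

lemma uvf_um (w : ∀ i, Valuation (K i) ℤᵐ⁰) (x : ∀ i, K i) :
    uvf U w (um U K x) = ((fun i => w i (x i) : ℕ → ℤᵐ⁰) : Germ (U : Filter ℕ) ℤᵐ⁰) := by
  refine Germ.coe_eq.2 ?_
  filter_upwards [ur_um (U := U) x] with i hi
  rw [hi]

variable (U) in
/-- the ultraproduct valuation -/
noncomputable def uv (w : ∀ i, Valuation (K i) ℤᵐ⁰) : Valuation (Ult U K) (VG U) where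
  toFun := uvf U w
  map_zero' := by
    rw [← map_zero (um U K), uvf_um]
    exact Germ.coe_eq.2 (Eventually.of_forall fun i => by simp)
  map_one' := by
    rw [← map_one (um U K), uvf_um]
    exact Germ.coe_eq.2 (Eventually.of_forall fun i => by simp)
  map_mul' := by
    intro x y
    obtain ⟨x, rfl⟩ := um_surj U K x
    obtain ⟨y, rfl⟩ := um_surj U K y
    rw [← map_mul, uvf_um, uvf_um, uvf_um]
    exact Germ.coe_eq.2 (Eventually.of_forall fun i => by simp)
  map_add_le_max' := by
    intro x y
    obtain ⟨x, rfl⟩ := um_surj U K x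
    obtain ⟨y, rfl⟩ := um_surj U K y
    rw [← map_add, uvf_um, uvf_um, uvf_um, Germ.max_def]
    exact Germ.coe_le.2 (Eventually.of_forall fun i => (w i).map_add _ _)

lemma uv_um (w : ∀ i, Valuation (K i) ℤᵐ⁰) (x : ∀ i, K i) :
    uv U w (um U K x) = ((fun i => w i (x i) : ℕ → ℤᵐ⁰) : Germ (U : Filter ℕ) ℤᵐ⁰) := uvf_um w x

lemma uv_le {w : ∀ i, Valuation (K i) ℤᵐ⁰} {x : ∀ i, K i} {f : ℕ → ℤᵐ⁰} :
    uv U w (um U K x) ≤ (f : Germ (U : Filter ℕ) ℤᵐ⁰) ↔ ∀ᶠ i in U, w i (x i) ≤ f i := by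
  rw [uv_um]; exact Germ.coe_le

lemma uv_lt {w : ∀ i, Valuation (K i) ℤᵐ⁰} {x : ∀ i, K i} {f : ℕ → ℤᵐ⁰} :
    uv U w (um U K x) < (f : Germ (U : Filter ℕ) ℤᵐ⁰) ↔ ∀ᶠ i in U, w i (x i) < f i := by
  rw [uv_um]; exact Germ.coe_lt

lemma uv_le_one {w : ∀ i, Valuation (K i) ℤᵐ⁰} {x : ∀ i, K i} :
    uv U w (um U K x) ≤ 1 ↔ ∀ᶠ i in U, w i (x i) ≤ 1 := uv_le (f := fun _ => 1)

lemma uv_lt_one {w : ∀ i, Valuation (K i) ℤᵐ⁰} {x : ∀ i, K i} :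
    uv U w (um U K x) < 1 ↔ ∀ᶠ i in U, w i (x i) < 1 := uv_lt (f := fun _ => 1)

lemma uv_eq_one {w : ∀ i, Valuation (K i) ℤᵐ⁰} {x : ∀ i, K i} :
    uv U w (um U K x) = 1 ↔ ∀ᶠ i in U, w i (x i) = 1 := by
  rw [uv_um]; exact Germ.coe_eq

/-- cross section from a uniformizer -/
noncomputable def cs {F : Type} [Field F] (π : F) (h : π ≠ 0) : ℤᵐ⁰ →*₀ F :=
  WithZero.lift' ((Units.coeHom F).comp (zpowersHom Fˣ (Units.mk0 π h)⁻¹))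

lemma cs_v {F : Type} [Field F] (w : Valuation F ℤᵐ⁰) (π : F) (h : π ≠ 0)
    (hπ : w π = exp (-1)) (γ : ℤᵐ⁰) : w (cs π h γ) = γ := by
  induction γ using WithZero.recZeroCoe with
  | zero => simp
  | coe a =>
    have : cs π h (a : ℤᵐ⁰) = π⁻¹ ^ (Multiplicative.toAdd a) := by
      unfold cs
      rw [WithZero.lift'_coe]
      simp [zpowersHom_apply]
    rw [this, map_zpow₀, map_inv₀, hπ, ← exp_neg, ← exp_zsmul]
    simp [exp]

/-- the ultraproduct cross section -/
noncomputable def us (σ : ∀ i, ℤᵐ⁰ →*₀ K i) : VG U →*₀ Ult U K where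
  toFun γ := Quotient.liftOn' γ (fun f => um U K (fun i => σ i (f i))) (by
    intro f g hfg
    refine um_eq.2 ?_
    filter_upwards [hfg] with i hi
    rw [hi])
  map_zero' := by
    show um U K (fun i => σ i 0) = 0
    exact um_eq_zero.2 (Eventually.of_forall fun i => by simp)
  map_one' := by
    show um U K (fun i => σ i 1) = 1
    rw [← map_one (um U K)]
    exact um_eq.2 (Eventually.of_forall fun i => by simp)
  map_mul' := by
    intro x y
    refine Germ.inductionOn₂ x y fun f g => ?_
    show um U K (fun i => σ i (f i * g i)) = um U K (fun i => σ i (f i)) * um U K (fun i => σ i (g i))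
    rw [← map_mul]
    exact um_eq.2 (Eventually.of_forall fun i => by simp)

lemma us_v (w : ∀ i, Valuation (K i) ℤᵐ⁰) (σ : ∀ i, ℤᵐ⁰ →*₀ K i)
    (h : ∀ i γ, w i (σ i γ) = γ) (γ : VG U) : uv U w (us σ γ) = γ := by
  induction γ using Germ.inductionOn with
  | _ f =>
    show uv U w (um U K (fun i => σ i (f i))) = _
    rw [uv_um]
    simp only [h]

lemma u_sph (hU : ∀ n, ∀ᶠ i in (U : Filter ℕ), n ≤ i) (w : ∀ i, Valuation (K i) ℤᵐ⁰)
    (c : ℕ → Ult U K) (δ : ℕ → VG U)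
    (h : ∀ n, ∃ y, ∀ i ≤ n, uv U w (y - c i) ≤ δ i) : ∃ y, ∀ i, uv U w (y - c i) ≤ δ i := by
  classical
  have hd : ∀ n, ∃ f : ℕ → ℤᵐ⁰, δ n = (f : Germ (U : Filter ℕ) ℤᵐ⁰) := fun n =>
    (Quotient.exists_rep (δ n)).imp fun f hf => hf.symm
  choose e he using hd
  choose b hb using fun n => um_surj U K (c n)
  choose y hy using h
  choose z hz using fun n => um_surj U K (y n)
  have key : ∀ n, ∀ᶠ i in U, ∀ j ≤ n, w i (z n i - b j i) ≤ e j i := by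
    intro n
    have : ∀ j ∈ Finset.range (n + 1), ∀ᶠ i in U, w i (z n i - b j i) ≤ e j i := by
      intro j hj
      have := hy n j (by simpa [Nat.lt_succ_iff] using hj)
      rw [← hz, ← hb, ← map_sub, he] at this
      exact uv_le.1 this
    filter_upwards [(Finset.eventually_all (Finset.range (n+1))).2 this] with i hi j hj
    exact hi j (by simp; omega)
  let Pn : ℕ → ℕ → Prop := fun i n => ∀ j ≤ n, w i (z n i - b j i) ≤ e j i
  refine ⟨um U K (fun i => z (Nat.findGreatest (Pn i) i) i), fun j => ?_⟩
  rw [← hb, ← map_sub, he]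
  refine uv_le.2 ?_
  filter_upwards [key j, hU j] with i h1 h2
  have h3 : j ≤ Nat.findGreatest (Pn i) i := Nat.le_findGreatest h2 h1
  have h4 : Pn i (Nat.findGreatest (Pn i) i) := Nat.findGreatest_spec (m := j) h2 h1
  exact h4 j h3

/-- Hensel property -/
def Hens {F Γ : Type*} [Field F] [LinearOrderedCommGroupWithZero Γ] (v : Valuation F Γ) : Prop :=
  ∀ (n : ℕ) (c : ℕ → F) (a : F), (∀ j < n, v (c j) ≤ 1) → v a ≤ 1 →
    v (a ^ n + ∑ j ∈ Finset.range n, c j * a ^ j) < 1 →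
    v (n * a ^ (n - 1) + ∑ j ∈ Finset.range n, c j * (j * a ^ (j - 1))) = 1 →
    ∃ z, z ^ n + ∑ j ∈ Finset.range n, c j * z ^ j = 0 ∧ v (z - a) < 1

lemma u_hens (w : ∀ i, Valuation (K i) ℤᵐ⁰) (h : ∀ i, Hens (w i)) : Hens (uv U w) := by
  intro n c a hc ha h1 h2
  obtain ⟨a, rfl⟩ := um_surj U K a
  choose b hb using fun n => um_surj U K (c n)
  obtain rfl : (fun j => um U K (b j)) = c := funext hb
  have e1 : um U K a ^ n + ∑ j ∈ Finset.range n, um U K (b j) * um U K a ^ j =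
    um U K (fun i => a i ^ n + ∑ j ∈ Finset.range n, b j i * a i ^ j) := by
    rw [← map_pow]
    simp_rw [← map_pow, ← map_mul]
    rw [← map_sum, ← map_add]
    congr 1
    ext i
    simp
  have e2 : (n : Ult U K) * um U K a ^ (n - 1) +
      ∑ j ∈ Finset.range n, um U K (b j) * (j * um U K a ^ (j - 1)) =
      um U K (fun i => n * a i ^ (n - 1) + ∑ j ∈ Finset.range n, b j i * (j * a i ^ (j - 1))) := by
    rw [← map_natCast (um U K)]
    simp_rw [← map_natCast (um U K), ← map_pow, ← map_mul]
    rw [← map_sum, ← map_add]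
    congr 1
    ext i
    simp
  rw [e1, uv_lt_one] at h1
  rw [e2, uv_eq_one] at h2
  rw [uv_le_one] at ha
  have hc' : ∀ᶠ i in U, ∀ j ∈ Finset.range n, w i (b j i) ≤ 1 :=
    (Finset.eventually_all _).2 fun j hj => uv_le_one.1 (hc j (by simpa using hj))
  have : ∀ i, ∃ z, (w i (a i ^ n + ∑ j ∈ Finset.range n, b j i * a i ^ j) < 1) →
    w i (n * a i ^ (n - 1) + ∑ j ∈ Finset.range n, b j i * (j * a i ^ (j - 1))) = 1 →
    w i (a i) ≤ 1 → (∀ j ∈ Finset.range n, w i (b j i) ≤ 1) →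
    z ^ n + ∑ j ∈ Finset.range n, b j i * z ^ j = 0 ∧ w i (z - a i) < 1 := by
    intro i
    by_cases hh : (w i (a i ^ n + ∑ j ∈ Finset.range n, b j i * a i ^ j) < 1) ∧
      w i (n * a i ^ (n - 1) + ∑ j ∈ Finset.range n, b j i * (j * a i ^ (j - 1))) = 1 ∧
      w i (a i) ≤ 1 ∧ (∀ j ∈ Finset.range n, w i (b j i) ≤ 1)
    · obtain ⟨z, hz⟩ := h i n (fun j => b j i) (a i) (by simpa using hh.2.2.2) hh.2.2.1 hh.1 hh.2.1
      exact ⟨z, fun _ _ _ _ => hz⟩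
    · exact ⟨0, fun h1 h2 h3 h4 => absurd ⟨h1, h2, h3, h4⟩ hh⟩
  choose z hz using this
  refine ⟨um U K z, ?_, ?_⟩
  · have e3 : um U K z ^ n + ∑ j ∈ Finset.range n, um U K (b j) * um U K z ^ j =
      um U K (fun i => z i ^ n + ∑ j ∈ Finset.range n, b j i * z i ^ j) := by
      rw [← map_pow]
      simp_rw [← map_pow, ← map_mul]
      rw [← map_sum, ← map_add]
      congr 1
      ext i
      simp
    rw [e3]
    refine um_eq_zero.2 ?_
    filter_upwards [h1, h2, ha, hc'] with i a1 a2 a3 a4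
    exact (hz i a1 a2 a3 a4).1
  · rw [← map_sub, uv_lt_one]
    filter_upwards [h1, h2, ha, hc'] with i a1 a2 a3 a4
    exact (hz i a1 a2 a3 a4).2
end ult
end AK
namespace AK
open Polynomial WithZero Filter
section newton

theorem newton_of_hens {F Γ : Type*} [Field F] [LinearOrderedCommGroupWithZero Γ]
    {v : Valuation F Γ} (H : Hens v) (Q : F[X]) (w : F) (h1 : (taylor w Q).coeff 1 ≠ 0)
    (h2 : ∀ i, 2 ≤ i → v ((taylor w Q).coeff i) * v (Q.eval w) ^ (i - 1) <
      v ((taylor w Q).coeff 1) ^ i) :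
    ∃ z, Q.eval z = 0 ∧ v (z - w) * v ((taylor w Q).coeff 1) ≤ v (Q.eval w) := by
  by_cases h0 : Q.eval w = 0
  · exact ⟨w, h0, by simp⟩
  set R := taylor w Q with hR
  have hq0 : R.coeff 0 = Q.eval w := taylor_coeff_zero _ _
  set q0 := Q.eval w with hq0'
  set q1 := R.coeff 1 with hq1
  set ε := - q0 / q1 with hε
  have hε0 : ε ≠ 0 := div_ne_zero (neg_ne_zero.2 h0) h1
  let C : ℕ → F := fun i => R.coeff i * ε ^ i / q0
  have hC0 : C 0 = 1 := by simp [C, hq0, h0]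
  have hC1 : C 1 = -1 := by
    simp only [C, pow_one, ← hq1, hε]
    field_simp
  have hv0 : v q0 ≠ 0 := by simpa using h0
  have hv1 : v q1 ≠ 0 := by simpa using h1
  have hC : ∀ i, 2 ≤ i → v (C i) < 1 := by
    intro i hi
    have := h2 i hi
    simp only [C, map_div₀, map_mul, map_pow, hε, Valuation.map_neg]
    obtain ⟨j, rfl⟩ : ∃ j, i = j + 1 := ⟨i - 1, by omega⟩
    rw [div_lt_one₀ (zero_lt_iff.2 hv0), div_pow, mul_div_assoc',
      div_lt_iff₀ (pow_pos (zero_lt_iff.2 hv1) _), pow_succ (v q0), ← mul_assoc, mul_comm (v q0)]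
    exact mul_lt_mul_of_pos_right this (zero_lt_iff.2 hv0)
  set m := R.natDegree + 1 with hm
  have hsm : ∀ j ∈ Finset.range m, v (C (m + 1 - j)) < 1 := by
    intro j hj
    simp at hj
    exact hC _ (by omega)
  obtain ⟨u, hu, hu1⟩ := H (m + 1) (fun j => C (m + 1 - j)) 1 (by
      intro j hj
      by_cases hjm : j = m
      · subst hjm
        simp [hC1]
      · exact (hsm j (by simp; omega)).le) (by simp) (by
      simp only [Finset.sum_range_succ, one_pow, mul_one, Nat.add_sub_cancel_left, hC1]
      have : (1 : F) + (∑ j ∈ Finset.range m, C (m + 1 - j) + -1) =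
        ∑ j ∈ Finset.range m, C (m + 1 - j) := by ring
      rw [this]
      exact v.map_sum_lt one_ne_zero hsm) (by
      simp only [Finset.sum_range_succ, one_pow, mul_one, Nat.add_sub_cancel_left, hC1]
      have : ((m + 1 : ℕ) : F) + (∑ j ∈ Finset.range m, C (m + 1 - j) * j + -1 * m) =
        1 + ∑ j ∈ Finset.range m, C (m + 1 - j) * j := by push_cast; ring
      rw [this]
      refine v.map_one_add_of_lt (v.map_sum_lt one_ne_zero fun j hj => ?_)
      rw [map_mul]
      exact mul_lt_one_of_lt_of_le (hsm j hj) (v_nat_le v _))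
  have hvu : v u = 1 := by
    have := v.map_one_add_of_lt hu1
    rwa [add_sub_cancel] at this
  have hu0 : u ≠ 0 := by
    rintro rfl
    simp at hvu
  refine ⟨w + ε * u⁻¹, ?_, ?_⟩
  · have e1 : Q.eval (w + ε * u⁻¹) = R.eval (ε * u⁻¹) := by
      rw [hR, taylor_eval, add_comm]
    rw [e1, eval_eq_sum_range' (n := m + 2) (by omega)]
    have e2 : ∀ i ∈ Finset.range (m + 2), R.coeff i * (ε * u⁻¹) ^ i =
        q0 * (u⁻¹) ^ (m + 1) * (C i * u ^ (m + 1 - i)) := by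
      intro i hi
      simp at hi
      simp only [C]
      have : u ^ (m + 1) = u ^ (m + 1 - i) * u ^ i := by rw [← pow_add]; congr 1; omega
      rw [mul_pow ε, inv_pow, inv_pow, this]
      field_simp
    rw [Finset.sum_congr rfl e2, ← Finset.mul_sum, ← Finset.sum_range_reflect]
    rw [Finset.sum_range_succ]
    have e3 : ∀ j ∈ Finset.range (m + 1), C (m + 2 - 1 - j) * u ^ (m + 1 - (m + 2 - 1 - j)) =
      C (m + 1 - j) * u ^ j := by
      intro j hj
      simp at hj
      congr 2
      omega
    rw [Finset.sum_congr rfl e3]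
    simp only [show m + 2 - 1 - (m + 1) = 0 by omega, hC0, one_mul, Nat.sub_zero]
    rw [add_comm] at hu
    rw [hu, mul_zero]
  · rw [add_sub_cancel_left, map_mul, map_inv₀, hvu, inv_one, mul_one, hε, map_div₀,
      Valuation.map_neg, div_mul_cancel₀ _ hv1]

/-- assemble the structure on an ultraproduct -/
noncomputable def mkCF {U : Ultrafilter ℕ} {K : ℕ → Type} [∀ i, Field (K i)]
    (hU : ∀ n, ∀ᶠ i in (U : Filter ℕ), n ≤ i)
    (w : ∀ i, Valuation (K i) ℤᵐ⁰) (σ : ∀ i, ℤᵐ⁰ →*₀ K i) (hσ : ∀ i γ, w i (σ i γ) = γ)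
    (hH : ∀ i, Hens (w i)) {k : Type} [Field k] (ι : k →+* Ult U K)
    (hι : ∀ α, α ≠ 0 → uv U w (ι α) = 1)
    (hl : ∀ a, uv U w a = 1 → ∃ α, uv U w (a - ι α) < 1) : CF k (VG U) (Ult U K) where
  v := uv U w
  ι := ι
  s := us σ
  v_ι := hι
  v_s := us_v w σ hσ
  lead := by
    intro a ha
    have hv : uv U w a ≠ 0 := by simpa using ha
    have hs0 : us σ (uv U w a) ≠ 0 := by
      intro h
      have := us_v w σ hσ (uv U w a)
      rw [h, map_zero] at this
      exact hv this.symm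
    have h1 : uv U w (a / us σ (uv U w a)) = 1 := by
      rw [map_div₀, us_v w σ hσ, div_self hv]
    obtain ⟨α, hα⟩ := hl _ h1
    refine ⟨α, ?_, ?_⟩
    · rintro rfl
      rw [map_zero, sub_zero, h1] at hα
      exact lt_irrefl _ hα
    · have : a - ι α * us σ (uv U w a) = (a / us σ (uv U w a) - ι α) * us σ (uv U w a) := by
        field_simp
      rw [this, map_mul, us_v w σ hσ]
      exact (mul_lt_mul_of_pos_right hα (zero_lt_iff.2 hv)).trans_eq (one_mul _)
  newton := newton_of_hens (u_hens w hH)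
  sph := u_sph hU w
end newton
end AK
namespace AK
open Polynomial WithZero Filter
section coeff
variable {F Γ : Type*} [Field F] [LinearOrderedCommGroupWithZero Γ] {v : Valuation F Γ}

/-- polynomial version of the Hensel property -/
def HensP (v : Valuation F Γ) : Prop := ∀ (P : F[X]) (a : F), P.Monic → (∀ j, v (P.coeff j) ≤ 1) →
  v a ≤ 1 → v (P.eval a) < 1 → v (P.derivative.eval a) = 1 → ∃ z, P.eval z = 0 ∧ v (z - a) < 1

lemma eval_monic {P : F[X]} (hP : P.Monic) (a : F) :
    P.eval a = a ^ P.natDegree + ∑ j ∈ Finset.range P.natDegree, P.coeff j * a ^ j := by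
  rw [eval_eq_sum_range, Finset.sum_range_succ, hP.coeff_natDegree, one_mul, add_comm]

lemma deriv_eval_monic {P : F[X]} (hP : P.Monic) (a : F) :
    P.derivative.eval a = P.natDegree * a ^ (P.natDegree - 1) +
      ∑ j ∈ Finset.range P.natDegree, P.coeff j * (j * a ^ (j - 1)) := by
  rw [derivative_eval, sum_over_range _ (by simp), Finset.sum_range_succ, hP.coeff_natDegree,
    one_mul, add_comm]
  simp only [mul_assoc]

lemma Hens.poly (H : Hens v) : HensP v := by
  intro P a hP hc ha h1 h2
  rw [eval_monic hP] at h1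
  rw [deriv_eval_monic hP] at h2
  obtain ⟨z, hz, hz1⟩ := H P.natDegree P.coeff a (fun j _ => hc j) ha h1 h2
  exact ⟨z, by rw [eval_monic hP, hz], hz1⟩

lemma HensP.hens (H : HensP v) : Hens v := by
  intro n c a hc ha h1 h2
  let P : F[X] := X ^ n + ∑ j ∈ Finset.range n, C (c j) * X ^ j
  have hdeg : (∑ j ∈ Finset.range n, C (c j) * X ^ j).degree < (n : WithBot ℕ) := by
    refine (degree_sum_le _ _).trans_lt ?_
    refine (Finset.sup_lt_iff (by exact_mod_cast WithBot.bot_lt_coe n)).2 ?_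
    intro j hj
    refine (degree_C_mul_X_pow_le _ _).trans_lt ?_
    simpa using hj
  have hP : P.Monic := monic_X_pow_add hdeg
  have hPe : ∀ x, P.eval x = x ^ n + ∑ j ∈ Finset.range n, c j * x ^ j := by
    intro x
    simp [P, eval_finsetSum]
  have hPd : ∀ x, P.derivative.eval x = 
     n * x ^ (n - 1) + ∑ j ∈ Finset.range n, c j * (j * x ^ (j - 1)) := by
    intro x
    simp [P, eval_finsetSum, derivative_X_pow]
  have hPc : ∀ j, v (P.coeff j) ≤ 1 := by
    intro j
    simp only [P, coeff_add, coeff_X_pow, finsetSum_coeff, coeff_C_mul]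
    refine (v.map_add _ _).trans (max_le ?_ (v.map_sum_le ?_))
    · split_ifs <;> simp
    · intro i hi
      split_ifs
      · simpa using hc i (by simpa using hi)
      · simp
  rw [← hPe] at h1
  rw [← hPd] at h2
  obtain ⟨z, hz, hz1⟩ := H P a hP hPc ha h1 h2
  exact ⟨z, by rw [← hPe, hz], hz1⟩

lemma gv_mul_lt_one {a b : Γ} (ha : a ≤ 1) (hb : b < 1) : a * b < 1 :=
  (mul_le_of_le_one_left' ha).trans_lt hb

lemma v_pow_sub {z a : F} (hz : v z ≤ 1) (ha : v a ≤ 1) (h : v (z - a) < 1) (i : ℕ) :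
    v (z ^ i - a ^ i) < 1 := by
  rw [← geom_sum₂_mul, map_mul]
  refine gv_mul_lt_one (v.map_sum_le fun j _ => ?_) h
  rw [map_mul, map_pow, map_pow]
  exact mul_le_one' (pow_le_one' hz _) (pow_le_one' ha _)

theorem coeff_field (H : HensP v) (h0 : ∀ n : ℕ, n ≠ 0 → v n = 1) :
    ∃ k : Subfield F, (∀ x ∈ k, x ≠ 0 → v x = 1) ∧ ∀ a, v a ≤ 1 → ∃ b ∈ k, v (a - b) < 1 := by
  have hcz : CharZero F := charZero_of_inj_zero fun n hn => by
    by_contra h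
    have := h0 n h
    rw [hn] at this
    simp at this
  obtain ⟨R, -, hmax⟩ := zorn_le_nonempty₀
    {R : Subring F | ∀ x ∈ R, x ≠ 0 → v x = 1} (by
      intro c hc hch y hy
      have hd : DirectedOn (· ≤ ·) c := hch.directedOn
      have hm : ∀ e, e ∈ sSup c ↔ ∃ s ∈ c, e ∈ s := fun e =>
        Subring.mem_sSup_of_directedOn ⟨y, hy⟩ hd
      refine ⟨sSup c, ?_, fun z hz => le_sSup hz⟩
      · intro e he
        obtain ⟨s, hs, hes⟩ := (hm e).1 he
        exact hc hs e hes) ⊥ (by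
      intro x hx hx0
      obtain ⟨n, rfl⟩ := Subring.mem_bot.1 hx
      have hn : n.natAbs ≠ 0 := by
        intro h
        apply hx0
        rw [Int.natAbs_eq_zero] at h
        simp [h]
      rcases Int.natAbs_eq n with h | h
      · rw [h]; simpa using h0 _ hn
      · rw [h]; simpa using h0 _ hn)
  have hRle : (Subfield.closure (R : Set F)).toSubring ≤ R := by
    refine hmax.2 ?_ (fun x hx => Subfield.subset_closure hx)
    intro x hx hx0
    obtain ⟨y, hy, z, hz, rfl⟩ := Subfield.mem_closure_iff.1 hx
    rw [Subring.closure_eq] at hy hz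
    have hy0 : y ≠ 0 := by rintro rfl; simp at hx0
    have hz0 : z ≠ 0 := by rintro rfl; simp at hx0
    rw [map_div₀, hmax.prop y hy hy0, hmax.prop z hz hz0, div_one]
  set k := Subfield.closure (R : Set F) with hk
  have hk1 : ∀ x ∈ k, x ≠ 0 → v x = 1 := fun x hx => hmax.prop x (hRle hx)
  have hkle : ∀ x : k, v (x : F) ≤ 1 := by
    intro x
    by_cases hx : (x : F) = 0
    · simp [hx]
    · exact (hk1 x x.2 hx).le
  have adj : ∀ z : F, (∀ T : k[X], aeval z T = 0 ∨ v (aeval z T) = 1) → z ∈ k := by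
    intro z hz
    have hmem : ∀ e, e ∈ (Algebra.adjoin k {z}).toSubring ↔ ∃ Q : k[X], aeval z Q = e := by
      intro e
      rw [Subalgebra.mem_toSubring, Algebra.adjoin_singleton_eq_range_aeval]
      rfl
    have : (Algebra.adjoin k {z}).toSubring ≤ R := by
      refine hmax.2 ?_ ?_
      · intro x hx hx0
        obtain ⟨Q, rfl⟩ := (hmem x).1 hx
        exact (hz Q).resolve_left hx0
      · intro x hx
        exact (hmem x).2 ⟨C ⟨x, Subfield.subset_closure hx⟩, by simp; rfl⟩
    exact Subfield.subset_closure (this ((hmem z).2 ⟨X, by simp⟩))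
  refine ⟨k, hk1, fun a ha => ?_⟩
  have hTle : ∀ T : k[X], ∀ z, v z ≤ 1 → v (aeval z T) ≤ 1 := by
    intro T z hz
    rw [aeval_eq_sum_range]
    refine v.map_sum_le fun i _ => ?_
    rw [Algebra.smul_def, map_mul, map_pow]
    exact mul_le_one' (hkle _) (pow_le_one' hz _)
  by_cases hP : ∃ n, ∃ P : k[X], P ≠ 0 ∧ v (aeval a P) < 1 ∧ P.natDegree = n
  · classical
    obtain ⟨P0, hP0, hP0a, hP0n⟩ := Nat.find_spec hP
    have hPmin : ∀ T : k[X], T ≠ 0 → T.natDegree < P0.natDegree → v (aeval a T) = 1 := by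
      intro T hT hd
      by_contra hne
      exact Nat.find_min hP (m := T.natDegree) (by omega)
        ⟨T, hT, lt_of_le_of_ne (hTle T a ha) hne, rfl⟩
    have hlc : (P0.leadingCoeff)⁻¹ ≠ 0 := inv_ne_zero (leadingCoeff_ne_zero.2 hP0)
    set P := P0 * C (P0.leadingCoeff)⁻¹ with hPdef
    have hPm : P.Monic := monic_mul_leadingCoeff_inv hP0
    have hPd : P.natDegree = P0.natDegree := natDegree_mul_C hlc
    have hPa : v (aeval a P) < 1 := by
      rw [hPdef, map_mul, map_mul]
      refine mul_lt_one_of_lt_of_le hP0a (hTle _ _ ha)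
    have hPpos : 0 < P.natDegree := by
      by_contra h
      have : P = 1 := hPm.natDegree_eq_zero.1 (by omega)
      rw [this] at hPa
      simp at hPa
    have hder : derivative P ≠ 0 := by
      intro h
      have := derivative_eq_zero.1 h
      omega
    have hdera : v (aeval a (derivative P)) = 1 :=
      hPmin _ hder (by rw [← hPd]; exact natDegree_derivative_lt (by omega))
    have hev : ∀ (T : k[X]) x, (T.map (algebraMap k F)).eval x = aeval x T := by
      intro T x
      rw [eval_map, aeval_def]
    obtain ⟨z, hz, hza⟩ := H (P.map (algebraMap k F)) a (hPm.map _)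
      (fun j => by rw [coeff_map]; exact hkle _) ha (by rwa [hev])
      (by rwa [derivative_map, hev])
    rw [hev] at hz
    have hvz : v z ≤ 1 := by
      have := v.map_add (z - a) a
      rw [sub_add_cancel] at this
      exact this.trans (max_le hza.le ha)
    refine ⟨z, adj z fun T => ?_, by rwa [Valuation.map_sub_swap]⟩
    have hmod : aeval z T = aeval z (T %ₘ P) := by
      conv_lhs => rw [← modByMonic_add_div T P]
      simp [hz]
    rw [hmod]
    by_cases hr : T %ₘ P = 0
    · left; simp [hr]
    · right
      have h1 : v (aeval a (T %ₘ P)) = 1 := hPmin _ hr (by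
        rw [← hPd]
        exact natDegree_modByMonic_lt _ hPm (by intro h; rw [h] at hPpos; simp at hPpos))
      have h2 : v (aeval z (T %ₘ P) - aeval a (T %ₘ P)) < 1 := by
        rw [aeval_eq_sum_range, aeval_eq_sum_range, ← Finset.sum_sub_distrib]
        refine v.map_sum_lt one_ne_zero fun i _ => ?_
        rw [← smul_sub, Algebra.smul_def, map_mul]
        exact gv_mul_lt_one (hkle _) (v_pow_sub hvz ha hza i)
      rw [← h1] at h2
      have := v.map_add_eq_of_lt_right h2
      rw [sub_add_cancel] at this
      rw [this, h1]
  · push Not at hP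
    refine ⟨a, adj a fun T => ?_, by simp⟩
    by_cases hT : T = 0
    · left; simp [hT]
    · right
      by_contra hne
      exact hP _ T hT (lt_of_le_of_ne (hTle T a ha) hne) rfl
end coeff
end AK
namespace AK
open WithZero Filter
section fibers

open Polynomial in
theorem hensP_of {F Γ O : Type*} [Field F] [LinearOrderedCommGroupWithZero Γ] (v : Valuation F Γ)
    [CommRing O] [IsLocalRing O] [IsAdicComplete (IsLocalRing.maximalIdeal O) O]
    (φ : O →+* F) (hinj : Function.Injective φ) (hr : ∀ x, v x ≤ 1 ↔ ∃ y, φ y = x) : HensP v := by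
  have hle : ∀ y, v (φ y) ≤ 1 := fun y => (hr _).2 ⟨y, rfl⟩
  have hunit : ∀ y, IsUnit y ↔ v (φ y) = 1 := by
    intro y
    constructor
    · rintro h
      obtain ⟨z, hz⟩ := h.exists_right_inv
      have h1 : v (φ y) * v (φ z) = 1 := by rw [← map_mul, ← map_mul, hz, map_one, map_one]
      refine le_antisymm (hle y) ?_
      rw [← h1]
      exact mul_le_of_le_one_right' (hle z)
    · intro h
      have h1 : v (φ y)⁻¹ ≤ 1 := by rw [map_inv₀, h, inv_one]
      obtain ⟨z, hz⟩ := (hr _).1 h1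
      have h0 : φ y ≠ 0 := by intro h0; rw [h0] at h; simp at h
      refine IsUnit.of_mul_eq_one z (hinj ?_)
      rw [map_mul, hz, mul_inv_cancel₀ h0, map_one]
  have hmax : ∀ y, y ∈ IsLocalRing.maximalIdeal O ↔ v (φ y) < 1 := by
    intro y
    rw [IsLocalRing.mem_maximalIdeal, mem_nonunits_iff, hunit]
    exact ⟨fun h => lt_of_le_of_ne (hle y) h, fun h => h.ne⟩
  intro P a hP hc ha h1 h2
  obtain ⟨Q, hQ, -, hQm⟩ := lifts_and_natDegree_eq_and_monic (f := φ)
    ((lifts_iff_coeff_lifts P).2 fun n => (hr _).1 (hc n)) hP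
  obtain ⟨b, rfl⟩ := (hr _).1 ha
  subst hQ
  rw [eval_map, eval₂_at_apply] at h1
  rw [derivative_map, eval_map, eval₂_at_apply] at h2
  obtain ⟨z, hz, hz1⟩ := HenselianRing.is_henselian (I := IsLocalRing.maximalIdeal O) Q hQm b
    ((hmax _).2 h1) (((hunit _).2 h2).map _)
  refine ⟨φ z, ?_, ?_⟩
  · rw [eval_map, eval₂_at_apply, hz, map_zero]
  · rw [← map_sub]
    exact (hmax _).1 hz1

variable (p : ℕ) [hp : Fact p.Prime]

/-- p-adic valuation -/
noncomputable abbrev vQ : Valuation ℚ_[p] ℤᵐ⁰ := Padic.mulValuation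

lemma vQ_ap {x : ℚ_[p]} (hx : x ≠ 0) : vQ p x = exp (-x.valuation) := if_neg hx

lemma vQ_le_one (x : ℚ_[p]) : vQ p x ≤ 1 ↔ ‖x‖ ≤ 1 := by
  by_cases hx : x = 0
  · simp [hx]
  · rw [Padic.norm_le_one_iff_val_nonneg, vQ_ap p hx, ← exp_zero,
      exp_le_exp]
    omega

lemma vQ_p : vQ p (p : ℚ_[p]) = exp (-1) := by
  have : (p : ℚ_[p]) ≠ 0 := by exact_mod_cast hp.1.ne_zero
  rw [vQ_ap p this, Padic.valuation_p]

lemma p_ne : (p : ℚ_[p]) ≠ 0 := by exact_mod_cast hp.1.ne_zero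

lemma vQ_lt_one (x : ℚ_[p]) : vQ p x < 1 ↔ ‖x‖ < 1 := by
  by_cases hx : x = 0
  · simp [hx]
  · have h1 : (1 : ℝ) = (p : ℝ) ^ (0 : ℤ) := by simp
    rw [Padic.norm_eq_zpow_neg_valuation hx, vQ_ap p hx, ← exp_zero,
      exp_lt_exp, h1, zpow_lt_zpow_iff_right₀ (by exact_mod_cast hp.1.one_lt)]

lemma vQ_hens : Hens (vQ p) := by
  refine HensP.hens (hensP_of (O := ℤ_[p]) _ PadicInt.Coe.ringHom ?_ ?_)
  · exact Subtype.coe_injective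
  · intro x
    rw [vQ_le_one]
    exact ⟨fun h => ⟨⟨x, h⟩, rfl⟩, fun ⟨y, hy⟩ => by rw [← hy]; exact y.2⟩

lemma vQ_nat {n : ℕ} (hn : n ≠ 0) (h : n < p) : vQ p n = 1 := by
  refine le_antisymm (v_nat_le _ _) ?_
  by_contra hlt
  rw [not_le, vQ_lt_one] at hlt
  have := (Padic.norm_natCast_lt_one_iff (p := p) (n := n)).1 hlt
  exact absurd (Nat.le_of_dvd (by omega) this) (by omega)

instance ps_complete : IsAdicComplete (IsLocalRing.maximalIdeal (PowerSeries (ZMod p)))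
    (PowerSeries (ZMod p)) where
  haus' := by
    intro x hx
    simp only [← Ideal.one_eq_top, smul_eq_mul, mul_one, SModEq.sub_mem,
      PowerSeries.maximalIdeal_eq_span_X, Ideal.span_singleton_pow, Ideal.mem_span_singleton,
      PowerSeries.X_pow_dvd_iff, sub_zero] at hx
    ext n
    exact hx (n + 1) n (by omega)
  prec' := by
    intro f hf
    simp only [← Ideal.one_eq_top, smul_eq_mul, mul_one, SModEq.sub_mem,
      PowerSeries.maximalIdeal_eq_span_X, Ideal.span_singleton_pow, Ideal.mem_span_singleton,
      PowerSeries.X_pow_dvd_iff] at hf ⊢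
    refine ⟨PowerSeries.mk fun n => PowerSeries.coeff n (f (n + 1)), fun n m hm => ?_⟩
    have := hf (m := m + 1) (n := n) (by omega) m (by omega)
    rw [map_sub, PowerSeries.coeff_mk, sub_eq_zero]
    rw [map_sub, sub_eq_zero] at this
    exact this.symm

/-- t-adic valuation -/
noncomputable abbrev vL : Valuation (LaurentSeries (ZMod p)) ℤᵐ⁰ := Valued.v

lemma vL_hens : Hens (vL p) := by
  refine HensP.hens (hensP_of (O := PowerSeries (ZMod p)) _ (HahnSeries.ofPowerSeries ℤ (ZMod p))
    HahnSeries.ofPowerSeries_injective ?_)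
  intro x
  exact LaurentSeries.val_le_one_iff_eq_coe _ x

/-- uniformizer -/
noncomputable def tL : LaurentSeries (ZMod p) := HahnSeries.single 1 1

lemma vL_t : vL p (tL p) = exp (-1) := LaurentSeries.valuation_single_zpow _ 1

lemma tL_ne : tL p ≠ 0 := by
  intro h
  have := vL_t p
  rw [h, map_zero] at this
  exact exp_ne_zero this.symm

/-- the residue map followed by the inclusion of constants -/
noncomputable def rho (x : ℚ_[p]) : LaurentSeries (ZMod p) :=
  open Classical in if h : ‖x‖ ≤ 1 then HahnSeries.C (PadicInt.toZMod ⟨x, h⟩) else 0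

lemma rho_coe (x : ℤ_[p]) : rho p x = HahnSeries.C (PadicInt.toZMod x) := by
  unfold rho
  rw [dif_pos x.2]
  rfl

lemma exists_coe {x : ℚ_[p]} (h : vQ p x ≤ 1) : ∃ y : ℤ_[p], (y : ℚ_[p]) = x :=
  ⟨⟨x, (vQ_le_one p x).1 h⟩, rfl⟩

lemma rho_add {x y : ℚ_[p]} (hx : vQ p x ≤ 1) (hy : vQ p y ≤ 1) :
    rho p (x + y) = rho p x + rho p y := by
  obtain ⟨x, rfl⟩ := exists_coe p hx
  obtain ⟨y, rfl⟩ := exists_coe p hy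
  rw [← PadicInt.coe_add, rho_coe, rho_coe, rho_coe, map_add, map_add]

lemma rho_mul {x y : ℚ_[p]} (hx : vQ p x ≤ 1) (hy : vQ p y ≤ 1) :
    rho p (x * y) = rho p x * rho p y := by
  obtain ⟨x, rfl⟩ := exists_coe p hx
  obtain ⟨y, rfl⟩ := exists_coe p hy
  rw [← PadicInt.coe_mul, rho_coe, rho_coe, rho_coe, map_mul, map_mul]

lemma rho_one : rho p 1 = 1 := by
  rw [← PadicInt.coe_one, rho_coe, map_one, map_one]

lemma rho_zero : rho p 0 = 0 := by
  rw [← PadicInt.coe_zero, rho_coe, map_zero, map_zero]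

lemma rho_small {x : ℚ_[p]} (hx : vQ p x < 1) : rho p x = 0 := by
  obtain ⟨x, rfl⟩ := exists_coe p hx.le
  rw [rho_coe]
  rw [vQ_lt_one] at hx
  have : x ∈ IsLocalRing.maximalIdeal ℤ_[p] := by
    rw [IsLocalRing.mem_maximalIdeal, PadicInt.mem_nonunits]
    exact hx
  rw [← PadicInt.ker_toZMod, RingHom.mem_ker] at this
  rw [this, map_zero]

lemma rho_surj {b : LaurentSeries (ZMod p)} (hb : vL p b ≤ 1) :
    ∃ x, vQ p x ≤ 1 ∧ vL p (b - rho p x) < 1 := by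
  obtain ⟨F, rfl⟩ := (LaurentSeries.val_le_one_iff_eq_coe _ b).1 hb
  obtain ⟨x, hx⟩ := ZMod.ringHom_surjective PadicInt.toZMod (PowerSeries.constantCoeff F)
  refine ⟨x, (vQ_le_one p _).2 x.2, ?_⟩
  rw [rho_coe, hx]
  have h1 : vL p ((F : LaurentSeries (ZMod p)) - HahnSeries.C (PowerSeries.constantCoeff F)) ≤
      exp (-1) := by
    rw [LaurentSeries.valuation_le_iff_coeff_lt_eq_zero]
    intro n hn
    rw [← PowerSeries.coe_C, ← PowerSeries.coe_sub, PowerSeries.coeff_coe]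
    split_ifs with h
    · rfl
    · obtain rfl : n = 0 := by omega
      simp
  refine h1.trans_lt ?_
  rw [← exp_zero, exp_lt_exp]
  omega
end fibers
end AK
namespace AK
open Filter
section lang
variable (p : ℕ) [hp : Fact p.Prime]

lemma form_smul {R : Type*} [CommRing R] {n d : ℕ} {I : Finset (Fin n → ℕ)}
    (hI : ∀ m ∈ I, ∑ i, m i = d) (c : (Fin n → ℕ) → R) (t : R) (x : Fin n → R) :
    form I c (fun i => t * x i) = t ^ d * form I c x := by
  unfold form
  rw [Finset.mul_sum]
  refine Finset.sum_congr rfl fun m hm => ?_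
  simp_rw [mul_pow]
  rw [Finset.prod_mul_distrib, Finset.prod_pow_eq_pow_sum, hI m hm]
  ring

lemma form_zero {R : Type*} [CommRing R] {n d : ℕ} (hd : 0 < d) {I : Finset (Fin n → ℕ)}
    (hI : ∀ m ∈ I, ∑ i, m i = d) (c : (Fin n → ℕ) → R) : form I c (fun _ => 0) = 0 := by
  have := form_smul hI c 0 (fun _ => 0)
  simpa [hd.ne'] using this

/-- coefficientwise degree bound -/
def DB {σ : Type*} (k : ℕ) (g : PowerSeries (MvPolynomial σ (ZMod p))) : Prop :=
  ∀ r, (PowerSeries.coeff r g).totalDegree ≤ k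

variable {p}
lemma DB.mul {σ : Type*} {a b : ℕ} {g h : PowerSeries (MvPolynomial σ (ZMod p))} (hg : DB p a g)
    (hh : DB p b h) : DB p (a + b) (g * h) := by
  intro r
  rw [PowerSeries.coeff_mul]
  refine (MvPolynomial.totalDegree_finsetSum_le fun x _ => ?_)
  exact (MvPolynomial.totalDegree_mul _ _).trans (add_le_add (hg _) (hh _))

lemma DB.one {σ : Type*} : DB p 0 (1 : PowerSeries (MvPolynomial σ (ZMod p))) := by
  intro r
  rw [PowerSeries.coeff_one]
  split_ifs <;> simp

lemma DB.pow {σ : Type*} {g : PowerSeries (MvPolynomial σ (ZMod p))} (hg : DB p 1 g) (k : ℕ) :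
    DB p k (g ^ k) := by
  induction k with
  | zero => rw [pow_zero]; exact DB.one
  | succ k ih => rw [pow_succ]; exact ih.mul hg

lemma DB.prod {σ J : Type*} (s : Finset J) (g : J → PowerSeries (MvPolynomial σ (ZMod p)))
    (m : J → ℕ) (h : ∀ i ∈ s, DB p (m i) (g i)) : DB p (∑ i ∈ s, m i) (∏ i ∈ s, g i) := by
  classical
  induction s using Finset.induction_on with
  | empty => simpa using DB.one
  | insert a s ha ih =>
    rw [Finset.sum_insert ha, Finset.prod_insert ha]
    exact (h a (by simp)).mul (ih fun i hi => h i (by simp [hi]))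

lemma DB.sum {σ J : Type*} {k : ℕ} (s : Finset J) (g : J → PowerSeries (MvPolynomial σ (ZMod p)))
    (h : ∀ i ∈ s, DB p k (g i)) : DB p k (∑ i ∈ s, g i) := by
  intro r
  rw [map_sum]
  exact MvPolynomial.totalDegree_finsetSum_le fun x hx => h x hx r

open PowerSeries in
theorem approx {n d : ℕ} (hd : 0 < d) (hn : d ^ 2 < n) {I : Finset (Fin n → ℕ)}
    (hI : ∀ m ∈ I, ∑ i, m i = d) (b : (Fin n → ℕ) → PowerSeries (ZMod p)) (N : ℕ) :
    ∃ y : Fin n → PowerSeries (ZMod p), (∃ i, coeff 0 (y i) ≠ 0) ∧ X ^ N ∣ form I b y := by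
  classical
  set s := d * N + 1 with hs
  set L := d * (s - 1) + N with hL
  let σ := Fin n × Fin s
  let Y : Fin n → PowerSeries (MvPolynomial σ (ZMod p)) := fun i =>
    ∑ j : Fin s, C (MvPolynomial.X (i, j)) * X ^ (j : ℕ)
  let G := form I (fun m => PowerSeries.map MvPolynomial.C (b m)) Y
  let yy : (σ → ZMod p) → Fin n → PowerSeries (ZMod p) := fun x i =>
    ∑ j : Fin s, C (x (i, j)) * X ^ (j : ℕ)
  have hev : ∀ x r, MvPolynomial.eval x (coeff r G) = coeff r (form I b (yy x)) := by
    intro x r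
    rw [← PowerSeries.coeff_map, map_form]
    congr 2
    · funext m
      rw [← RingHom.comp_apply, ← PowerSeries.map_comp]
      have : (MvPolynomial.eval x).comp (MvPolynomial.C : ZMod p →+* _) = RingHom.id _ := by
        ext z
        simp
      rw [this]
      simp
    · funext i
      simp [Y, yy]
  have hDY : ∀ i, DB p 1 (Y i) := by
    intro i
    refine DB.sum _ _ fun j _ r => ?_
    rw [coeff_C_mul, coeff_X_pow]
    split_ifs
    · rw [mul_one]; exact (MvPolynomial.totalDegree_X _).le
    · simp
  have hDG : DB p d G := by
    refine DB.sum _ _ fun m hm => ?_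
    rw [← hI m hm, ← zero_add (∑ i, m i)]
    refine DB.mul ?_ (DB.prod _ _ _ fun i _ => (hDY i).pow _)
    intro r
    simp
  have hcard : p ∣ Fintype.card { x : σ → ZMod p //
      ∀ r ∈ Finset.range L, MvPolynomial.eval x (coeff r G) = 0 } := by
    refine char_dvd_card_solutions_of_sum_lt p ?_
    calc ∑ r ∈ Finset.range L, (coeff r G).totalDegree ≤ ∑ r ∈ Finset.range L, d :=
          Finset.sum_le_sum fun r _ => hDG r
      _ = L * d := by simp
      _ < (d ^ 2 + 1) * s := by
          simp only [hL, hs, Nat.add_sub_cancel]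
          nlinarith
      _ ≤ n * s := Nat.mul_le_mul_right _ hn
      _ = _ := by simp [σ]
  have hyy0 : yy 0 = fun _ => 0 := by
    funext i
    simp [yy]
  have h1 : 1 < Fintype.card { x : σ → ZMod p //
      ∀ r ∈ Finset.range L, MvPolynomial.eval x (coeff r G) = 0 } := by
    refine lt_of_lt_of_le hp.1.one_lt (Nat.le_of_dvd (Fintype.card_pos_iff.2 ⟨0, ?_⟩) hcard)
    intro r _
    rw [hev, hyy0, form_zero hd hI, map_zero]
  obtain ⟨⟨x, hx⟩, hx0⟩ := Fintype.exists_ne_of_one_lt_card h1 ⟨0, by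
    intro r _
    rw [hev, hyy0, form_zero hd hI, map_zero]⟩
  have hx0 : x ≠ 0 := fun h => hx0 (by simp [h])
  have hco : ∀ i (j : ℕ), coeff j (yy x i) = if h : j < s then x (i, ⟨j, h⟩) else 0 := by
    intro i j
    simp only [yy, map_sum, coeff_C_mul, coeff_X_pow]
    split_ifs with h
    · rw [Finset.sum_eq_single ⟨j, h⟩]
      · simp
      · intro k _ hk
        rw [if_neg, mul_zero]
        intro h2
        exact hk (Fin.ext h2.symm)
      · simp
    · refine Finset.sum_eq_zero fun k _ => ?_
      rw [if_neg, mul_zero]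
      have := k.2
      omega
  have hex : ∃ j, ∃ i, coeff j (yy x i) ≠ 0 := by
    obtain ⟨⟨i, j⟩, hij⟩ := Function.ne_iff.1 hx0
    refine ⟨j, i, ?_⟩
    rw [hco, dif_pos j.2]
    exact hij
  obtain ⟨i0, hi0⟩ := Nat.find_spec hex
  set e := Nat.find hex with he
  have hes : e ≤ s - 1 := by
    by_contra h
    rw [hco, dif_neg (by omega)] at hi0
    exact hi0 rfl
  have hdvd : ∀ i, (X : PowerSeries (ZMod p)) ^ e ∣ yy x i := by
    intro i
    rw [X_pow_dvd_iff]
    intro j hj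
    by_contra h
    exact Nat.find_min hex hj ⟨i, h⟩
  choose y hy using hdvd
  refine ⟨y, ⟨i0, ?_⟩, ?_⟩
  · have := coeff_X_pow_mul (y i0) e 0
    rw [zero_add] at this
    rw [← this, ← hy]
    exact hi0
  · have h2 : form I b (yy x) = (X ^ e) ^ d * form I b y := by
      rw [← form_smul hI]
      congr 1
      funext i
      exact hy i
    have h3 : (X : PowerSeries (ZMod p)) ^ L ∣ form I b (yy x) := by
      rw [X_pow_dvd_iff]
      intro r hr
      rw [← hev]
      exact hx r (by simpa using hr)
    rw [h2, ← pow_mul] at h3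
    have h4 : (X : PowerSeries (ZMod p)) ^ (e * d) * X ^ N ∣ X ^ (e * d) * form I b y := by
      refine dvd_trans ?_ h3
      rw [← pow_add]
      refine pow_dvd_pow _ ?_
      rw [hL, mul_comm e d]
      exact Nat.add_le_add_right (Nat.mul_le_mul_left d hes) N
    exact (mul_dvd_mul_iff_left (pow_ne_zero _ X_ne_zero)).1 h4

open PowerSeries in
theorem lang_ps {n d : ℕ} (hd : 0 < d) (hn : d ^ 2 < n) {I : Finset (Fin n → ℕ)}
    (hI : ∀ m ∈ I, ∑ i, m i = d) (b : (Fin n → ℕ) → PowerSeries (ZMod p)) :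
    ∃ y : Fin n → PowerSeries (ZMod p), y ≠ 0 ∧ form I b y = 0 := by
  choose Y hY0 hY using approx (p := p) hd hn hI b
  let U : Ultrafilter ℕ := hyperfilter ℕ
  have hU : ∀ n, ∀ᶠ i in (U : Filter ℕ), n ≤ i := by
    intro n
    have : ∀ᶠ i in atTop, n ≤ i := eventually_ge_atTop n
    rw [← Nat.cofinite_eq_atTop] at this
    exact this.filter_mono hyperfilter_le_cofinite
  have hlim : ∀ i j, ∃ a, ∀ᶠ N in (U : Filter ℕ), coeff j (Y N i) = a := by
    intro i j
    by_contra h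
    push Not at h
    have h' : ∀ a, ∀ᶠ N in (U : Filter ℕ), coeff j (Y N i) ≠ a := h
    obtain ⟨N, hN⟩ := (eventually_all.2 h').exists
    exact hN _ rfl
  choose a ha using hlim
  refine ⟨fun i => PowerSeries.mk (a i), ?_, ?_⟩
  · have h1 : ∀ᶠ N in (U : Filter ℕ), ∀ i, coeff 0 (Y N i) = a i 0 :=
      eventually_all.2 fun i => ha i 0
    obtain ⟨N, hN⟩ := h1.exists
    obtain ⟨i, hi⟩ := hY0 N
    intro h
    have h2 := congrArg (coeff 0) (congrFun h i)
    rw [coeff_mk, ← hN] at h2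
    exact hi (by simpa using h2)
  · ext L
    have h1 : ∀ᶠ N in (U : Filter ℕ), ∀ i, ∀ j ∈ Finset.range (L + 1), coeff j (Y N i) = a i j :=
      eventually_all.2 fun i => (Finset.eventually_all _).2 fun j _ => ha i j
    obtain ⟨N, hN, hLN⟩ := (h1.and (hU (L + 1))).exists
    have h2 : (X : PowerSeries (ZMod p)) ^ (L + 1) ∣
        form I b (fun i => PowerSeries.mk (a i)) - form I b (Y N) := by
      rw [← Ideal.mem_span_singleton, ← Ideal.Quotient.eq, map_form, map_form]
      congr 1
      funext i
      rw [Ideal.Quotient.eq, Ideal.mem_span_singleton, X_pow_dvd_iff]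
      intro j hj
      rw [map_sub, coeff_mk, hN i j (by simpa using hj), sub_self]
    have h3 := dvd_add h2 ((pow_dvd_pow X hLN).trans (hY N))
    rw [sub_add_cancel, X_pow_dvd_iff] at h3
    rw [h3 L (by omega), map_zero]

theorem lang {n d : ℕ} (hd : 0 < d) (hn : d ^ 2 < n) {I : Finset (Fin n → ℕ)}
    (hI : ∀ m ∈ I, ∑ i, m i = d) (c : (Fin n → ℕ) → LaurentSeries (ZMod p)) :
    ∃ y : Fin n → LaurentSeries (ZMod p), y ≠ 0 ∧ form I c y = 0 := by
  classical
  obtain ⟨t, ht⟩ := IsLocalization.exist_integer_multiples_of_finset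
    (nonZeroDivisors (PowerSeries (ZMod p))) (I.image c)
  have : ∀ m, ∃ b : PowerSeries (ZMod p), m ∈ I →
      algebraMap _ (LaurentSeries (ZMod p)) b = (t : PowerSeries (ZMod p)) • c m := by
    intro m
    by_cases hm : m ∈ I
    · obtain ⟨b, hb⟩ := ht (c m) (Finset.mem_image_of_mem _ hm)
      exact ⟨b, fun _ => hb⟩
    · exact ⟨0, fun h => absurd h hm⟩
  choose b hb using this
  obtain ⟨y, hy0, hy⟩ := lang_ps hd hn hI b
  have hinj : Function.Injective (algebraMap (PowerSeries (ZMod p)) (LaurentSeries (ZMod p))) :=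
    IsFractionRing.injective _ _
  refine ⟨fun i => algebraMap _ _ (y i), ?_, ?_⟩
  · intro h
    apply hy0
    funext i
    apply hinj
    rw [Pi.zero_apply, map_zero]
    exact congrFun h i
  · have h1 := congrArg (algebraMap (PowerSeries (ZMod p)) (LaurentSeries (ZMod p))) hy
    rw [map_form, map_zero] at h1
    have h2 : form I (fun m => algebraMap (PowerSeries (ZMod p)) (LaurentSeries (ZMod p)) (b m))
        (fun i => algebraMap _ _ (y i)) =
        algebraMap (PowerSeries (ZMod p)) (LaurentSeries (ZMod p)) t *
          form I c (fun i => algebraMap _ _ (y i)) := by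
      unfold form
      rw [Finset.mul_sum]
      refine Finset.sum_congr rfl fun m hm => ?_
      beta_reduce
      rw [hb m hm, Algebra.smul_def, mul_assoc]
    rw [h2] at h1
    refine (mul_eq_zero.1 h1).resolve_left ?_
    exact fun h => nonZeroDivisors.ne_zero t.2 ((map_eq_zero_iff _ hinj).1 h)
end lang
end AK
namespace AK
open WithZero Filter
section final

lemma um_form {U : Ultrafilter ℕ} {K : ℕ → Type} [∀ i, Field (K i)] {n : ℕ}
    (I : Finset (Fin n → ℕ)) (c : (Fin n → ℕ) → ∀ i, K i) (x : Fin n → ∀ i, K i) :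
    form I (fun m => um U K (c m)) (fun j => um U K (x j)) =
      um U K (fun i => form I (fun m => c m i) (fun j => x j i)) := by
  rw [← map_form]
  congr 1
  funext i
  exact map_form (Pi.evalRingHom K i) I c x

lemma ult_zero {U : Ultrafilter ℕ} {K : ℕ → Type} [∀ i, Field (K i)] {n : ℕ}
    (I : Finset (Fin n → ℕ))
    (h : ∀ i, ∀ c : (Fin n → ℕ) → K i, ∃ y : Fin n → K i, y ≠ 0 ∧ form I c y = 0)
    (c : (Fin n → ℕ) → Ult U K) : ∃ y : Fin n → Ult U K, y ≠ 0 ∧ form I c y = 0 := by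
  choose y hy0 hy using fun i => h i (fun m => ur (c m) i)
  refine ⟨fun j => um U K (fun i => y i j), ?_, ?_⟩
  · intro h0
    have h1 : ∀ j, ∀ᶠ i in (U : Filter ℕ), y i j = 0 := fun j => um_eq_zero.1 (congrFun h0 j)
    obtain ⟨i, hi⟩ := (eventually_all.2 h1).exists
    exact hy0 i (funext hi)
  · have h1 : c = fun m => um U K (ur (c m)) := by
      funext m
      simp
    rw [h1, um_form, um_eq_zero]
    exact Eventually.of_forall hy

lemma ult_zero' {U : Ultrafilter ℕ} {K : ℕ → Type} [∀ i, Field (K i)] {n : ℕ}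
    (I : Finset (Fin n → ℕ)) (c : ∀ i, (Fin n → ℕ) → K i)
    (h : ∃ x : Fin n → Ult U K, x ≠ 0 ∧ form I (fun m => um U K (fun i => c i m)) x = 0) :
    ∃ i, ∃ x : Fin n → K i, x ≠ 0 ∧ form I (c i) x = 0 := by
  obtain ⟨x, hx0, hx⟩ := h
  have h1 : x = fun j => um U K (ur (x j)) := by
    funext j
    simp
  obtain ⟨j, hj⟩ := Function.ne_iff.1 hx0
  rw [h1, um_form, um_eq_zero] at hx
  have h2 : ∀ᶠ i in (U : Filter ℕ), ¬ ur (x j) i = 0 := by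
    rw [Ultrafilter.eventually_not, ← um_eq_zero, um_ur]
    exact hj
  obtain ⟨i, hi, hi2⟩ := (hx.and h2).exists
  exact ⟨i, fun j => ur (x j) i, fun h0 => hi2 (congrFun h0 j), hi⟩

lemma rho_le (p : ℕ) [Fact p.Prime] {x : ℚ_[p]} (hx : vQ p x ≤ 1) : vL p (rho p x) ≤ 1 := by
  obtain ⟨x, rfl⟩ := exists_coe p hx
  rw [rho_coe]
  refine (LaurentSeries.val_le_one_iff_eq_coe _ _).2 ⟨PowerSeries.C (PadicInt.toZMod x), ?_⟩
  rw [PowerSeries.coe_C]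

theorem ultra_main (P : ℕ → ℕ) [hP : ∀ i, Fact (P i).Prime] (hinj : Function.Injective P)
    {d n : ℕ} (hd : 0 < d) (hn : d ^ 2 < n) {I : Finset (Fin n → ℕ)}
    (hI : ∀ m ∈ I, ∑ i, m i = d) (c : ∀ i, (Fin n → ℕ) → ℚ_[P i]) :
    ∃ i, ∃ x : Fin n → ℚ_[P i], x ≠ 0 ∧ form I (c i) x = 0 := by
  let U : Ultrafilter ℕ := hyperfilter ℕ
  have hU : ∀ n, ∀ᶠ i in (U : Filter ℕ), n ≤ i := by
    intro n
    have : ∀ᶠ i in atTop, n ≤ i := eventually_ge_atTop n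
    rw [← Nat.cofinite_eq_atTop] at this
    exact this.filter_mono hyperfilter_le_cofinite
  have hPU : ∀ n, ∀ᶠ i in (U : Filter ℕ), n < P i := by
    intro n
    have : ∀ᶠ i in cofinite, n < P i := by
      have h1 := hinj.tendsto_cofinite
      rw [Nat.cofinite_eq_atTop] at h1 ⊢
      exact h1.eventually (eventually_gt_atTop n)
    exact this.filter_mono hyperfilter_le_cofinite
  let K : ℕ → Type := fun i => ℚ_[P i]
  let L : ℕ → Type := fun i => LaurentSeries (ZMod (P i))
  let _ : ∀ i, Field (K i) := fun i => inferInstanceAs (Field ℚ_[P i])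
  let _ : ∀ i, Field (L i) := fun i => inferInstanceAs (Field (LaurentSeries (ZMod (P i))))
  let w : ∀ i, Valuation (K i) ℤᵐ⁰ := fun i => vQ (P i)
  let w' : ∀ i, Valuation (L i) ℤᵐ⁰ := fun i => vL (P i)
  have hw0 : ∀ n : ℕ, n ≠ 0 → uv U w (n : Ult U K) = 1 := by
    intro n hn
    rw [← map_natCast (um U K), uv_eq_one]
    filter_upwards [hPU n] with i hi
    exact vQ_nat (P i) hn hi
  obtain ⟨k, hk1, hk⟩ := coeff_field (u_hens (U := U) w fun i => vQ_hens (P i)).poly hw0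
  have hkle : ∀ x : k, ∀ᶠ i in (U : Filter ℕ), w i (ur (x : Ult U K) i) ≤ 1 := by
    intro x
    rw [← uv_le_one, um_ur]
    by_cases hx : (x : Ult U K) = 0
    · rw [hx, map_zero]; exact zero_le
    · exact (hk1 x x.2 hx).le
  have : CharZero k := charZero_of_inj_zero fun n hn => by
    by_contra h
    have h1 := hw0 n h
    have h2 := congrArg (Subtype.val) hn
    rw [show ((n : k) : Ult U K) = n from rfl] at h2
    rw [h2] at h1
    simp at h1
  let r : Ult U K → Ult U L := fun x => um U L (fun i => rho (P i) (ur x i))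
  have r_um : ∀ x, r (um U K x) = um U L (fun i => rho (P i) (x i)) := by
    intro x
    refine um_eq.2 ?_
    filter_upwards [ur_um (U := U) x] with i hi
    rw [hi]
  have r_add : ∀ x y : Ult U K, uv U w x ≤ 1 → uv U w y ≤ 1 → r (x + y) = r x + r y := by
    intro x y hx hy
    obtain ⟨x, rfl⟩ := um_surj U K x
    obtain ⟨y, rfl⟩ := um_surj U K y
    rw [← map_add, r_um, r_um, r_um, ← map_add]
    refine um_eq.2 ?_
    filter_upwards [uv_le_one.1 hx, uv_le_one.1 hy] with i h1 h2
    exact rho_add (P i) h1 h2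
  have r_mul : ∀ x y : Ult U K, uv U w x ≤ 1 → uv U w y ≤ 1 → r (x * y) = r x * r y := by
    intro x y hx hy
    obtain ⟨x, rfl⟩ := um_surj U K x
    obtain ⟨y, rfl⟩ := um_surj U K y
    rw [← map_mul, r_um, r_um, r_um, ← map_mul]
    refine um_eq.2 ?_
    filter_upwards [uv_le_one.1 hx, uv_le_one.1 hy] with i h1 h2
    exact rho_mul (P i) h1 h2
  have r_one : r 1 = 1 := by
    rw [← map_one (um U K), r_um, ← map_one (um U L)]
    exact um_eq.2 (Eventually.of_forall fun i => rho_one (P i))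
  have r_small : ∀ x : Ult U K, uv U w x < 1 → r x = 0 := by
    intro x hx
    obtain ⟨x, rfl⟩ := um_surj U K x
    rw [r_um, um_eq_zero]
    filter_upwards [uv_lt_one.1 hx] with i h1
    exact rho_small (P i) h1
  have r_le : ∀ x : Ult U K, uv U w x ≤ 1 → uv U w' (r x) ≤ 1 := by
    intro x hx
    obtain ⟨x, rfl⟩ := um_surj U K x
    rw [r_um, uv_le_one]
    filter_upwards [uv_le_one.1 hx] with i h1
    exact rho_le (P i) h1
  have hkle' : ∀ x : k, uv U w (x : Ult U K) ≤ 1 := by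
    intro x
    by_cases hx : (x : Ult U K) = 0
    · rw [hx, map_zero]; exact zero_le
    · exact (hk1 x x.2 hx).le
  let ι : k →+* Ult U L :=
    { toFun := fun x => r x
      map_one' := r_one
      map_zero' := r_small 0 (by simp)
      map_add' := fun x y => r_add x y (hkle' x) (hkle' y)
      map_mul' := fun x y => r_mul x y (hkle' x) (hkle' y) }
  let A : CF k (VG U) (Ult U K) := mkCF hU w (fun i => cs (F := ℚ_[P i]) (P i) (p_ne (P i)))
    (fun i => cs_v (vQ (P i)) _ _ (vQ_p (P i))) (fun i => vQ_hens (P i)) k.subtype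
    (fun α hα => hk1 α α.2 (by simpa using hα))
    (fun a ha => by
      obtain ⟨b, hb, hab⟩ := hk a ha.le
      exact ⟨⟨b, hb⟩, hab⟩)
  let C : CF k (VG U) (Ult U L) := mkCF hU w'
    (fun i => cs (F := LaurentSeries (ZMod (P i))) (tL (P i)) (tL_ne (P i)))
    (fun i => cs_v (vL (P i)) _ _ (vL_t (P i))) (fun i => vL_hens (P i)) ι
    (fun α hα => by
      have h1 : uv U w' (ι α) * uv U w' (ι α⁻¹) = 1 := by
        rw [← map_mul, ← map_mul, mul_inv_cancel₀ hα, map_one, map_one]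
      refine le_antisymm (r_le α (hkle' α)) ?_
      rw [← h1]
      exact mul_le_of_le_one_right' (r_le _ (hkle' _)))
    (fun a ha => by
      obtain ⟨a, rfl⟩ := um_surj U L a
      have h1 : ∀ i, ∃ x : K i, w' i (a i) = 1 → w i x ≤ 1 ∧ w' i (a i - rho (P i) x) < 1 := by
        intro i
        by_cases h : w' i (a i) = 1
        · obtain ⟨x, hx⟩ := rho_surj (P i) h.le
          exact ⟨x, fun _ => hx⟩
        · exact ⟨0, fun h' => absurd h' h⟩
      choose x hx using h1
      have ha' := uv_eq_one.1 ha
      have hx1 : uv U w (um U K x) ≤ 1 := by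
        rw [uv_le_one]
        filter_upwards [ha'] with i hi
        exact (hx i hi).1
      obtain ⟨b, hb, hxb⟩ := hk (um U K x) hx1
      refine ⟨⟨b, hb⟩, ?_⟩
      have h2 : ι ⟨b, hb⟩ = um U L (fun i => rho (P i) (x i)) := by
        show r b = _
        have h3 := r_add b (um U K x - b) (hkle' ⟨b, hb⟩) hxb.le
        rw [add_sub_cancel, r_small _ hxb, add_zero, r_um] at h3
        exact h3.symm
      rw [h2, ← map_sub, uv_lt_one]
      filter_upwards [ha'] with i hi
      exact (hx i hi).2)
  have hM := ult_zero (U := U) (K := L) I (fun i c => lang (p := P i) hd hn hI c)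
  exact ult_zero' (U := U) (K := K) I c (transfer A C I hM _)

lemma reduce {F : Type*} [Field F] {d n N : ℕ} (hN : N ≤ n) (f : MvPolynomial (Fin n) F)
    (hf : f.IsHomogeneous d) :
    ∃ c : (Fin N → ℕ) → F, (∃ y : Fin N → F, y ≠ 0 ∧
      form (Finset.piAntidiag Finset.univ d) c y = 0) →
      ∃ x : Fin n → F, x ≠ 0 ∧ MvPolynomial.eval x f = 0 := by
  classical
  let q : Fin n → MvPolynomial (Fin N) F := fun i =>
    if h : (i : ℕ) < N then MvPolynomial.X ⟨i, h⟩ else 0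
  have hq : ∀ i, (q i).IsHomogeneous 1 := by
    intro i
    simp only [q]
    split_ifs
    · exact MvPolynomial.isHomogeneous_X _ _
    · exact MvPolynomial.isHomogeneous_zero _ _ _
  let g := MvPolynomial.bind₁ q f
  have hg : g.IsHomogeneous d := by
    have := hf.aeval q hq
    rwa [one_mul] at this
  refine ⟨fun m => g.coeff (Finsupp.equivFunOnFinite.symm m), ?_⟩
  rintro ⟨y, hy0, hy⟩
  refine ⟨fun i => MvPolynomial.eval y (q i), ?_, ?_⟩
  · intro h
    apply hy0
    funext j
    have := congrFun h ⟨j, j.2.trans_le hN⟩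
    simpa [q] using this
  · have h1 : MvPolynomial.eval (fun i => MvPolynomial.eval y (q i)) f = MvPolynomial.eval y g := by
      simp only [g]
      exact (MvPolynomial.eval₂Hom_bind₁ (RingHom.id F) y q f).symm
    rw [h1, MvPolynomial.eval_eq', ← hy]
    unfold form
    refine Finset.sum_bij_ne_zero (fun m _ _ => (m : Fin N → ℕ)) ?_ ?_ ?_ ?_
    · intro m hm _
      rw [Finset.mem_piAntidiag]
      refine ⟨?_, fun _ _ => Finset.mem_univ _⟩
      have := hg (MvPolynomial.mem_support_iff.1 hm)
      rw [← this, Finsupp.weight_apply, Finsupp.sum_fintype] <;> simp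
    · intro a _ _ b _ _ h
      exact DFunLike.coe_injective h
    · intro m hm h
      refine ⟨Finsupp.equivFunOnFinite.symm m, ?_, ?_, ?_⟩
      · rw [MvPolynomial.mem_support_iff]
        exact left_ne_zero_of_mul h
      · simpa using h
      · simp
    · intro m _ _
      simp
end final
end AK

theorem ax_kochen_almost_C2 (d : ℕ) (hd : 0 < d) :
    ∃ e : Finset ℕ, ∀ (p : ℕ) [Fact p.Prime], p ∉ e →
      ∀ n : ℕ, d ^ 2 < n →
        ∀ f : MvPolynomial (Fin n) ℚ_[p], f.IsHomogeneous d →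
          ∃ x : Fin n → ℚ_[p], x ≠ 0 ∧ MvPolynomial.eval x f = 0 := by
  classical
  let B : Set ℕ := {p | ∃ _ : Fact p.Prime, ∃ c : (Fin (d ^ 2 + 1) → ℕ) → ℚ_[p],
    ¬ ∃ y : Fin (d ^ 2 + 1) → ℚ_[p], y ≠ 0 ∧
      AK.form (Finset.piAntidiag Finset.univ d) c y = 0}
  by_cases hB : B.Finite
  · refine ⟨hB.toFinset, ?_⟩
    intro p hp hpB n hn f hf
    obtain ⟨c, hc⟩ := AK.reduce (N := d ^ 2 + 1) hn f hf
    refine hc ?_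
    by_contra h
    exact hpB (hB.mem_toFinset.2 ⟨hp, c, h⟩)
  · exfalso
    let P := Set.Infinite.natEmbedding B hB
    have hP := fun i => (P i).2
    choose hF c hc using hP
    obtain ⟨i, hi⟩ := AK.ultra_main (fun i => (P i : ℕ))
      (fun i j h => P.injective (Subtype.ext h)) hd (Nat.lt_succ_self _)
      (I := Finset.piAntidiag Finset.univ d)
      (fun m hm => (Finset.mem_piAntidiag.1 hm).1) c
    exact hc i hi
end

section
/- For every prime p, the field F̄_p((t)) of formal Laurent series over an algebraic closure F̄_p of the field with p elements is C₂: every homogeneous polynomial over F̄_p((t)) of degree d in n variables with n > d² has a nontrivial zero over F̄_p((t)). -/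
section
open MvPolynomial

theorem C2_cw (p : ℕ) [Fact p.Prime] {σ ι : Type} [Fintype σ] (s : Finset ι)
    (g : ι → MvPolynomial σ (AlgebraicClosure (ZMod p)))
    (hdeg : ∑ i ∈ s, (g i).totalDegree < Fintype.card σ)
    (h0 : ∀ i ∈ s, eval 0 (g i) = 0) :
    ∃ x : σ → AlgebraicClosure (ZMod p), x ≠ 0 ∧ ∀ i ∈ s, eval x (g i) = 0 := by
  classical
  set k := AlgebraicClosure (ZMod p)
  let S : Finset k := s.biUnion fun i => (g i).support.image fun m => (g i).coeff m
  let F := IntermediateField.adjoin (ZMod p) (S : Set k)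
  have hfd : FiniteDimensional (ZMod p) F :=
    IntermediateField.finiteDimensional_adjoin fun x _ => Algebra.IsIntegral.isIntegral x
  have hfin : Finite F := Module.finite_of_finite (ZMod p)
  have : Fintype F := Fintype.ofFinite F
  have hl : ∀ i ∈ s, ∃ G : MvPolynomial σ F, map (algebraMap F k) G = g i := by
    intro i hi
    have : g i ∈ Set.range (map (σ := σ) (algebraMap F k)) := by
      have := (mem_range_map_iff_coeffs_subset (f := algebraMap F k) (x := g i)).2 (by
        intro c hc
        rw [Finset.mem_coe, mem_coeffs_iff] at hc
        obtain ⟨m, hm, rfl⟩ := hc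
        refine ⟨⟨_, IntermediateField.subset_adjoin _ _ ?_⟩, rfl⟩
        simp only [S, Finset.coe_biUnion, Set.mem_iUnion]
        exact ⟨i, hi, by simpa using ⟨m, by simpa using hm, rfl⟩⟩)
      exact this
    exact this
  choose! G hG using hl
  have hinj : Function.Injective (algebraMap F k) := (algebraMap F k).injective
  have hdeg' : ∑ i ∈ s, (G i).totalDegree < Fintype.card σ := by
    refine lt_of_le_of_lt (le_of_eq (Finset.sum_congr rfl fun i hi => ?_)) hdeg
    rw [← hG i hi, totalDegree, totalDegree, support_map_of_injective _ hinj]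
  have := char_dvd_card_solutions_of_sum_lt p hdeg'
  have hz : ∀ i ∈ s, eval (0 : σ → F) (G i) = 0 := by
    intro i hi
    apply hinj
    have := h0 i hi
    rw [← hG i hi, eval_map] at this
    rw [map_zero, ← this, ← eval₂_id, eval₂_comp_left]
    congr 1
  have hcard : 1 < Fintype.card { x : σ → F // ∀ i ∈ s, eval x (G i) = 0 } := by
    have h1 : 0 < Fintype.card { x : σ → F // ∀ i ∈ s, eval x (G i) = 0 } :=
      Fintype.card_pos_iff.2 ⟨⟨0, hz⟩⟩
    exact lt_of_lt_of_le (Fact.out : p.Prime).one_lt (Nat.le_of_dvd h1 this)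
  obtain ⟨⟨x, hx⟩, hne⟩ := Fintype.exists_ne_of_one_lt_card hcard ⟨0, hz⟩
  refine ⟨fun i => algebraMap F k (x i), ?_, ?_⟩
  · intro h
    apply hne
    ext i : 2
    apply hinj
    simpa using congrFun h i
  · intro i hi
    rw [← hG i hi, eval_map]
    have := congrArg (algebraMap F k) (hx i hi)
    rwa [map_zero, ← eval₂_id, eval₂_comp_left] at this

end

section
open Polynomial

/-- coefficients of bounded total degree -/
def C2Bdd {τ k : Type} [Field k] (a : ℕ) (P : (MvPolynomial τ k)[X]) : Prop :=
  ∀ m, (P.coeff m).totalDegree ≤ a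

theorem C2Bdd.mul {τ k : Type} [Field k] {a b : ℕ} {P Q : (MvPolynomial τ k)[X]}
    (hP : C2Bdd a P) (hQ : C2Bdd b Q) : C2Bdd (a + b) (P * Q) := by
  intro m
  rw [coeff_mul]
  refine MvPolynomial.totalDegree_finsetSum_le fun x _ => ?_
  exact (MvPolynomial.totalDegree_mul _ _).trans (add_le_add (hP _) (hQ _))

theorem C2Bdd.pow {τ k : Type} [Field k] {a : ℕ} {P : (MvPolynomial τ k)[X]}
    (hP : C2Bdd a P) (r : ℕ) : C2Bdd (r * a) (P ^ r) := by
  induction r with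
  | zero =>
    intro m
    rw [pow_zero, coeff_one]
    split_ifs <;> simp
  | succ r ih => rw [pow_succ, add_mul, one_mul]; exact ih.mul hP

theorem C2Bdd.prod {τ k ι : Type} [Field k] {a : ι → ℕ} {P : ι → (MvPolynomial τ k)[X]}
    (s : Finset ι) (hP : ∀ i, C2Bdd (a i) (P i)) : C2Bdd (∑ i ∈ s, a i) (∏ i ∈ s, P i) := by
  classical
  induction s using Finset.induction_on with
  | empty =>
    intro m
    rw [Finset.prod_empty, coeff_one]
    split_ifs <;> simp
  | insert i s hi ih => rw [Finset.sum_insert hi, Finset.prod_insert hi]; exact (hP i).mul ih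

theorem C2Bdd.sum {τ k ι : Type} [Field k] {a : ℕ} {P : ι → (MvPolynomial τ k)[X]}
    (s : Finset ι) (hP : ∀ i ∈ s, C2Bdd a (P i)) : C2Bdd a (∑ i ∈ s, P i) := by
  intro m
  rw [finsetSum_coeff]
  exact MvPolynomial.totalDegree_finsetSum_le fun i hi => hP i hi m

theorem C2_exact (p : ℕ) [Fact p.Prime] (d n N : ℕ) (hd : 0 < d) (hn : d ^ 2 < n)
    (S : Finset (Fin n →₀ ℕ)) (hS : ∀ s ∈ S, ∑ i, s i = d)
    (c : (Fin n →₀ ℕ) → (AlgebraicClosure (ZMod p))[X]) (hc : ∀ s, (c s).natDegree ≤ N) :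
    ∃ x : Fin n → (AlgebraicClosure (ZMod p))[X], x ≠ 0 ∧
      ∑ s ∈ S, c s * ∏ i, x i ^ s i = 0 := by
  classical
  set k := AlgebraicClosure (ZMod p)
  let N' := d * (N + 1) + 1
  let τ := Fin n × Fin N'
  let l : Fin n → (MvPolynomial τ k)[X] := fun i =>
    ∑ j : Fin N', Polynomial.C (MvPolynomial.X (i, j)) * Polynomial.X ^ (j : ℕ)
  let G : (MvPolynomial τ k)[X] :=
    ∑ s ∈ S, (c s).map MvPolynomial.C * ∏ i, l i ^ s i
  have hl : ∀ i, C2Bdd 1 (l i) := by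
    intro i
    refine C2Bdd.sum _ fun j _ m => ?_
    rw [coeff_C_mul, coeff_X_pow]
    split_ifs <;> simp
  have hld : ∀ i, (l i).natDegree ≤ N' - 1 := by
    intro i
    refine natDegree_sum_le_of_forall_le _ _ fun j _ => ?_
    refine (natDegree_C_mul_X_pow_le _ _).trans ?_
    have := j.2
    omega
  have hGd : C2Bdd d G := by
    refine C2Bdd.sum _ fun s hs => ?_
    have h1 : C2Bdd 0 ((c s).map (MvPolynomial.C : k →+* MvPolynomial τ k)) := by
      intro m; simp
    have h2 := h1.mul (C2Bdd.prod Finset.univ fun i => (hl i).pow (s i))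
    simpa [hS s hs] using h2
  have hGn : G.natDegree ≤ N + d * (N' - 1) := by
    refine natDegree_sum_le_of_forall_le _ _ fun s hs => ?_
    refine natDegree_mul_le.trans (add_le_add (natDegree_map_le.trans (hc s)) ?_)
    refine (natDegree_prod_le _ _).trans ?_
    rw [← hS s hs, Finset.sum_mul]
    exact Finset.sum_le_sum fun i _ => natDegree_pow_le.trans (Nat.mul_le_mul_left _ (hld i))
  have hev : ∀ v : τ → k, G.map (MvPolynomial.eval v) =
      ∑ s ∈ S, c s * ∏ i, (∑ j : Fin N', Polynomial.C (v (i, j)) * Polynomial.X ^ (j : ℕ)) ^ s i := by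
    intro v
    simp only [G, l, Polynomial.map_sum, Polynomial.map_mul, Polynomial.map_prod,
      Polynomial.map_pow, Polynomial.map_map, map_C, map_X, MvPolynomial.eval_X]
    refine Finset.sum_congr rfl fun s _ => ?_
    congr 1
    conv_rhs => rw [← Polynomial.map_id (p := c s)]
    congr 1
    ext; simp
  obtain ⟨v, hv, hv'⟩ := C2_cw p (Finset.range (N + d * (N' - 1) + 1)) (fun m => G.coeff m) (by
      refine (Finset.sum_le_card_nsmul _ _ d fun m _ => hGd m).trans_lt ?_
      simp only [Finset.card_range, smul_eq_mul, τ, Fintype.card_prod, Fintype.card_fin]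
      have : (d ^ 2 + 1) * N' ≤ n * N' := Nat.mul_le_mul_right _ hn
      refine lt_of_lt_of_le ?_ this
      simp only [N', Nat.add_sub_cancel]
      nlinarith [sq_nonneg d]) (by
      intro m _
      have := hev 0
      rw [← coeff_map, this]
      have : ∀ s ∈ S, c s * ∏ i, (∑ j : Fin N', Polynomial.C ((0 : τ → k) (i, j)) *
          Polynomial.X ^ (j : ℕ)) ^ s i = 0 := by
        intro s hs
        obtain ⟨i, hi⟩ : ∃ i, s i ≠ 0 := by
          by_contra! h
          have := hS s hs
          simp [h] at this
          omega
        rw [Finset.prod_eq_zero (Finset.mem_univ i), mul_zero]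
        simp [hi]
      rw [Finset.sum_eq_zero this, coeff_zero])
  refine ⟨fun i => ∑ j : Fin N', Polynomial.C (v (i, j)) * Polynomial.X ^ (j : ℕ), ?_, ?_⟩
  · intro h
    apply hv
    ext ⟨i, j⟩ : 1
    have := congrArg (fun P => coeff P (j : ℕ)) (congrFun h i)
    simpa [finsetSum_coeff, coeff_C_mul, coeff_X_pow, Fin.val_inj] using this
  · rw [← hev]
    ext m
    rw [coeff_map, coeff_zero]
    by_cases hm : m ∈ Finset.range (N + d * (N' - 1) + 1)
    · exact hv' m hm
    · rw [coeff_eq_zero_of_natDegree_lt, map_zero]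
      simp at hm
      omega

theorem C2_approx (p : ℕ) [Fact p.Prime] (d n N : ℕ) (hd : 0 < d) (hn : d ^ 2 < n)
    (f : MvPolynomial (Fin n) (PowerSeries (AlgebraicClosure (ZMod p)))) (hf : f.IsHomogeneous d) :
    ∃ x : Fin n → PowerSeries (AlgebraicClosure (ZMod p)),
      (∃ i, PowerSeries.coeff 0 (x i) ≠ 0) ∧ PowerSeries.X ^ N ∣ MvPolynomial.eval x f := by
  classical
  set k := AlgebraicClosure (ZMod p)
  have hS : ∀ s ∈ f.support, ∑ i, s i = d := by
    intro s hs
    have := hf (MvPolynomial.mem_support_iff.1 hs)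
    rw [← this, Finsupp.weight_apply, Finsupp.sum_fintype _ _ (by simp)]
    simp
  obtain ⟨x, hx, hx0⟩ := C2_exact p d n N hd hn f.support hS
    (fun s => PowerSeries.trunc N (f.coeff s)) (fun s => by
      exact natDegree_le_of_degree_le (PowerSeries.degree_trunc_lt _ N).le)
  have hex : ∃ m i, PowerSeries.coeff m (x i : PowerSeries k) ≠ 0 := by
    by_contra! h
    apply hx
    ext i m
    simpa using h m i
  let m := Nat.find hex
  have hm := Nat.find_spec hex
  have hdvd : ∀ i, ∃ z : PowerSeries k, (x i : PowerSeries k) = PowerSeries.X ^ m * z := by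
    intro i
    refine PowerSeries.X_pow_dvd_iff.2 fun j hj => ?_
    have := Nat.find_min hex hj
    push Not at this
    exact this i
  choose z hz using hdvd
  have key : ∑ s ∈ f.support, (PowerSeries.trunc N (f.coeff s) : PowerSeries k) *
      ∏ i, z i ^ s i = 0 := by
    have h1 : (PowerSeries.X ^ (m * d) : PowerSeries k) * ∑ s ∈ f.support,
      (PowerSeries.trunc N (f.coeff s) : PowerSeries k) * ∏ i, z i ^ s i = 0 := by
      have := congrArg (Polynomial.coeToPowerSeries.ringHom (R := k)) hx0
      simp only [map_sum, map_mul, map_prod, map_pow, map_zero, coeToPowerSeries.ringHom_apply,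
        hz] at this
      rw [← this, Finset.mul_sum]
      refine Finset.sum_congr rfl fun s hs => ?_
      simp only [mul_pow, Finset.prod_mul_distrib, ← pow_mul]
      rw [Finset.prod_pow_eq_pow_sum, ← Finset.mul_sum, hS s hs]
      ring
    exact (mul_eq_zero.1 h1).resolve_left (pow_ne_zero _ PowerSeries.X_ne_zero)
  refine ⟨z, ?_, ?_⟩
  · obtain ⟨i, hi⟩ := hm
    refine ⟨i, ?_⟩
    change PowerSeries.coeff m _ ≠ 0 at hi
    rwa [hz i, PowerSeries.coeff_X_pow_mul', if_pos le_rfl, Nat.sub_self] at hi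
  · rw [MvPolynomial.eval_eq', ← sub_zero (∑ s ∈ f.support, _), ← key, ← Finset.sum_sub_distrib]
    refine Finset.dvd_sum fun s _ => ?_
    rw [← sub_mul]
    refine Dvd.dvd.mul_right (PowerSeries.X_pow_dvd_iff.2 fun j hj => ?_) _
    simp [PowerSeries.coeff_trunc, hj]

end

section
open Polynomial

theorem C2_fixed {k : Type} [Field k] (g : PowerSeries k) (Ψ : (PowerSeries k)[X]) :
    ∃ z, z = g + PowerSeries.X * Ψ.eval z := by
  let Φ : PowerSeries k → PowerSeries k := fun z => g + PowerSeries.X * Ψ.eval z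
  have hΦ : ∀ n a b, PowerSeries.X ^ n ∣ a - b → PowerSeries.X ^ (n + 1) ∣ Φ a - Φ b := by
    rintro n a b h
    have : Φ a - Φ b = PowerSeries.X * (Ψ.eval a - Ψ.eval b) := by simp only [Φ]; ring
    rw [this, pow_succ']
    exact mul_dvd_mul_left _ (h.trans (sub_dvd_eval_sub _ _ _))
  let z : ℕ → PowerSeries k := fun n => Φ^[n] 0
  have hz : ∀ n, z (n + 1) = Φ (z n) := fun n => Function.iterate_succ_apply' _ _ _
  have h1 : ∀ n, PowerSeries.X ^ n ∣ z (n + 1) - z n := by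
    intro n
    induction n with
    | zero => simp
    | succ n ih => rw [hz (n + 1)]; nth_rw 2 [hz n]; exact hΦ _ _ _ ih
  have h2 : ∀ n j, PowerSeries.X ^ n ∣ z (n + j) - z n := by
    intro n j
    induction j with
    | zero => simp
    | succ j ih =>
      have := ((pow_dvd_pow PowerSeries.X (Nat.le_add_right n j)).trans (h1 (n + j))).add ih
      rwa [sub_add_sub_cancel] at this
  let w : PowerSeries k := PowerSeries.mk fun j => PowerSeries.coeff j (z (j + 1))
  have hw : ∀ n, PowerSeries.X ^ n ∣ w - z n := by
    intro n
    refine PowerSeries.X_pow_dvd_iff.2 fun j hj => ?_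
    obtain ⟨i, rfl⟩ := Nat.exists_eq_add_of_lt hj
    have := PowerSeries.X_pow_dvd_iff.1 (h2 (j + 1) i) j (Nat.lt_succ_self j)
    rw [map_sub, sub_eq_zero] at this
    rw [map_sub, PowerSeries.coeff_mk, ← this, add_right_comm, sub_self]
  refine ⟨w, ?_⟩
  change w = Φ w
  rw [← sub_eq_zero]
  ext n
  rw [map_zero]
  have := (hw (n + 1)).sub ((pow_dvd_pow _ (by omega)).trans (hΦ n _ _ (hw n)))
  rw [hz, sub_sub_sub_cancel_right] at this
  exact PowerSeries.X_pow_dvd_iff.1 this n (Nat.lt_succ_self n)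

theorem C2_hensel {k : Type} [Field k] (G : (PowerSeries k)[X]) (y u : PowerSeries k) (e r : ℕ)
    (hu : IsUnit u) (hG' : G.derivative.eval y = PowerSeries.X ^ e * u)
    (hG : PowerSeries.X ^ (2 * e + r + 1) ∣ G.eval y) :
    ∃ y', G.eval y' = 0 ∧ PowerSeries.X ^ (r + 1) ∣ y' - y := by
  obtain ⟨v, hv⟩ := hu.exists_right_inv
  obtain ⟨g, hg⟩ := hG
  obtain ⟨Q, hQ⟩ := Polynomial.binomExpansion (G.map Polynomial.C) (Polynomial.C y)
    (Polynomial.C (PowerSeries.X ^ (e + r + 1)) * Polynomial.X)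
  obtain ⟨z, hz⟩ := C2_fixed (-(v * g))
    (-(Polynomial.C (PowerSeries.X ^ r * v) * Polynomial.X ^ 2 * Q))
  refine ⟨y + PowerSeries.X ^ (e + r + 1) * z, ?_, ?_⟩
  · have := congrArg (Polynomial.eval z) hQ
    have e1 : ∀ (P : (PowerSeries k)[X]) (R : (PowerSeries k)[X]),
        Polynomial.eval z ((P.map Polynomial.C).eval R) = P.eval (R.eval z) := by
      intro P R
      rw [Polynomial.eval_map]; exact Polynomial.eval_comp
    rw [derivative_map] at this
    simp only [eval_add, eval_mul, eval_pow, e1, eval_C, eval_X] at this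
    rw [this, hg, hG']
    simp only [eval_neg, eval_mul, eval_pow, eval_C, eval_X] at hz
    have h3 : u * z = u * (-(v * g) + PowerSeries.X * -(PowerSeries.X ^ r * v * z ^ 2 * eval z Q)) :=
      congrArg _ hz
    have h4 : u * z = - g - PowerSeries.X ^ (r + 1) * z ^ 2 * eval z Q := by
      rw [h3]; linear_combination (-g - PowerSeries.X ^ (r + 1) * z ^ 2 * eval z Q) * hv
    linear_combination PowerSeries.X ^ (2 * e + r + 1) * h4
  · rw [add_sub_cancel_left]
    exact (pow_dvd_pow _ (by omega)).mul_right _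

end

section
open Polynomial

theorem C2_coeff_pow {k : Type} [Field k] (p : ℕ) [Fact p.Prime] [CharP k p] (b : PowerSeries k)
    (m : ℕ) : PowerSeries.coeff m (b ^ p) =
      if p ∣ m then (PowerSeries.coeff (m / p) b) ^ p else 0 := by
  have hp : p ≠ 0 := (Fact.out : p.Prime).ne_zero
  have h : PowerSeries.map (frobenius k p) (PowerSeries.expand p hp b) = b ^ p :=
    MvPowerSeries.map_frobenius_expand p hp
  rw [← h, PowerSeries.coeff_map, PowerSeries.coeff_expand]
  split_ifs
  · rfl
  · simp

theorem C2_coeff_sum {k : Type} [Field k] (p : ℕ) [Fact p.Prime] [CharP k p]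
    (b : Fin p → PowerSeries k) (m : ℕ) (j : Fin p) :
    PowerSeries.coeff (p * m + j) (∑ i : Fin p, PowerSeries.X ^ (i : ℕ) * b i ^ p) =
      (PowerSeries.coeff m (b j)) ^ p := by
  have hp : 0 < p := (Fact.out : p.Prime).pos
  rw [map_sum, Finset.sum_eq_single j]
  · rw [PowerSeries.coeff_X_pow_mul', if_pos (by omega), Nat.add_sub_cancel, C2_coeff_pow p,
      if_pos (dvd_mul_right _ _), Nat.mul_div_cancel_left _ hp]
  · intro i _ hij
    rw [PowerSeries.coeff_X_pow_mul']
    split_ifs with h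
    · rw [C2_coeff_pow p, if_neg]
      rintro ⟨q, hq⟩
      apply hij
      have h1 : p * m + j = p * q + i := by omega
      have h2 := congrArg (· % p) h1
      simp only [Nat.mul_add_mod, Nat.mod_eq_of_lt j.2, Nat.mod_eq_of_lt i.2] at h2
      exact Fin.ext h2.symm
    · rfl
  · simp

theorem C2_decomp {k : Type} [Field k] (p : ℕ) [Fact p.Prime] [CharP k p] [PerfectRing k p]
    (c : PowerSeries k) : ∃ b : Fin p → PowerSeries k,
      c = ∑ i : Fin p, PowerSeries.X ^ (i : ℕ) * b i ^ p := by
  have hp : 0 < p := (Fact.out : p.Prime).pos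
  have hs : ∀ a : k, ∃ b, b ^ p = a := fun a => by
    obtain ⟨b, hb⟩ := surjective_frobenius k p a
    exact ⟨b, hb⟩
  choose r hr using hs
  refine ⟨fun j => PowerSeries.mk fun m => r (PowerSeries.coeff (p * m + j) c), ?_⟩
  ext m
  have := C2_coeff_sum p (fun j : Fin p => PowerSeries.mk fun m => r (PowerSeries.coeff (p * m + j) c))
    (m / p) ⟨m % p, Nat.mod_lt _ hp⟩
  simp only [Nat.div_add_mod, PowerSeries.coeff_mk, hr] at this
  rw [this]

theorem C2_maclane {k κ L : Type} [Field k] [Field κ] [Algebra k κ] (p : ℕ) [Fact p.Prime]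
    [CharP k p] [CharP κ p] [PerfectRing k p]
    [Field L] [Algebra (PowerSeries κ) L] [IsFractionRing (PowerSeries κ) L]
    [Algebra (PowerSeries k) L] [IsScalarTower (PowerSeries k) (PowerSeries κ) L]
    {ι : Type} [Fintype ι] (v : ι → L) (hv : LinearIndependent (PowerSeries k) v) :
    LinearIndependent (PowerSeries k) (fun i => v i ^ p) := by
  classical
  have hp : 0 < p := (Fact.out : p.Prime).pos
  rw [Fintype.linearIndependent_iff] at hv ⊢
  intro c hc
  obtain ⟨b, hb⟩ := IsLocalization.exist_integer_multiples_of_finset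
    (nonZeroDivisors (PowerSeries κ)) (Finset.univ.image v)
  have hb' : ∀ i, ∃ w : PowerSeries κ, algebraMap _ L w = (b : PowerSeries κ) • v i := fun i =>
    hb (v i) (by simp)
  choose w hw using hb'
  choose a ha using fun i => C2_decomp p (c i)
  have hinj : Function.Injective (algebraMap (PowerSeries κ) L) := IsFractionRing.injective _ _
  have h1 : ∑ i, algebraMap (PowerSeries k) (PowerSeries κ) (c i) * w i ^ p = 0 := by
    apply hinj
    have : (algebraMap (PowerSeries κ) L b) ^ p * ∑ i, c i • v i ^ p = 0 := by rw [hc, mul_zero]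
    rw [map_zero, ← this, map_sum, Finset.mul_sum]
    refine Finset.sum_congr rfl fun i _ => ?_
    rw [map_mul, map_pow, hw, ← IsScalarTower.algebraMap_apply, Algebra.smul_def, Algebra.smul_def]
    ring
  have hX : ∀ j : ℕ, algebraMap (PowerSeries k) (PowerSeries κ) (PowerSeries.X ^ j) = PowerSeries.X ^ j := by
    intro j
    rw [PowerSeries.algebraMap_apply'', map_pow, PowerSeries.map_X]
  have : ExpChar (PowerSeries κ) p := by
    have : CharP (PowerSeries κ) p :=
      charP_of_injective_ringHom (PowerSeries.C_injective (R := κ)) p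
    infer_instance
  have h2 : ∑ j : Fin p, PowerSeries.X ^ (j : ℕ) *
      (∑ i, algebraMap (PowerSeries k) (PowerSeries κ) (a i j) * w i) ^ p = 0 := by
    rw [← h1]
    simp only [sum_pow_char, Finset.mul_sum, mul_pow]
    rw [Finset.sum_comm]
    refine Finset.sum_congr rfl fun i _ => ?_
    conv_rhs => rw [ha i]
    rw [map_sum, Finset.sum_mul]
    refine Finset.sum_congr rfl fun j _ => ?_
    rw [map_mul, hX, map_pow]
    ring
  have h3 : ∀ j : Fin p, ∑ i, algebraMap (PowerSeries k) (PowerSeries κ) (a i j) * w i = 0 := by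
    intro j
    ext m
    have := C2_coeff_sum p (fun j : Fin p =>
      ∑ i, algebraMap (PowerSeries k) (PowerSeries κ) (a i j) * w i) m j
    rw [h2, map_zero] at this
    rw [map_zero]
    exact pow_eq_zero_iff hp.ne' |>.1 this.symm
  have h4 : ∀ j i, a i j = 0 := by
    intro j
    apply hv
    have := congrArg (algebraMap (PowerSeries κ) L) (h3 j)
    rw [map_zero, map_sum] at this
    have hb0 : algebraMap (PowerSeries κ) L b ≠ 0 :=
      IsFractionRing.to_map_ne_zero_of_mem_nonZeroDivisors b.2
    refine (mul_eq_zero.1 (?_ : algebraMap (PowerSeries κ) L b * _ = 0)).resolve_left hb0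
    rw [← this, Finset.mul_sum]
    refine Finset.sum_congr rfl fun i _ => ?_
    rw [map_mul, hw, ← IsScalarTower.algebraMap_apply, Algebra.smul_def, Algebra.smul_def]
    ring
  intro i
  rw [ha i]
  simp [h4, hp.ne']

end

section
open Polynomial

/-- evaluation of a polynomial in `σ` variables and one more variable -/
noncomputable def C2ev {A R σ : Type} [CommRing A] [CommRing R] (φ : A →+* R) (s : σ → R) (y : R) :
    (MvPolynomial σ A)[X] →+* R :=
  Polynomial.eval₂RingHom (MvPolynomial.eval₂Hom φ s) y

theorem C2ev_comp {A R R' σ : Type} [CommRing A] [CommRing R] [CommRing R'] (φ : A →+* R)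
    (s : σ → R) (y : R) (ψ : R →+* R') (G : (MvPolynomial σ A)[X]) :
    ψ (C2ev φ s y G) = C2ev (ψ.comp φ) (fun i => ψ (s i)) (ψ y) G := by
  have : ψ.comp (C2ev φ s y) = C2ev (ψ.comp φ) (fun i => ψ (s i)) (ψ y) := by
    apply Polynomial.ringHom_ext'
    · apply MvPolynomial.ringHom_ext <;> intros <;> simp [C2ev]
    · simp [C2ev]
  exact DFunLike.congr_fun this G

theorem C2ev_eval {A R σ : Type} [CommRing A] [CommRing R] (φ : A →+* R) (s : σ → R) (y : R)
    (G : (MvPolynomial σ A)[X]) :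
    C2ev φ s y G = (G.map (MvPolynomial.eval₂Hom φ s)).eval y := by
  rw [Polynomial.eval_map]; rfl

theorem C2_sel {k κ ι : Type} [Field k] [Field κ] (π : (ℕ → k) →+* κ) (u : ℕ → k) (hu : π u ≠ 0)
    (S : Finset ι) (c : ι → ℕ → k) (hc : ∀ i ∈ S, π (c i) = 0) :
    ∃ N, u N ≠ 0 ∧ ∀ i ∈ S, c i N = 0 := by
  classical
  induction S using Finset.induction_on generalizing u with
  | empty =>
    by_contra! h
    apply hu
    have : u = 0 := funext fun N => by
      by_contra hN
      obtain ⟨i, hi, _⟩ := h N hN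
      simp at hi
    rw [this, map_zero]
  | insert i S hi ih =>
    let w : ℕ → k := fun N => if c i N = 0 then 1 else 0
    have hw : w + c i * (fun N => (c i N)⁻¹) = 1 := by
      funext N
      by_cases h : c i N = 0 <;> simp [w, h]
    have hw1 : π w = 1 := by
      have := congrArg π hw
      rwa [map_add, map_mul, hc i (Finset.mem_insert_self _ _), zero_mul, add_zero, map_one] at this
    obtain ⟨N, hN, hN'⟩ := ih (u * w) (by rwa [map_mul, hw1, mul_one])
      (fun j hj => hc j (Finset.mem_insert_of_mem hj))
    refine ⟨N, fun h => hN (by simp [h]), fun j hj => ?_⟩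
    rcases Finset.mem_insert.1 hj with rfl | hj
    · by_contra h
      exact hN (by simp [w, h])
    · exact hN' j hj

theorem C2_spec {k κ σ : Type} [Field k] [Field κ] [Algebra k κ] (π : (ℕ → k) →+* κ)
    (hπ : Function.Surjective π) (hπa : π.comp (algebraMap k (ℕ → k)) = algebraMap k κ)
    (G H : (MvPolynomial σ (PowerSeries k))[X]) (s : σ → PowerSeries κ) (y : PowerSeries κ)
    (hG : C2ev (algebraMap (PowerSeries k) (PowerSeries κ)) s y G = 0)
    (hG' : C2ev (algebraMap (PowerSeries k) (PowerSeries κ)) s y (derivative G) ≠ 0)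
    (hH : C2ev (algebraMap (PowerSeries k) (PowerSeries κ)) s y H ≠ 0) :
    ∃ (s' : σ → PowerSeries k) (y' : PowerSeries k),
      C2ev (RingHom.id _) s' y' G = 0 ∧ C2ev (RingHom.id _) s' y' H ≠ 0 := by
  classical
  have hsurj : ∀ b : PowerSeries κ, ∃ a : PowerSeries (ℕ → k), PowerSeries.map π a = b := by
    intro b
    choose r hr using hπ
    exact ⟨PowerSeries.mk fun m => r (PowerSeries.coeff m b), by ext m; simp [hr]⟩
  choose r hr using hsurj
  let φ : PowerSeries k →+* PowerSeries (ℕ → k) := PowerSeries.map (algebraMap k (ℕ → k))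
  let E : (MvPolynomial σ (PowerSeries k))[X] →+* PowerSeries (ℕ → k) :=
    C2ev φ (fun i => r (s i)) (r y)
  have hE : ∀ P, PowerSeries.map π (E P) =
      C2ev (algebraMap (PowerSeries k) (PowerSeries κ)) s y P := by
    intro P
    rw [C2ev_comp]
    simp only [hr]
    suffices h : (PowerSeries.map π).comp φ = algebraMap (PowerSeries k) (PowerSeries κ) by
      rw [h]
    refine RingHom.ext fun a => ?_
    ext m
    simp only [φ, RingHom.comp_apply, PowerSeries.coeff_map, PowerSeries.algebraMap_apply'']
    exact DFunLike.congr_fun hπa _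
  let ev : ℕ → PowerSeries (ℕ → k) →+* PowerSeries k := fun N =>
    PowerSeries.map (Pi.evalRingHom (fun _ => k) N)
  have hev : ∀ N P, ev N (E P) =
      C2ev (RingHom.id _) (fun i => ev N (r (s i))) (ev N (r y)) P := by
    intro N P
    rw [C2ev_comp]
    suffices h : (ev N).comp φ = RingHom.id _ by
      rw [h]
    refine RingHom.ext fun a => ?_
    ext m
    simp [φ, ev]
  have hcoeff : ∀ P m, π (PowerSeries.coeff m (E P)) =
      PowerSeries.coeff m (C2ev (algebraMap (PowerSeries k) (PowerSeries κ)) s y P) := by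
    intro P m
    rw [← hE, PowerSeries.coeff_map]
  obtain ⟨e, he, he'⟩ := PowerSeries.exists_coeff_ne_zero_iff_ne_zero.2 hG' |> fun h =>
    (⟨Nat.find h, Nat.find_spec h, fun m hm => not_not.1 (Nat.find_min h hm)⟩ :
      ∃ e, PowerSeries.coeff e (C2ev (algebraMap (PowerSeries k) (PowerSeries κ)) s y
        (derivative G)) ≠ 0 ∧ ∀ m < e, PowerSeries.coeff m
          (C2ev (algebraMap (PowerSeries k) (PowerSeries κ)) s y (derivative G)) = 0)
  obtain ⟨h, hh⟩ := PowerSeries.exists_coeff_ne_zero_iff_ne_zero.2 hH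
  obtain ⟨N, hN, hN'⟩ := C2_sel π
    (PowerSeries.coeff e (E (derivative G)) * PowerSeries.coeff h (E H))
    (by rw [map_mul, hcoeff, hcoeff]; exact mul_ne_zero he hh)
    ((Finset.range (2 * e + h + 1)).disjSum (Finset.range e))
    (Sum.elim (fun m => PowerSeries.coeff m (E G)) (fun m => PowerSeries.coeff m (E (derivative G))))
    (by
      rintro (m | m) hm
      · simp only [Sum.elim_inl]
        rw [hcoeff, hG, map_zero]
      · simp only [Sum.elim_inr]
        rw [hcoeff]
        exact he' m (by simpa using hm))
  have hevc : ∀ P m, PowerSeries.coeff m (ev N (E P)) = PowerSeries.coeff m (E P) N := by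
    intro P m; simp [ev]
  have hG1 : PowerSeries.X ^ (2 * e + h + 1) ∣ ev N (E G) := by
    refine PowerSeries.X_pow_dvd_iff.2 fun m hm => ?_
    rw [hevc]
    exact hN' (Sum.inl m) (by simpa using hm)
  have hD1 : PowerSeries.X ^ e ∣ ev N (E (derivative G)) := by
    refine PowerSeries.X_pow_dvd_iff.2 fun m hm => ?_
    rw [hevc]
    exact hN' (Sum.inr m) (by simpa using hm)
  obtain ⟨u, hu⟩ := hD1
  have huu : IsUnit u := by
    rw [PowerSeries.isUnit_iff_constantCoeff, isUnit_iff_ne_zero]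
    have := hevc (derivative G) e
    rw [hu, PowerSeries.coeff_X_pow_mul', if_pos le_rfl, Nat.sub_self,
      PowerSeries.coeff_zero_eq_constantCoeff] at this
    rw [this]
    intro h0
    exact hN (by rw [Pi.mul_apply, h0, zero_mul])
  rw [hev, C2ev_eval] at hG1 hu
  rw [← derivative_map] at hu
  obtain ⟨y', hy', hyy⟩ := C2_hensel _ _ u e h huu hu hG1
  refine ⟨fun i => ev N (r (s i)), y', by rw [C2ev_eval]; exact hy', fun h0 => hN ?_⟩
  rw [C2ev_eval] at h0
  have h1 := hyy.trans (Polynomial.sub_dvd_eval_sub y' (ev N (r y))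
    (H.map (MvPolynomial.eval₂Hom (RingHom.id _) fun i => ev N (r (s i)))))
  rw [h0, ← C2ev_eval, ← hev, zero_sub, dvd_neg] at h1
  have := PowerSeries.X_pow_dvd_iff.1 h1 h (Nat.lt_succ_self h)
  rw [hevc] at this
  rw [Pi.mul_apply, this, mul_zero]

theorem C2_core {A T F E : Type} [CommRing A] [CommRing T] [IsDomain T] [Field F] [Field E]
    [Algebra A T] [Algebra T F] [IsFractionRing T F] [Algebra F E] [Algebra T E]
    [IsScalarTower T F E] [Algebra A E] [IsScalarTower A T E]
    (d n : ℕ) (f : MvPolynomial (Fin n) A) (hf : f.IsHomogeneous d)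
    (x : Fin n → E) (hx : MvPolynomial.aeval x f = 0) (y : E) (hy : IsSeparable F y)
    (hxy : ∀ i, ∃ P : F[X], aeval y P = x i) :
    ∃ (G R : T[X]) (P : Fin n → T[X]) (q c : T), q ≠ 0 ∧ c ≠ 0 ∧ aeval y G = 0 ∧
      aeval y (derivative G) ≠ 0 ∧ (∀ i, aeval y (P i) = algebraMap T E q * x i) ∧
      C c * MvPolynomial.aeval P f = G * R := by
  classical
  have hinjF : Function.Injective (algebraMap T F) := IsFractionRing.injective T F
  have hnorm : ∀ Q : F[X], ∃ (b : T) (Q' : T[X]), b ≠ 0 ∧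
      Q'.map (algebraMap T F) = C (algebraMap T F b) * Q := by
    intro Q
    obtain ⟨b, hb, h⟩ := IsLocalization.integerNormalization_spec (nonZeroDivisors T) Q
    refine ⟨b, _, nonZeroDivisors.ne_zero hb, h.trans ?_⟩
    rw [← IsScalarTower.algebraMap_smul F b Q, Polynomial.smul_eq_C_mul]
  have hmap : ∀ Q : T[X], aeval y Q = aeval y (Q.map (algebraMap T F)) := fun Q =>
    (aeval_map_algebraMap F y Q).symm
  choose P0 hP0 using hxy
  choose b Q hb hQ using fun i => hnorm (P0 i)
  obtain ⟨g, G, hg, hG⟩ := hnorm (minpoly F y)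
  let q := ∏ i, b i
  have hq : q ≠ 0 := Finset.prod_ne_zero_iff.2 fun i _ => hb i
  let P : Fin n → T[X] := fun i => C (∏ j ∈ Finset.univ.erase i, b j) * Q i
  have hP : ∀ i, aeval y (P i) = algebraMap T E q * x i := by
    intro i
    simp only [P, q]
    rw [map_mul, hmap (Q i), hQ, map_mul, aeval_C, aeval_C, hP0, ← mul_assoc,
      ← IsScalarTower.algebraMap_apply, ← map_mul, Finset.prod_erase_mul _ _ (Finset.mem_univ i)]
  have hW : aeval y (MvPolynomial.aeval P f) = 0 := by
    have h1 : aeval y (MvPolynomial.aeval P f) = MvPolynomial.aeval (fun i => aeval y (P i)) f := by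
      have : ((aeval y : T[X] →ₐ[T] E).restrictScalars A).comp (MvPolynomial.aeval P) =
          MvPolynomial.aeval (fun i => aeval y (P i)) := by
        ext i; simp
      exact DFunLike.congr_fun this f
    rw [h1, MvPolynomial.aeval_def, MvPolynomial.eval₂_eq']
    rw [MvPolynomial.aeval_def, MvPolynomial.eval₂_eq'] at hx
    rw [← mul_zero ((algebraMap T E q) ^ d), ← hx, Finset.mul_sum]
    refine Finset.sum_congr rfl fun m hm => ?_
    have hmd : ∑ i, m i = d := by
      have := hf (MvPolynomial.mem_support_iff.1 hm)
      rw [← this, Finsupp.weight_apply, Finsupp.sum_fintype _ _ (by simp)]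
      simp
    simp only [hP, mul_pow, Finset.prod_mul_distrib]
    rw [Finset.prod_pow_eq_pow_sum, hmd]
    ring
  rw [hmap] at hW
  obtain ⟨R0, hR0⟩ := minpoly.dvd F y hW
  obtain ⟨r, R, hr, hR⟩ := hnorm R0
  refine ⟨G, R, P, q, g * r, hq, mul_ne_zero hg hr, ?_, ?_, hP, ?_⟩
  · rw [hmap, hG, map_mul, minpoly.aeval, mul_zero]
  · rw [hmap, ← derivative_map, hG, derivative_C_mul, map_mul, aeval_C]
    refine mul_ne_zero ?_ (Separable.aeval_derivative_ne_zero hy (minpoly.aeval F y))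
    rw [← IsScalarTower.algebraMap_apply, IsScalarTower.algebraMap_apply T F E]
    simpa using hg
  · apply Polynomial.map_injective _ hinjF
    rw [Polynomial.map_mul, Polynomial.map_mul, hR0, hG, hR]
    rw [map_C, map_mul, C_mul]
    ring

end

section
open Polynomial

theorem C2_clear {A K σ : Type} [CommRing A] [IsDomain A] [Field K] [Algebra A K]
    [IsFractionRing A K] (r : MvPolynomial σ K) :
    ∃ (a : A) (r' : MvPolynomial σ A), a ≠ 0 ∧
      MvPolynomial.map (algebraMap A K) r' = MvPolynomial.C (algebraMap A K a) * r := by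
  let := MvPolynomial.algebraMvPolynomial (R := A) (S := K) (σ := σ)
  obtain ⟨⟨r', ⟨m, hm⟩⟩, h⟩ := IsLocalization.surj
    ((nonZeroDivisors A).map (MvPolynomial.C (σ := σ))) r
  obtain ⟨a, ha, rfl⟩ := hm
  refine ⟨a, r', nonZeroDivisors.ne_zero ha, ?_⟩
  rw [mul_comm]
  have e : ∀ q, algebraMap (MvPolynomial σ A) (MvPolynomial σ K) q =
      MvPolynomial.map (algebraMap A K) q := fun q => rfl
  rw [e, e, MvPolynomial.map_C] at h
  exact h.symm

theorem C2_std {A K E σ : Type} [CommRing A] [IsDomain A] [Field K] [Algebra A K]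
    [IsFractionRing A K] [Field E] [Algebra K E] [Algebra A E] [IsScalarTower A K E]
    (s : σ → E) (hs : AlgebraicIndependent K s)
    (d n : ℕ) (f : MvPolynomial (Fin n) A) (hf : f.IsHomogeneous d)
    (x : Fin n → E) (hx : MvPolynomial.aeval x f = 0) (y : E)
    (hy : IsSeparable (IntermediateField.adjoin K (Set.range s)) y)
    (hxy : ∀ i, ∃ P : (IntermediateField.adjoin K (Set.range s))[X], aeval y P = x i) :
    ∃ (G R : (MvPolynomial σ A)[X]) (P : Fin n → (MvPolynomial σ A)[X]) (q c : MvPolynomial σ A),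
      MvPolynomial.aeval s q ≠ 0 ∧ MvPolynomial.aeval s c ≠ 0 ∧ C2ev (algebraMap A E) s y G = 0 ∧
      C2ev (algebraMap A E) s y (derivative G) ≠ 0 ∧
      (∀ i, C2ev (algebraMap A E) s y (P i) = MvPolynomial.aeval s q * x i) ∧
      C c * MvPolynomial.aeval P f = G * R := by
  let F := IntermediateField.adjoin K (Set.range s)
  have hsA : AlgebraicIndependent A s := hs.restrictScalars (IsFractionRing.injective A K)
  have hmem : ∀ r : MvPolynomial σ A, MvPolynomial.aeval s r ∈ F := by
    intro r
    have h1 : MvPolynomial.aeval s r ∈ Algebra.adjoin A (Set.range s) := by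
      rw [Algebra.adjoin_range_eq_range_aeval]; exact ⟨r, rfl⟩
    have h2 : Algebra.adjoin A (Set.range s) ≤ F.toSubalgebra.restrictScalars A :=
      Algebra.adjoin_le (IntermediateField.subset_adjoin K _)
    exact h2 h1
  let φ : MvPolynomial σ A →+* F :=
    (MvPolynomial.aeval (R := A) s).toRingHom.codRestrict F.toSubalgebra hmem
  let : Algebra (MvPolynomial σ A) F := φ.toAlgebra
  let : Algebra (MvPolynomial σ A) E := (MvPolynomial.aeval (R := A) s).toRingHom.toAlgebra
  have : IsScalarTower (MvPolynomial σ A) F E := IsScalarTower.of_algebraMap_eq fun r => rfl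
  have : IsScalarTower A (MvPolynomial σ A) E := IsScalarTower.of_algebraMap_eq fun r => by
    change _ = MvPolynomial.aeval s (MvPolynomial.C r)
    simp
  have hinjE : Function.Injective (algebraMap (MvPolynomial σ A) E) := hsA
  have : FaithfulSMul (MvPolynomial σ A) F := by
    rw [faithfulSMul_iff_algebraMap_injective]
    intro a b hab
    exact hinjE (congrArg Subtype.val hab)
  have : IsFractionRing (MvPolynomial σ A) F := by
    refine IsFractionRing.of_field _ _ fun z => ?_
    obtain ⟨r, t, hz⟩ := (IntermediateField.mem_adjoin_range_iff K s z.1).1 z.2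
    obtain ⟨a, r', ha, hr⟩ := C2_clear (A := A) r
    obtain ⟨b, t', hb, ht⟩ := C2_clear (A := A) t
    refine ⟨MvPolynomial.C b * r', MvPolynomial.C a * t', ?_⟩
    apply Subtype.ext
    rw [hz]
    change _ = MvPolynomial.aeval s (MvPolynomial.C b * r') / MvPolynomial.aeval s (MvPolynomial.C a * t')
    have h1 := congrArg (MvPolynomial.aeval (R := K) s) hr
    have h2 := congrArg (MvPolynomial.aeval (R := K) s) ht
    rw [MvPolynomial.aeval_map_algebraMap, map_mul, MvPolynomial.aeval_C,
      ← IsScalarTower.algebraMap_apply] at h1 h2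
    have hab : ∀ a : A, a ≠ 0 → algebraMap A E a ≠ 0 := by
      intro a ha
      rw [IsScalarTower.algebraMap_apply A K E]
      simpa using ha
    rw [map_mul, map_mul, h1, h2, MvPolynomial.aeval_C, MvPolynomial.aeval_C, ← mul_assoc,
      ← mul_assoc, mul_comm (algebraMap A E b), mul_div_mul_left]
    exact mul_ne_zero (hab a ha) (hab b hb)
  obtain ⟨G, R, P, q, c, hq, hc, h1, h2, h3, h4⟩ := C2_core (T := MvPolynomial σ A) (F := F) d n f hf x hx y hy hxy
  have hev : ∀ Q : (MvPolynomial σ A)[X], C2ev (algebraMap A E) s y Q = aeval y Q := fun Q => rfl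
  refine ⟨G, R, P, q, c, ?_, ?_, h1, h2, h3, h4⟩
  · exact fun h => hq (hinjE (h.trans (map_zero _).symm))
  · exact fun h => hc (hinjE (h.trans (map_zero _).symm))

end

section
open Polynomial

theorem C2_algInd_smul {K E σ : Type} [Field K] [Field E] [Algebra K E] (s : σ → E)
    (hs : AlgebraicIndependent K s) (c : σ → K) (hc : ∀ i, c i ≠ 0) :
    AlgebraicIndependent K (fun i => c i • s i) := by
  let g : MvPolynomial σ K →ₐ[K] MvPolynomial σ K :=
    MvPolynomial.aeval (fun i => MvPolynomial.C (c i) * MvPolynomial.X i)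
  let h : MvPolynomial σ K →ₐ[K] MvPolynomial σ K :=
    MvPolynomial.aeval (fun i => MvPolynomial.C (c i)⁻¹ * MvPolynomial.X i)
  have hgh : h.comp g = AlgHom.id K _ := by
    ext i
    simp [g, h, MvPolynomial.algHom_C, ← mul_assoc, ← MvPolynomial.C_mul, hc]
  have hg : Function.Injective g := by
    intro a b hab
    have := congrArg h hab
    rwa [← AlgHom.comp_apply, ← AlgHom.comp_apply, hgh] at this
  have e : MvPolynomial.aeval (R := K) (fun i => c i • s i) = (MvPolynomial.aeval s).comp g := by
    ext i
    simp [g, Algebra.smul_def]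
  rw [AlgebraicIndependent, e]
  rw [AlgHom.coe_comp]
  exact Function.Injective.comp (show Function.Injective (MvPolynomial.aeval (R := K) s) from hs) hg

theorem C2_prim {K E : Type} [Field K] [Field E] [Algebra K E] [Algebra.EssFiniteType K E]
    (s : Finset E) (hs : IsTranscendenceBasis K ((↑) : s → E))
    (hsep : Algebra.IsSeparable (IntermediateField.adjoin K (s : Set E)) E)
    (P : E → Prop) (hP : ∀ e, ∃ c : K, c ≠ 0 ∧ P (c • e)) :
    ∃ (σ : Type) (t : σ → E) (y : E), (∀ i, P (t i)) ∧ P y ∧ AlgebraicIndependent K t ∧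
      IsSeparable (IntermediateField.adjoin K (Set.range t)) y ∧
      ∀ e : E, ∃ Q : (IntermediateField.adjoin K (Set.range t))[X], aeval y Q = e := by
  choose c hc hcP using hP
  let t : s → E := fun i => c i • (i : E)
  have hF : IntermediateField.adjoin K (Set.range t) = IntermediateField.adjoin K (s : Set E) := by
    apply le_antisymm
    · rw [IntermediateField.adjoin_le_iff]
      rintro _ ⟨i, rfl⟩
      exact IntermediateField.smul_mem _ (IntermediateField.subset_adjoin K _ i.2)
    · rw [IntermediateField.adjoin_le_iff]
      intro e he
      have h1 : t ⟨e, he⟩ ∈ IntermediateField.adjoin K (Set.range t) :=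
        IntermediateField.subset_adjoin K _ ⟨_, rfl⟩
      have h2 := IntermediateField.smul_mem _ (x := (c e)⁻¹) h1
      simpa [t, smul_smul, hc] using h2
  rw [← hF] at hsep
  have : Algebra.EssFiniteType (IntermediateField.adjoin K (Set.range t)) E :=
    Algebra.EssFiniteType.of_comp K _ E
  have : Module.Finite (IntermediateField.adjoin K (Set.range t)) E :=
    Algebra.finite_of_essFiniteType_of_isAlgebraic
  obtain ⟨y, hy⟩ := Field.exists_primitive_element (IntermediateField.adjoin K (Set.range t)) E
  refine ⟨s, t, c y • y, fun i => hcP _, hcP _, C2_algInd_smul _ hs.1 _ fun i => hc _,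
    Algebra.IsSeparable.isSeparable _ _, ?_⟩
  have hy2 : Algebra.adjoin (IntermediateField.adjoin K (Set.range t)) {y} = ⊤ :=
    Algebra.adjoin_eq_top_of_primitive_element (Algebra.IsAlgebraic.isAlgebraic _) hy
  intro e
  have he : e ∈ Algebra.adjoin (IntermediateField.adjoin K (Set.range t)) {y} := by
    rw [hy2]; trivial
  rw [Algebra.adjoin_singleton_eq_range_aeval] at he
  obtain ⟨Q, rfl⟩ := he
  refine ⟨Q.comp (C (algebraMap K _ (c y)⁻¹) * X), ?_⟩
  change aeval _ _ = aeval y Q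
  rw [aeval_comp]
  congr 1
  simp only [map_mul, aeval_C, aeval_X]
  rw [← IsScalarTower.algebraMap_apply, ← Algebra.smul_def, smul_smul, inv_mul_cancel₀ (hc y), one_smul]

theorem C2_sepgen0 {A K L : Type} [CommRing A] [IsDomain A] (p : ℕ) [Fact p.Prime] [CharP A p]
    [Field K] [Algebra A K] [IsFractionRing A K] [Field L] [Algebra A L] [Algebra K L]
    [IsScalarTower A K L]
    (H : ∀ (ι : Type) [Fintype ι] (v : ι → L), LinearIndependent A v →
      LinearIndependent A (fun i => v i ^ p))
    (E : IntermediateField K L) [Algebra.EssFiniteType K E] :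
    ∃ s : Finset E, IsTranscendenceBasis K ((↑) : s → E) ∧
      Algebra.IsSeparable (IntermediateField.adjoin K (s : Set E)) E := by
  have : CharP K p := charP_of_injective_algebraMap (IsFractionRing.injective A K) p
  have : ExpChar K p := .prime Fact.out
  refine exists_isTranscendenceBasis_and_isSeparable_of_linearIndepOn_pow_of_essFiniteType p Fact.out
    fun s hs ↦ ?_
  have hinj : Function.Injective E.val.toLinearMap := E.val.injective
  have h1 : LinearIndependent K (fun i : s => ((i : E) : L)) := by
    exact LinearIndependent.map' hs E.val.toLinearMap (LinearMap.ker_eq_bot.2 hinj)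
  have h2 := H s _ ((LinearIndependent.iff_fractionRing A K).2 h1)
  rw [LinearIndependent.iff_fractionRing A K] at h2
  exact LinearIndependent.of_comp E.val.toLinearMap h2

theorem C2_sepgen {k κ K L : Type} [Field k] [Field κ] [Algebra k κ] (p : ℕ) [Fact p.Prime] [CharP k p] [CharP κ p]
    [PerfectRing k p] [Field K] [Algebra (PowerSeries k) K] [IsFractionRing (PowerSeries k) K] [Field L]
    [Algebra (PowerSeries κ) L] [IsFractionRing (PowerSeries κ) L]
    [Algebra (PowerSeries k) L] [IsScalarTower (PowerSeries k) (PowerSeries κ) L] [Algebra K L]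
    [IsScalarTower (PowerSeries k) K L] (E : IntermediateField K L) [Algebra.EssFiniteType K E] :
    ∃ s : Finset E, IsTranscendenceBasis K ((↑) : s → E) ∧
      Algebra.IsSeparable (IntermediateField.adjoin K (s : Set E)) E := by
  have : CharP (PowerSeries k) p := charP_of_injective_algebraMap (algebraMap k (PowerSeries k)).injective p
  exact C2_sepgen0 (A := PowerSeries k) p
    (fun ι _ v hv => C2_maclane (k := k) (κ := κ) p v hv) E

end

section
open Polynomial

theorem C2_den {κ L : Type} [Field κ] [Field L]
    [Algebra (PowerSeries κ) L] [IsFractionRing (PowerSeries κ) L] (e : L) :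
    ∃ (m : ℕ) (b : PowerSeries κ), algebraMap (PowerSeries κ) L b =
      algebraMap (PowerSeries κ) L (PowerSeries.X ^ m) * e := by
  obtain ⟨a, b, hb, rfl⟩ := IsFractionRing.div_surjective (A := PowerSeries κ) e
  obtain ⟨m, u, hu⟩ := IsDiscreteValuationRing.eq_unit_mul_pow_irreducible
    (nonZeroDivisors.ne_zero hb) (PowerSeries.X_irreducible (R := κ))
  refine ⟨m, a * ((u⁻¹ : (PowerSeries κ)ˣ) : PowerSeries κ), ?_⟩
  have hb0 : algebraMap (PowerSeries κ) L b ≠ 0 :=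
    IsFractionRing.to_map_ne_zero_of_mem_nonZeroDivisors hb
  rw [mul_div_assoc', eq_div_iff hb0, ← map_mul, ← map_mul]
  congr 1
  rw [hu]
  calc a * ((u⁻¹ : (PowerSeries κ)ˣ) : PowerSeries κ) * ((u : PowerSeries κ) * PowerSeries.X ^ m)
      = a * (((u⁻¹ : (PowerSeries κ)ˣ) : PowerSeries κ) * (u : PowerSeries κ)) * PowerSeries.X ^ m := by ring
    _ = _ := by rw [Units.inv_mul]; ring

/-- Everything needed, with an abstract pair of rings `A`, `B`. -/
theorem C2_down {A B K L : Type} [CommRing A] [IsDomain A] [CommRing B] [Field K]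
    [Algebra A K] [IsFractionRing A K] [Field L] [Algebra A B] [Algebra B L]
    (hBL : Function.Injective (algebraMap B L))
    [Algebra A L] [IsScalarTower A B L] [Algebra K L] [IsScalarTower A K L]
    (hgen : ∀ E : IntermediateField K L, Algebra.EssFiniteType K E →
      ∃ s : Finset E, IsTranscendenceBasis K ((↑) : s → E) ∧
      Algebra.IsSeparable (IntermediateField.adjoin K (s : Set E)) E)
    (hden : ∀ e : L, ∃ c : K, c ≠ 0 ∧ ∃ b : B, algebraMap B L b = c • e)
    (hspec : ∀ (σ : Type) (G H : (MvPolynomial σ A)[X]) (s : σ → B) (y : B),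
      C2ev (algebraMap A B) s y G = 0 → C2ev (algebraMap A B) s y (derivative G) ≠ 0 →
      C2ev (algebraMap A B) s y H ≠ 0 → ∃ (s' : σ → A) (y' : A),
      C2ev (RingHom.id _) s' y' G = 0 ∧ C2ev (RingHom.id _) s' y' H ≠ 0)
    (d n : ℕ) (f : MvPolynomial (Fin n) A) (hf : f.IsHomogeneous d)
    (x : Fin n → B) (hx : MvPolynomial.aeval x f = 0) (j : Fin n) (hj : x j ≠ 0) :
    ∃ z : Fin n → A, z ≠ 0 ∧ MvPolynomial.eval z f = 0 := by
  let xL : Fin n → L := fun i => algebraMap B L (x i)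
  let E := IntermediateField.adjoin K (Set.range xL)
  have hE : Algebra.EssFiniteType K E := by
    rw [IntermediateField.essFiniteType_iff]
    exact IntermediateField.fg_adjoin_of_finite (Set.finite_range _)
  have hT : IsScalarTower A E L := IsScalarTower.of_algebraMap_eq fun r => rfl
  obtain ⟨s0, hs0, hs0'⟩ := hgen E hE
  obtain ⟨σ, t, y, ht, hy, hind, hsep, hpr⟩ := C2_prim s0 hs0 hs0'
    (fun e => ∃ b : B, algebraMap B L b = (e : L)) (fun e => hden e)
  choose tB htB using ht
  obtain ⟨yB, hyB⟩ := hy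
  let xE : Fin n → E := fun i => ⟨xL i, IntermediateField.subset_adjoin K _ ⟨i, rfl⟩⟩
  have hxE : MvPolynomial.aeval xE f = 0 := by
    apply Subtype.val_injective
    have h1 : ((MvPolynomial.aeval xE f : E) : L) = MvPolynomial.aeval xL f := by
      exact (MvPolynomial.aeval_algebraMap_apply (B := L) xE f).symm
    have h2 : MvPolynomial.aeval xL f = algebraMap B L (MvPolynomial.aeval x f) :=
      MvPolynomial.aeval_algebraMap_apply (B := L) x f
    rw [h1, h2, hx, map_zero]; rfl
  obtain ⟨G, R, P, q, c, hq, hc, hG, hG', hP, hid⟩ :=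
    C2_std t hind d n f hf xE hxE y hsep fun i => hpr _
  have key : ∀ Q : (MvPolynomial σ A)[X], algebraMap B L (C2ev (algebraMap A B) tB yB Q) =
      ((C2ev (algebraMap A E) t y Q : E) : L) := by
    intro Q
    have h2 := C2ev_comp (algebraMap A E) t y (algebraMap E L) Q
    rw [← IsScalarTower.algebraMap_eq A E L] at h2
    rw [C2ev_comp, ← IsScalarTower.algebraMap_eq, hyB]
    simp_rw [htB]
    exact h2.symm
  have key0 : ∀ Q : (MvPolynomial σ A)[X], C2ev (algebraMap A B) tB yB Q = 0 ↔
      C2ev (algebraMap A E) t y Q = 0 := by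
    intro Q
    rw [← map_eq_zero_iff _ hBL, key]
    exact ZeroMemClass.coe_eq_zero
  have hCc : C2ev (algebraMap A E) t y (C c) = MvPolynomial.aeval t c := by
    simp [C2ev]; rfl
  obtain ⟨s', y', h1, h2⟩ := hspec σ G (C c * P j) tB yB ((key0 _).2 hG)
    (fun h => hG' ((key0 _).1 h)) (by
      intro h
      rw [key0, map_mul, hCc, hP] at h
      refine mul_ne_zero hc (mul_ne_zero hq ?_) h
      intro h
      apply hj
      apply hBL
      rw [map_zero]
      exact congrArg Subtype.val h)
  rw [map_mul] at h2
  refine ⟨fun i => C2ev (RingHom.id _) s' y' (P i), ?_, ?_⟩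
  · intro h
    exact right_ne_zero_of_mul h2 (congrFun h j)
  · have h3 := congrArg (C2ev (RingHom.id A) s' y') hid
    rw [map_mul, map_mul, h1, zero_mul] at h3
    have h4 := (mul_eq_zero.1 h3).resolve_left (left_ne_zero_of_mul h2)
    rw [← h4]
    have h5 : (C2ev (RingHom.id A) s' y').comp (MvPolynomial.aeval P : _ →ₐ[A] _).toRingHom =
        MvPolynomial.eval (fun i => C2ev (RingHom.id _) s' y' (P i)) := by
      apply MvPolynomial.ringHom_ext
      · intro r
        simp [C2ev, IsScalarTower.algebraMap_apply A (MvPolynomial σ A) (MvPolynomial σ A)[X]]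
      · intro i
        simp
    exact (RingHom.congr_fun h5 f).symm

end

section
open Polynomial

theorem C2_ultra (k : Type) [Field k] : ∃ (κ : Type) (_ : Field κ) (π : (ℕ → k) →+* κ),
    Function.Surjective π ∧ ∀ (g : ℕ → k) (m : ℕ), (∀ N ≥ m, g N = 0) → π g = 0 := by
  let I : Ideal (ℕ → k) :=
    { carrier := {g | ∃ m, ∀ N ≥ m, g N = 0}
      zero_mem' := ⟨0, fun _ _ => rfl⟩
      add_mem' := by
        rintro a b ⟨m, hm⟩ ⟨m', hm'⟩
        exact ⟨max m m', fun N hN => by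
          simp [hm N (le_trans (le_max_left _ _) hN), hm' N (le_trans (le_max_right _ _) hN)]⟩
      smul_mem' := by
        rintro a b ⟨m, hm⟩
        exact ⟨m, fun N hN => by simp [hm N hN]⟩ }
  have hI : I ≠ ⊤ := by
    rw [Ideal.ne_top_iff_one]
    rintro ⟨m, hm⟩
    exact one_ne_zero (hm m le_rfl)
  obtain ⟨M, hM, hIM⟩ := Ideal.exists_le_maximal I hI
  exact ⟨(ℕ → k) ⧸ M, Ideal.Quotient.field M, Ideal.Quotient.mk M, Ideal.Quotient.mk_surjective,
    fun g m h => Ideal.Quotient.eq_zero_iff_mem.2 (hIM ⟨m, h⟩)⟩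

theorem C2_limit {k κ : Type} [Field k] [Field κ] [Algebra k κ] (π : (ℕ → k) →+* κ)
    (hπ0 : ∀ (g : ℕ → k) (m : ℕ), (∀ N ≥ m, g N = 0) → π g = 0)
    (hπa : π.comp (algebraMap k (ℕ → k)) = algebraMap k κ) (n : ℕ)
    (f : MvPolynomial (Fin n) (PowerSeries k)) (x : ℕ → Fin n → PowerSeries k)
    (hx0 : ∀ N, ∃ i, PowerSeries.coeff 0 (x N i) ≠ 0)
    (hx : ∀ N, PowerSeries.X ^ N ∣ MvPolynomial.eval (x N) f) :
    ∃ (z : Fin n → PowerSeries κ) (j : Fin n), z j ≠ 0 ∧ MvPolynomial.aeval z f = 0 := by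
  let xh : Fin n → PowerSeries (ℕ → k) := fun i => PowerSeries.mk fun m N => PowerSeries.coeff m (x N i)
  let z : Fin n → PowerSeries κ := fun i => PowerSeries.map π (xh i)
  have hj : ∃ j, z j ≠ 0 := by
    by_contra! h
    obtain ⟨N, -, hN⟩ := C2_sel π 1 (by simp) Finset.univ (fun i N => PowerSeries.coeff 0 (x N i))
      (by
        intro i _
        have := congrArg (PowerSeries.coeff 0) (h i)
        simpa only [z, xh, PowerSeries.coeff_map, PowerSeries.coeff_mk, map_zero] using this)
    obtain ⟨i, hi⟩ := hx0 N
    exact hi (hN i (Finset.mem_univ _))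
  obtain ⟨j, hj⟩ := hj
  refine ⟨z, j, hj, ?_⟩
  let w := MvPolynomial.eval₂ (PowerSeries.map (algebraMap k (ℕ → k))) xh f
  have h1 : MvPolynomial.aeval z f = PowerSeries.map π w := by
    rw [MvPolynomial.aeval_def, MvPolynomial.hom_eval₂]
    congr 1
    rw [← PowerSeries.map_comp, hπa]
    rfl
  have h2 : ∀ N, PowerSeries.map (Pi.evalRingHom (fun _ : ℕ => k) N) w = MvPolynomial.eval (x N) f := by
    intro N
    rw [MvPolynomial.hom_eval₂]
    have e : (PowerSeries.map (Pi.evalRingHom (fun _ : ℕ => k) N)).comp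
        (PowerSeries.map (algebraMap k (ℕ → k))) = RingHom.id _ := by
      rw [← PowerSeries.map_comp]
      exact RingHom.ext fun a => congrFun (PowerSeries.map_id (R := k)) a
    rw [e, MvPolynomial.eval, MvPolynomial.coe_eval₂Hom]
    congr 1
    funext i
    ext m
    simp [xh]
  rw [h1]
  ext m
  rw [PowerSeries.coeff_map, map_zero]
  apply hπ0 _ (m + 1)
  intro N hN
  have h3 : PowerSeries.coeff m w N =
      PowerSeries.coeff m (PowerSeries.map (Pi.evalRingHom (fun _ : ℕ => k) N) w) := by
    rw [PowerSeries.coeff_map]; rfl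
  rw [h3, h2]
  exact PowerSeries.X_pow_dvd_iff.1 (hx N) m hN

theorem C2_lift0 {k κ K L : Type} [Field k] [Field κ] [Algebra k κ] (p : ℕ) [Fact p.Prime] [CharP k p] [CharP κ p]
    [PerfectRing k p] [Field K] [Algebra (PowerSeries k) K] [IsFractionRing (PowerSeries k) K] [Field L]
    [Algebra (PowerSeries κ) L] [IsFractionRing (PowerSeries κ) L]
    [Algebra (PowerSeries k) L] [IsScalarTower (PowerSeries k) (PowerSeries κ) L] [Algebra K L]
    [IsScalarTower (PowerSeries k) K L] (π : (ℕ → k) →+* κ) (hπ : Function.Surjective π)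
    (hπa : π.comp (algebraMap k (ℕ → k)) = algebraMap k κ) (d n : ℕ)
    (f : MvPolynomial (Fin n) (PowerSeries k)) (hf : f.IsHomogeneous d)
    (x : Fin n → PowerSeries κ) (hx : MvPolynomial.aeval x f = 0) (j : Fin n) (hj : x j ≠ 0) :
    ∃ z : Fin n → PowerSeries k, z ≠ 0 ∧ MvPolynomial.eval z f = 0 := by
  refine C2_down (K := K) (L := L) (IsFractionRing.injective (PowerSeries κ) L)
    (fun E hE => C2_sepgen (k := k) (κ := κ) p E) ?_
    (fun σ G H s y h1 h2 h3 => C2_spec π hπ hπa G H s y h1 h2 h3) d n f hf x hx j hj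
  intro e
  obtain ⟨m, b, hb⟩ := C2_den (κ := κ) e
  refine ⟨algebraMap (PowerSeries k) K (PowerSeries.X ^ m), ?_, b, ?_⟩
  · rw [Ne, map_eq_zero_iff _ (IsFractionRing.injective (PowerSeries k) K)]
    exact pow_ne_zero _ PowerSeries.X_ne_zero
  · rw [hb, Algebra.smul_def, ← IsScalarTower.algebraMap_apply,
      IsScalarTower.algebraMap_apply (PowerSeries k) (PowerSeries κ) L]
    congr 2
    rw [PowerSeries.algebraMap_apply'']
    simp

theorem C2_lift {k : Type} [Field k] (p : ℕ) [Fact p.Prime] [CharP k p]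
    [PerfectRing k p] (d n : ℕ)
    (f : MvPolynomial (Fin n) (PowerSeries k)) (hf : f.IsHomogeneous d)
    (x : ℕ → Fin n → PowerSeries k)
    (hx0 : ∀ N, ∃ i, PowerSeries.coeff 0 (x N i) ≠ 0)
    (hx : ∀ N, PowerSeries.X ^ N ∣ MvPolynomial.eval (x N) f) :
    ∃ z : Fin n → PowerSeries k, z ≠ 0 ∧ MvPolynomial.eval z f = 0 := by
  obtain ⟨κ, _, π, hπ, hπ0⟩ := C2_ultra k
  let _ : Algebra k κ := (π.comp (algebraMap k (ℕ → k))).toAlgebra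
  have hπa : π.comp (algebraMap k (ℕ → k)) = algebraMap k κ := rfl
  have : CharP κ p := charP_of_injective_algebraMap (algebraMap k κ).injective p
  obtain ⟨z, j, hj, hz⟩ := C2_limit π hπ0 hπa n f x hx0 hx
  have hinj : Function.Injective (algebraMap (PowerSeries k) (PowerSeries κ)) :=
    PowerSeries.map_injective _ (algebraMap k κ).injective
  have hψ : Function.Injective (algebraMap (PowerSeries k) (FractionRing (PowerSeries κ))) := by
    rw [IsScalarTower.algebraMap_eq (PowerSeries k) (PowerSeries κ)]
    exact (IsFractionRing.injective (PowerSeries κ) _).comp hinj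
  let i3 : Algebra (FractionRing (PowerSeries k)) (FractionRing (PowerSeries κ)) :=
    (IsFractionRing.lift hψ).toAlgebra
  have i4 : IsScalarTower (PowerSeries k) (FractionRing (PowerSeries k)) (FractionRing (PowerSeries κ)) :=
    IsScalarTower.of_algebraMap_eq fun r => (IsFractionRing.lift_algebraMap hψ r).symm
  exact C2_lift0 (K := FractionRing (PowerSeries k)) (L := FractionRing (PowerSeries κ))
    p π hπ hπa d n f hf z hz j hj

theorem C2_series (p : ℕ) [Fact p.Prime] (d n : ℕ) (hd : 0 < d) (hn : d ^ 2 < n)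
    (f : MvPolynomial (Fin n) (PowerSeries (AlgebraicClosure (ZMod p)))) (hf : f.IsHomogeneous d) :
    ∃ z : Fin n → PowerSeries (AlgebraicClosure (ZMod p)), z ≠ 0 ∧ MvPolynomial.eval z f = 0 := by
  choose x hx0 hx using fun N => C2_approx p d n N hd hn f hf
  have hk1 : CharP (AlgebraicClosure (ZMod p)) p := inferInstance
  have hk2 : PerfectRing (AlgebraicClosure (ZMod p)) p := inferInstance
  exact C2_lift p d n f hf x hx0 hx

theorem C2_frac {A K : Type} [CommRing A] [IsDomain A] [Field K] [Algebra A K]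
    [IsFractionRing A K] (d n : ℕ)
    (H : ∀ f : MvPolynomial (Fin n) A, f.IsHomogeneous d →
      ∃ z : Fin n → A, z ≠ 0 ∧ MvPolynomial.eval z f = 0)
    (f : MvPolynomial (Fin n) K) (hf : f.IsHomogeneous d) :
    ∃ z : Fin n → K, z ≠ 0 ∧ MvPolynomial.eval z f = 0 := by
  obtain ⟨a, g, ha, hg⟩ := C2_clear (A := A) f
  have hinj := IsFractionRing.injective A K
  have ha' : algebraMap A K a ≠ 0 := by rwa [Ne, map_eq_zero_iff _ hinj]
  have hgh : g.IsHomogeneous d := by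
    intro m hm
    apply hf
    intro h0
    have := congrArg (MvPolynomial.coeff m) hg
    rw [MvPolynomial.coeff_map, MvPolynomial.coeff_C_mul, h0, mul_zero, map_eq_zero_iff _ hinj] at this
    exact hm this
  obtain ⟨z, hz, h⟩ := H g hgh
  refine ⟨fun i => algebraMap A K (z i), ?_, ?_⟩
  · intro h0
    apply hz
    funext i
    apply hinj
    rw [congrFun h0 i, Pi.zero_apply, Pi.zero_apply, map_zero]
  · have h1 := congrArg (MvPolynomial.eval fun i => algebraMap A K (z i)) hg
    rw [map_mul, MvPolynomial.eval_C, MvPolynomial.eval_map] at h1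
    have h2 : MvPolynomial.eval₂ (algebraMap A K) (fun i => algebraMap A K (z i)) g =
        algebraMap A K (MvPolynomial.eval z g) :=
      (MvPolynomial.eval₂_comp (algebraMap A K) z g).symm
    rw [h2, h, map_zero] at h1
    exact (mul_eq_zero.1 h1.symm).resolve_left ha'

end

theorem laurentSeries_algClosure_C2 (p : ℕ) [Fact p.Prime] (d n : ℕ) (hd : 0 < d)
    (hn : d ^ 2 < n)
    (f : MvPolynomial (Fin n) (LaurentSeries (AlgebraicClosure (ZMod p))))
    (hf : f.IsHomogeneous d) :
    ∃ x : Fin n → LaurentSeries (AlgebraicClosure (ZMod p)),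
      x ≠ 0 ∧ MvPolynomial.eval x f = 0 := by
  exact C2_frac (A := PowerSeries (AlgebraicClosure (ZMod p))) d n
    (fun g hg => C2_series p d n hd hn g hg) f hf
end
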